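/- arXiv:1908.00092 — 3 statements merged into one kernel-verified Lean document; each statement's English description precedes it below -/
import Mathlib

section
/- Let r ≥ 2, let F be an r-graph, and let k be an integer satisfying the Ramsey condition for F. For every ε > 0 there exist δ > 0 and N such that for every n ≥ N and every Berge-F-free hypergraph H on n vertices in which every hyperedge has size at least k and at most δ·n, we have ∑_{h ∈ E(H)} |h|^r ≤ ε · n^r. -/
open Finset


/-- `H` contains (a subhypergraph which is) a Berge copy of `F`. -/
def ContainsBerge {α β : Type*} [DecidableEq α] [DecidableEq β]
    (F : Finset (Finset α)) (H : Finset (Finset β)) : Prop :=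
  ∃ (φ : α → β) (f : Finset α → Finset β),
    Function.Injective φ ∧ Set.InjOn f (F : Set (Finset α)) ∧
    (∀ e ∈ F, f e ∈ H) ∧ (∀ e ∈ F, e.image φ ⊆ f e)

/-- `G` contains a subhypergraph isomorphic to `F`. -/
def CopyIn {α β : Type*} [DecidableEq α] [DecidableEq β]
    (F : Finset (Finset α)) (G : Finset (Finset β)) : Prop :=
  ∃ φ : α → β, Function.Injective φ ∧ ∀ e ∈ F, e.image φ ∈ G

noncomputable def exBerge {α : Type*} [DecidableEq α] (r n : ℕ) (F : Finset (Finset α)) : ℕ :=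
  sSup {m | ∃ H : Finset (Finset (Fin n)),
    (∀ e ∈ H, e.card = r) ∧ ¬ ContainsBerge F H ∧ H.card = m}

noncomputable def exForb {α : Type*} [DecidableEq α] (r n : ℕ) (F : Finset (Finset α)) : ℕ :=
  sSup {m | ∃ H : Finset (Finset (Fin n)),
    (∀ e ∈ H, e.card = r) ∧ ¬ CopyIn F H ∧ H.card = m}

/-- number of `r`-sets of vertices all of whose `k`-subsets are edges of `G`,
i.e. the number of copies of the complete `k`-graph on `r` vertices in `G`. -/
def cliqueCount (k r : ℕ) {n : ℕ} (G : Finset (Finset (Fin n))) : ℕ :=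
  (((Finset.univ : Finset (Fin n)).powersetCard r).filter
    (fun S => ∀ e ∈ S.powersetCard k, e ∈ G)).card

noncomputable def exGenClique {α : Type*} [DecidableEq α] (k r n : ℕ)
    (F : Finset (Finset α)) : ℕ :=
  sSup {m | ∃ G : Finset (Finset (Fin n)),
    (∀ e ∈ G, e.card = k) ∧ ¬ CopyIn F G ∧ cliqueCount k r G = m}

/-- `k ≥ R^(r)(F,F)`: every 2-coloring of the `r`-subsets of a `k`-set has a
monochromatic copy of `F`. -/
def RamseyProp {α : Type*} [DecidableEq α] (k r : ℕ) (F : Finset (Finset α)) : Prop :=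
  ∀ χ : Finset (Fin k) → Bool, ∃ c : Bool,
    CopyIn F (((Finset.univ : Finset (Fin k)).powersetCard r).filter (fun e => χ e = c))

def rShadow {β : Type*} [DecidableEq β] (r : ℕ) (H : Finset (Finset β)) : Finset (Finset β) :=
  H.biUnion (fun h => h.powersetCard r)

/-- the `k`-uniform expansion of a graph: add `k-2` new distinct vertices to each edge. -/
def expansion {α : Type*} [DecidableEq α] (k : ℕ) (F0 : Finset (Finset α)) :
    Finset (Finset (α ⊕ Finset α × Fin (k - 2))) :=
  F0.image (fun e =>
    e.image Sum.inl ∪ (Finset.univ : Finset (Fin (k - 2))).image (fun i => Sum.inr (e, i)))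

/-- Turán hypergraph `T^r(n,q)`: partition `Fin n` into `q` parts (residues mod `q`),
edges are the `r`-sets meeting every part at most once. -/
def turanEdges (r n q : ℕ) : Finset (Finset (Fin n)) :=
  ((Finset.univ : Finset (Fin n)).powersetCard r).filter
    (fun S => ∀ u ∈ S, ∀ v ∈ S, (u : ℕ) % q = (v : ℕ) % q → u = v)

def Colorable2 {α : Type*} (F0 : Finset (Finset α)) (t : ℕ) : Prop :=
  ∃ c : α → Fin t, ∀ e ∈ F0, ∀ u ∈ e, ∀ v ∈ e, u ≠ v → c u ≠ c v

/-- number of subhypergraphs of `G` isomorphic to `F`. -/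
def copyCount {α β : Type*} [Fintype α] [DecidableEq α] [Fintype β] [DecidableEq β]
    (F : Finset (Finset α)) (G : Finset (Finset β)) : ℕ :=
  (G.powerset.filter (fun G' => ∃ φ : α → β, Function.Injective φ ∧
      G' = F.image (fun e => e.image φ))).card

section

open MeasureTheory Filter Topology

namespace Loeb

variable {W : ℕ → Type*}

/-- Sequences of points of the finite spaces `W m`; the carrier of the Loeb space. -/
def Space (W : ℕ → Type*) : Type _ := ∀ m, W m

/-- The internal set determined by a sequence of sets. -/
def internal (A : ∀ m, Set (W m)) : Set (Space W) :=
  {x | ∀ᶠ m in hyperfilter ℕ, x m ∈ A m}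

lemma mem_internal {A : ∀ m, Set (W m)} {x : Space W} :
    x ∈ internal A ↔ ∀ᶠ m in hyperfilter ℕ, x m ∈ A m := Iff.rfl

lemma compl_internal (A : ∀ m, Set (W m)) : (internal A)ᶜ = internal fun m => (A m)ᶜ := by
  ext x
  simp only [Set.mem_compl_iff, mem_internal, Ultrafilter.eventually_not]

lemma internal_inter (A B : ∀ m, Set (W m)) :
    internal A ∩ internal B = internal fun m => A m ∩ B m := by
  ext x
  simp only [Set.mem_inter_iff, mem_internal, eventually_and]

lemma internal_union (A B : ∀ m, Set (W m)) :
    internal A ∪ internal B = internal fun m => A m ∪ B m := by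
  ext x
  simp only [Set.mem_union, mem_internal, Ultrafilter.eventually_or]

lemma internal_iInter {J : Type*} [Finite J] (A : J → ∀ m, Set (W m)) :
    ⋂ j, internal (A j) = internal fun m => ⋂ j, A j m := by
  ext x
  simp only [Set.mem_iInter, mem_internal, eventually_all]

lemma internal_empty : internal (fun m => (∅ : Set (W m))) = ∅ := by
  ext x
  simp [mem_internal, (hyperfilter ℕ).neBot.ne]

lemma internal_univ : internal (fun m => (Set.univ : Set (W m))) = Set.univ := by
  ext x
  simp [mem_internal]

lemma internal_eq_empty_iff [∀ m, Nonempty (W m)] {A : ∀ m, Set (W m)} :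
    internal A = ∅ ↔ ∀ᶠ m in hyperfilter ℕ, A m = ∅ := by
  classical
  refine ⟨fun h => ?_, fun h => ?_⟩
  · by_contra hne
    rw [← Ultrafilter.eventually_not] at hne
    have : (fun m => if h : (A m).Nonempty then h.some else Classical.arbitrary _) ∈
        internal A := by
      refine hne.mono fun m hm => ?_
      have hm' : (A m).Nonempty := Set.nonempty_iff_ne_empty.2 hm
      simp only [hm', dite_true]
      exact hm'.some_mem
    rw [h] at this
    exact this
  · ext x
    simp only [mem_internal, Set.mem_empty_iff_false, iff_false, ← Ultrafilter.eventually_not]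
    exact h.mono fun m hm => by simp [hm]

lemma isSetAlgebra_internal : IsSetAlgebra (Set.range (internal (W := W))) where
  empty_mem := ⟨_, internal_empty⟩
  compl_mem := by
    rintro _ ⟨A, rfl⟩
    exact ⟨_, (compl_internal A).symm⟩
  union_mem := by
    rintro _ _ ⟨A, rfl⟩ ⟨B, rfl⟩
    exact ⟨_, (internal_union A B).symm⟩

/-- Countable saturation. -/
lemma exists_eq_empty_of_iInter_eq_empty [∀ m, Nonempty (W m)] {s : ℕ → Set (Space W)}
    (hs : ∀ n, s n ∈ Set.range (internal (W := W))) (hanti : Antitone s)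
    (hempty : ⋂ n, s n = ∅) : ∃ n, s n = ∅ := by
  classical
  choose A hA using hs
  by_contra! hne
  have hev : ∀ n, ∀ᶠ m in hyperfilter ℕ, (⋂ k : Fin (n + 1), A k m).Nonempty := by
    intro n
    have h1 : internal (fun m => ⋂ k : Fin (n + 1), A k m) = s n := by
      rw [← internal_iInter (fun k : Fin (n + 1) => A k)]
      refine Set.Subset.antisymm ?_ ?_
      · refine (Set.iInter_subset _ (Fin.last n)).trans ?_
        rw [hA]
        simp
      · refine Set.subset_iInter fun k => ?_
        rw [hA]
        exact hanti (Nat.lt_succ_iff.1 k.2)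
    have h2 := (hne n).ne_empty
    rw [← h1, ne_eq, internal_eq_empty_iff, ← Ultrafilter.eventually_not] at h2
    exact h2.mono fun m hm => Set.nonempty_iff_ne_empty.2 hm
  let P : ℕ → ℕ → Prop := fun m n => (⋂ k : Fin (n + 1), A k m).Nonempty
  let x : Space W := fun m =>
    if h : P m (Nat.findGreatest (P m) m) then h.some else Classical.arbitrary _
  have hx : x ∈ ⋂ n, s n := by
    refine Set.mem_iInter.2 fun n => ?_
    rw [← hA]
    filter_upwards [hev n, Nat.hyperfilter_le_atTop (eventually_ge_atTop n)] with m hm hmn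
    have h1 : P m (Nat.findGreatest (P m) m) := Nat.findGreatest_spec hmn hm
    have h2 : n ≤ Nat.findGreatest (P m) m := Nat.le_findGreatest hmn hm
    have h3 : x m = h1.some := by simp only [x, h1, dite_true]
    have h4 := Set.mem_iInter.1 h1.some_mem ⟨n, Nat.lt_succ_iff.2 h2⟩
    rw [h3]
    exact h4
  rw [hempty] at hx
  exact hx

/-- The proportion of points of a finite type lying in `A`. -/
noncomputable def dens {X : Type*} (A : Set X) : ℝ := A.ncard / Nat.card X

lemma dens_nonneg {X : Type*} (A : Set X) : 0 ≤ dens A := by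
  unfold dens; positivity

lemma dens_le_one {X : Type*} [Finite X] (A : Set X) : dens A ≤ 1 := by
  unfold dens
  refine div_le_one_of_le₀ ?_ (by positivity)
  rw [← Set.ncard_univ]
  exact_mod_cast Set.ncard_le_ncard (Set.subset_univ A)

lemma dens_univ {X : Type*} [Finite X] [Nonempty X] : dens (Set.univ : Set X) = 1 := by
  unfold dens
  rw [Set.ncard_univ]
  exact div_self (by exact_mod_cast Nat.card_pos.ne')

lemma dens_union {X : Type*} [Finite X] {A B : Set X} (h : Disjoint A B) :
    dens (A ∪ B) = dens A + dens B := by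
  unfold dens
  rw [Set.ncard_union_eq h]
  push_cast
  ring

/-- The limit of the densities along the ultrafilter. -/
noncomputable def limDens (A : ∀ m, Set (W m)) : ENNReal :=
  ((hyperfilter ℕ).map fun m => ENNReal.ofReal (dens (A m))).lim

lemma tendsto_limDens (A : ∀ m, Set (W m)) :
    Tendsto (fun m => ENNReal.ofReal (dens (A m))) (hyperfilter ℕ) (𝓝 (limDens A)) :=
  Ultrafilter.le_nhds_lim _

lemma limDens_congr {A B : ∀ m, Set (W m)} (h : ∀ᶠ m in hyperfilter ℕ, A m = B m) :
    limDens A = limDens B :=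
  tendsto_nhds_unique ((tendsto_limDens A).congr' (h.mono fun m hm => by rw [hm]))
    (tendsto_limDens B)

lemma eventually_eq_of_internal_eq [∀ m, Nonempty (W m)] {A B : ∀ m, Set (W m)}
    (h : internal A = internal B) : ∀ᶠ m in hyperfilter ℕ, A m = B m := by
  have h1 : internal (fun m => A m ∩ (B m)ᶜ) = ∅ := by
    rw [← internal_inter, ← compl_internal, h, Set.inter_compl_self]
  have h2 : internal (fun m => B m ∩ (A m)ᶜ) = ∅ := by
    rw [← internal_inter, ← compl_internal, h, Set.inter_compl_self]
  rw [internal_eq_empty_iff] at h1 h2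
  filter_upwards [h1, h2] with m h1 h2
  refine Set.Subset.antisymm ?_ ?_
  · rwa [← Set.sdiff_eq, Set.sdiff_eq_empty] at h1
  · rwa [← Set.sdiff_eq, Set.sdiff_eq_empty] at h2

open Classical in
/-- The content of an internal set. -/
noncomputable def contentFun (s : Set (Space W)) : ENNReal :=
  if h : ∃ A, internal A = s then limDens h.choose else 0

lemma contentFun_internal [∀ m, Nonempty (W m)] (A : ∀ m, Set (W m)) :
    contentFun (internal A) = limDens A := by
  have h : ∃ B, internal B = internal A := ⟨A, rfl⟩
  rw [contentFun, dif_pos h]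
  exact limDens_congr (eventually_eq_of_internal_eq h.choose_spec)

lemma contentFun_empty [∀ m, Nonempty (W m)] : contentFun (∅ : Set (Space W)) = 0 := by
  rw [← internal_empty, contentFun_internal]
  refine tendsto_nhds_unique (tendsto_limDens _) ?_
  simp [dens]

/-- The content on the algebra of internal sets. -/
noncomputable def content (W : ℕ → Type*) [∀ m, Nonempty (W m)] [∀ m, Finite (W m)] :
    AddContent ENNReal (Set.range (internal (W := W))) :=
  isSetAlgebra_internal.isSetRing.addContent_of_union contentFun contentFun_empty <| by
    rintro _ _ ⟨A, rfl⟩ ⟨B, rfl⟩ hd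
    rw [internal_union, contentFun_internal, contentFun_internal, contentFun_internal]
    refine tendsto_nhds_unique (tendsto_limDens _)
      (((tendsto_limDens A).add (tendsto_limDens B)).congr' ?_)
    rw [Set.disjoint_iff_inter_eq_empty, internal_inter, internal_eq_empty_iff] at hd
    filter_upwards [hd] with m hm
    rw [dens_union (Set.disjoint_iff_inter_eq_empty.2 hm),
      ENNReal.ofReal_add (dens_nonneg _) (dens_nonneg _)]

lemma content_internal [∀ m, Nonempty (W m)] [∀ m, Finite (W m)] (A : ∀ m, Set (W m)) :
    content W (internal A) = limDens A := contentFun_internal A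

lemma limDens_le_one [∀ m, Finite (W m)] (A : ∀ m, Set (W m)) : limDens A ≤ 1 :=
  le_of_tendsto (tendsto_limDens A) (Eventually.of_forall fun _ =>
    ENNReal.ofReal_le_one.2 (dens_le_one _))

lemma isSigmaSubadditive_content [∀ m, Nonempty (W m)] [∀ m, Finite (W m)] :
    (content W).IsSigmaSubadditive := by
  have hR := (isSetAlgebra_internal (W := W)).isSetRing
  refine isSigmaSubadditive_of_addContent_iUnion_eq_tsum hR fun f hf hU hd => ?_
  refine addContent_iUnion_eq_sum_of_tendsto_zero hR (content W) ?_ ?_ hf hU hd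
  · rintro _ ⟨A, rfl⟩
    rw [content_internal]
    exact ((limDens_le_one A).trans_lt ENNReal.one_lt_top).ne
  · intro s hs hanti hempty
    obtain ⟨n, hn⟩ := exists_eq_empty_of_iInter_eq_empty hs hanti hempty
    refine tendsto_const_nhds.congr' ?_
    filter_upwards [eventually_ge_atTop n] with k hk
    have hk' : s k ⊆ s n := hanti hk
    rw [hn, Set.subset_empty_iff] at hk'
    rw [hk', addContent_empty]

instance : MeasurableSpace (Space W) :=
  MeasurableSpace.generateFrom (Set.range (internal (W := W)))

/-- The Loeb measure of the normalized counting measures. -/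
noncomputable def loeb (W : ℕ → Type*) [∀ m, Nonempty (W m)] [∀ m, Finite (W m)] :
    Measure (Space W) :=
  (content W).measure isSetAlgebra_internal.isSetRing.isSetSemiring le_rfl
    isSigmaSubadditive_content

lemma measurableSet_internal (A : ∀ m, Set (W m)) : MeasurableSet (internal A) :=
  MeasurableSpace.measurableSet_generateFrom ⟨A, rfl⟩

section measure

variable [∀ m, Nonempty (W m)] [∀ m, Finite (W m)]

lemma loeb_internal (A : ∀ m, Set (W m)) : loeb W (internal A) = limDens A := by
  have h := (content W).measure_eq isSetAlgebra_internal.isSetRing.isSetSemiring rfl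
    isSigmaSubadditive_content (Set.mem_range_self A)
  rw [content_internal] at h
  exact h

instance : IsProbabilityMeasure (loeb W) where
  measure_univ := by
    rw [← internal_univ, loeb_internal]
    refine tendsto_nhds_unique (tendsto_limDens _) ?_
    simp [dens_univ]

lemma tendsto_dens (A : ∀ m, Set (W m)) :
    Tendsto (fun m => dens (A m)) (hyperfilter ℕ) (𝓝 ((loeb W).real (internal A))) := by
  have h := (ENNReal.tendsto_toReal (measure_ne_top (loeb W) (internal A))).comp
    (loeb_internal A ▸ tendsto_limDens A)
  refine h.congr fun m => ?_
  simp [ENNReal.toReal_ofReal (dens_nonneg _)]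

end measure

end Loeb

namespace Loeb

universe u

variable {ι : Type u}

/-- Membership in `A` depends only on the coordinates in `T`. -/
def DepSet {X : Type*} (A : Set (ι → X)) (T : Finset ι) : Prop :=
  ∀ ⦃x y : ι → X⦄, (∀ i ∈ T, x i = y i) → (x ∈ A ↔ y ∈ A)

section DepSet

variable {X : Type*} {A B : Set (ι → X)} {S T : Finset ι}

lemma DepSet.mono (h : DepSet A S) (hST : S ⊆ T) : DepSet A T :=
  fun _ _ hxy => h fun i hi => hxy i (hST hi)

lemma DepSet.compl (h : DepSet A T) : DepSet Aᶜ T :=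
  fun _ _ hxy => not_congr (h hxy)

lemma DepSet.inter (hA : DepSet A T) (hB : DepSet B T) : DepSet (A ∩ B) T :=
  fun _ _ hxy => and_congr (hA hxy) (hB hxy)

lemma DepSet.union (hA : DepSet A T) (hB : DepSet B T) : DepSet (A ∪ B) T :=
  fun _ _ hxy => or_congr (hA hxy) (hB hxy)

lemma DepSet.iInter {J : Sort*} {A : J → Set (ι → X)} (h : ∀ j, DepSet (A j) T) :
    DepSet (⋂ j, A j) T := fun _ _ hxy => by
  simp only [Set.mem_iInter]
  exact forall_congr' fun j => h j hxy

lemma depSet_univ : DepSet (Set.univ : Set (ι → X)) T := fun _ _ _ => Iff.rfl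

lemma depSet_empty : DepSet (∅ : Set (ι → X)) T := fun _ _ _ => Iff.rfl

end DepSet

variable [DecidableEq ι] {V : ℕ → Type*}

/-- Internal intersections of sets, the `T`-th of which depends only on the coordinates in `T`. -/
def cyl (V : ℕ → Type*) (D : Finset (Finset ι)) : Set (Set (Space fun m => ι → V m)) :=
  {s | ∃ A : Finset ι → ∀ m, Set (ι → V m), (∀ T m, DepSet (A T m) T) ∧
    s = internal fun m => ⋂ T ∈ D, A T m}

/-- The σ-algebra generated by internal sets depending on the coordinates in a member of `D`. -/
@[reducible] def sig (V : ℕ → Type*) (D : Finset (Finset ι)) : MeasurableSpace (Space fun m => ι → V m) :=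
  MeasurableSpace.generateFrom (cyl V D)

omit [DecidableEq ι] in
lemma isPiSystem_cyl (D : Finset (Finset ι)) : IsPiSystem (cyl V D) := by
  rintro _ ⟨A, hA, rfl⟩ _ ⟨B, hB, rfl⟩ -
  refine ⟨fun T m => A T m ∩ B T m, fun T m => (hA T m).inter (hB T m), ?_⟩
  rw [internal_inter]
  congr 1
  ext m x
  simp only [Set.mem_inter_iff, Set.mem_iInter]
  exact ⟨fun h T hT => ⟨h.1 T hT, h.2 T hT⟩, fun h => ⟨fun T hT => (h T hT).1,
    fun T hT => (h T hT).2⟩⟩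

lemma cyl_mono {D D' : Finset (Finset ι)} (h : D ⊆ D') : cyl V D ⊆ cyl V D' := by
  rintro _ ⟨A, hA, rfl⟩
  refine ⟨fun T m => if T ∈ D then A T m else Set.univ, fun T m => ?_, ?_⟩
  · dsimp only
    split_ifs
    exacts [hA T m, depSet_univ]
  · congr 1
    ext m x
    simp only [Set.mem_iInter]
    refine ⟨fun H T _ => ?_, fun H T hT => ?_⟩
    · split_ifs with hT
      exacts [H T hT, trivial]
    · simpa [hT] using H T (h hT)

lemma sig_mono {D D' : Finset (Finset ι)} (h : D ⊆ D') : sig V D ≤ sig V D' :=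
  MeasurableSpace.generateFrom_mono (cyl_mono h)

omit [DecidableEq ι] in
lemma sig_le (D : Finset (Finset ι)) :
    sig V D ≤ (inferInstance : MeasurableSpace (Space fun m => ι → V m)) := by
  refine MeasurableSpace.generateFrom_le ?_
  rintro _ ⟨A, -, rfl⟩
  exact measurableSet_internal _

lemma internal_mem_cyl {D : Finset (Finset ι)} {T : Finset ι} (hT : T ∈ D)
    {A : ∀ m, Set (ι → V m)} (hA : ∀ m, DepSet (A m) T) : internal A ∈ cyl V D := by
  refine ⟨fun S m => if S = T then A m else Set.univ, fun S m => ?_, ?_⟩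
  · dsimp only
    split_ifs with h
    exacts [h ▸ hA m, depSet_univ]
  · congr 1
    ext m x
    simp only [Set.mem_iInter]
    refine ⟨fun H S _ => ?_, fun H => by simpa using H T hT⟩
    split_ifs
    exacts [H, trivial]

lemma mem_cyl_powerset {e : Finset ι} {s : Set (Space fun m => ι → V m)} :
    s ∈ cyl V e.powerset ↔ ∃ A : ∀ m, Set (ι → V m), (∀ m, DepSet (A m) e) ∧ s = internal A := by
  constructor
  · rintro ⟨A, hA, rfl⟩
    exact ⟨_, fun m => DepSet.iInter fun T => DepSet.iInter fun hT =>
      (hA T m).mono (mem_powerset.1 hT), rfl⟩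
  · rintro ⟨A, hA, rfl⟩
    exact internal_mem_cyl (mem_powerset_self e) hA

lemma isSetAlgebra_cyl_powerset (e : Finset ι) : IsSetAlgebra (cyl V e.powerset) where
  empty_mem := mem_cyl_powerset.2 ⟨_, fun _ => depSet_empty, internal_empty.symm⟩
  compl_mem := fun s hs => by
    obtain ⟨A, hA, rfl⟩ := mem_cyl_powerset.1 hs
    exact mem_cyl_powerset.2 ⟨_, fun m => (hA m).compl, compl_internal A⟩
  union_mem := fun s t hs ht => by
    obtain ⟨A, hA, rfl⟩ := mem_cyl_powerset.1 hs
    obtain ⟨B, hB, rfl⟩ := mem_cyl_powerset.1 ht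
    exact mem_cyl_powerset.2 ⟨_, fun m => (hA m).union (hB m), internal_union A B⟩

omit [DecidableEq ι] in
lemma eq_empty_or_univ_of_measurableSet_sig_empty [∀ m, Nonempty (V m)]
    {s : Set (Space fun m => ι → V m)} (hs : MeasurableSet[sig V ∅] s) :
    s = ∅ ∨ s = Set.univ := by
  have h : sig V (∅ : Finset (Finset ι)) ≤ ⊥ := by
    refine MeasurableSpace.generateFrom_le ?_
    rintro _ ⟨A, -, rfl⟩
    refine MeasurableSpace.measurableSet_bot_iff.2 (Or.inr ?_)
    simp [internal_univ]
  exact MeasurableSpace.measurableSet_bot_iff.1 (h s hs)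

/-- Approximation of measurable sets by members of a generating algebra. -/
lemma exists_mem_real_symmDiff_lt {Ω : Type*} {m m0 : MeasurableSpace Ω} {μ : Measure Ω}
    [IsFiniteMeasure μ] (hm : m ≤ m0) {C : Set (Set Ω)} (hC : IsSetAlgebra C)
    (hgen : m = MeasurableSpace.generateFrom C) {s : Set Ω} (hs : MeasurableSet[m] s) {ε : ENNReal}
    (hε : 0 < ε) : ∃ t ∈ C, MeasurableSet[m] t ∧ μ (symmDiff t s) < ε := by
  obtain ⟨t, htC, ht⟩ := exists_measure_symmDiff_lt_of_generateFrom_isSetRing (mα := m)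
    (μ := μ.trim hm) hC.isSetRing ⟨{Set.univ}, Set.countable_singleton _,
      Set.singleton_subset_iff.2 hC.univ_mem, by simp⟩ hgen hs hε
  have htm : MeasurableSet[m] t := hgen ▸ MeasurableSpace.measurableSet_generateFrom htC
  rw [trim_measurableSet_eq hm (htm.symmDiff hs)] at ht
  exact ⟨t, htC, htm, ht⟩

/-- The average of a function on a finite type. -/
noncomputable def mean {X : Type*} [Fintype X] (f : X → ℝ) : ℝ := (∑ x, f x) / Nat.card X

lemma mean_indicator_one {X : Type*} [Fintype X] (A : Set X) :
    mean (A.indicator fun _ => 1) = dens A := by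
  classical
  unfold mean dens
  congr 1
  rw [Set.ncard_eq_toFinset_card', Finset.card_eq_sum_ones]
  simp [Set.indicator_apply]

lemma mean_add {X : Type*} [Fintype X] (f g : X → ℝ) : mean (f + g) = mean f + mean g := by
  simp [mean, Finset.sum_add_distrib, add_div]

lemma mean_const_mul {X : Type*} [Fintype X] (c : ℝ) (f : X → ℝ) :
    mean (fun x => c * f x) = c * mean f := by
  simp [mean, ← Finset.mul_sum, mul_div_assoc]

/-- Some fibre average of `f` over `A` dominates the average of `f` over `A`, if `f` depends only
on the coordinates in `e`. -/
lemma exists_abs_mean_le [Fintype ι] {X : Type*} [Fintype X] [Nonempty X] (e : Finset ι)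
    (f : (ι → X) → ℝ) (hf : DependsOn f e) (A : Set (ι → X)) :
    ∃ z : ι → X, |mean (A.indicator f)| ≤ |mean ({x | e.piecewise x z ∈ A}.indicator f)| := by
  classical
  let h := A.indicator f
  let σ : (ι → X) × (ι → X) → (ι → X) × (ι → X) := fun p =>
    (e.piecewise p.1 p.2, e.piecewise p.2 p.1)
  have hσ : Function.Involutive σ := by
    rintro ⟨x, z⟩
    ext i <;> by_cases hi : i ∈ e <;> simp [σ, hi]
  have h1 : ∑ p : (ι → X) × (ι → X), h (σ p).1 = ∑ p : (ι → X) × (ι → X), h p.1 :=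
    Equiv.sum_comp (Function.Involutive.toPerm σ hσ) fun p => h p.1
  have h2 : ∀ x z, h (e.piecewise x z) = {x | e.piecewise x z ∈ A}.indicator f x := by
    intro x z
    have : f (e.piecewise x z) = f x := hf fun i hi => by simp [Finset.mem_coe.1 hi]
    by_cases hx : e.piecewise x z ∈ A <;> simp [h, hx, this]
  rw [Fintype.sum_prod_type_right, Fintype.sum_prod_type_right] at h1
  simp only [σ, h2, Finset.sum_const, nsmul_eq_mul] at h1
  by_contra! hlt
  have hc : (0 : ℝ) < Nat.card (ι → X) := by exact_mod_cast Nat.card_pos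
  simp only [mean, abs_div, div_lt_div_iff_of_pos_right (abs_pos.2 hc.ne')] at hlt
  have h3 : |∑ z : ι → X, ∑ x, {x | e.piecewise x z ∈ A}.indicator f x| <
      ∑ z : ι → X, |∑ x, h x| :=
    (Finset.abs_sum_le_sum_abs _ _).trans_lt
      (Finset.sum_lt_sum_of_nonempty univ_nonempty fun z _ => hlt z)
  rw [h1, abs_mul, Nat.abs_cast, Finset.sum_const, nsmul_eq_mul] at h3
  exact lt_irrefl _ h3

section measure

variable [Fintype ι] [∀ m, Fintype (V m)] [∀ m, Nonempty (V m)]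

/-- An integrable function measurable with respect to the coordinates in `e` is approximated by
internal functions depending only on these coordinates. -/
lemma exists_lift (e : Finset ι) {u : (Space fun m => ι → V m) → ℝ}
    (hu : StronglyMeasurable[sig V e.powerset] u) (hi : Integrable u (loeb fun m => ι → V m))
    {ε : ℝ} (hε : 0 < ε) :
    ∃ G : ∀ m, (ι → V m) → ℝ, (∀ m, DependsOn (G m) e) ∧ ∀ A : ∀ m, Set (ι → V m),
      ∀ᶠ m in hyperfilter ℕ, |mean ((A m).indicator (G m)) -
        ∫ x in internal A, u x ∂(loeb fun m => ι → V m)| ≤ ε := by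
  classical
  set μ := loeb fun m => ι → V m with hμ
  have hm := sig_le (V := V) e.powerset
  let P : ((Space fun m => ι → V m) → ℝ) → Prop := fun g =>
    StronglyMeasurable[sig V e.powerset] g ∧ Integrable g μ ∧
    ∃ G : ∀ m, (ι → V m) → ℝ, (∀ m, DependsOn (G m) e) ∧ ∀ A : ∀ m, Set (ι → V m),
      Tendsto (fun m => mean ((A m).indicator (G m))) (hyperfilter ℕ)
        (𝓝 (∫ x in internal A, g x ∂μ))
  have key : ∃ g, eLpNorm (u - g) 1 (μ.trim hm) ≤ ENNReal.ofReal (ε / 2) ∧ P g := by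
    refine @MemLp.induction_dense _ _ (sig V e.powerset) _ 1 (μ.trim hm) ENNReal.one_ne_top P ?_ ?_ ?_ _
      (memLp_one_iff_integrable.2 (hi.trim hm hu)) _ (by simpa using hε)
    · intro c s hs _ δ hδ
      by_cases hδt : δ = ⊤
      · refine ⟨0, by simp [hδt], stronglyMeasurable_zero, integrable_zero _ _ _, fun _ => 0,
          fun m _ _ _ => rfl, fun A => by simp [mean]⟩
      obtain ⟨t, htC, htm, ht⟩ := exists_mem_real_symmDiff_lt (μ := μ) hm
        (isSetAlgebra_cyl_powerset e) rfl hs (ε := δ / (‖c‖ₑ + 1))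
        (ENNReal.div_pos hδ (by finiteness))
      obtain ⟨E, hE, rfl⟩ := mem_cyl_powerset.1 htC
      refine ⟨(internal E).indicator fun _ => c, ?_, ?_, ?_, fun m => (E m).indicator fun _ => c,
        fun m => ?_, fun A => ?_⟩
      · rw [eLpNorm_trim hm ((stronglyMeasurable_const.indicator htm).sub
          (stronglyMeasurable_const.indicator hs)), eLpNorm_indicator_sub_indicator,
          eLpNorm_indicator_const (hm _ (htm.symmDiff hs)) one_ne_zero ENNReal.one_ne_top]
        simp only [ENNReal.toReal_one, div_one, ENNReal.rpow_one]
        refine (mul_le_mul' (le_self_add (a := ‖c‖ₑ) (b := 1)) ht.le).trans (ENNReal.mul_div_le)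
      · exact stronglyMeasurable_const.indicator htm
      · exact (integrable_const c).indicator (measurableSet_internal E)
      · intro x y hxy
        simp only [Set.indicator_apply, hE m hxy]
      · rw [setIntegral_indicator (measurableSet_internal E), setIntegral_const, internal_inter,
          smul_eq_mul, mul_comm]
        refine ((tendsto_dens _).const_mul c).congr fun m => ?_
        rw [← mean_indicator_one, ← mean_const_mul]
        congr 1
        ext x
        by_cases h1 : x ∈ A m <;> by_cases h2 : x ∈ E m <;> simp [h1, h2]
    · rintro f g ⟨hf, hfi, F, hF, hF'⟩ ⟨hg, hgi, G, hG, hG'⟩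
      refine ⟨hf.add hg, hfi.add hgi, fun m => F m + G m, fun m x y hxy => ?_, fun A => ?_⟩
      · simp only [Pi.add_apply, hF m hxy, hG m hxy]
      · simp only [Pi.add_apply]
        rw [integral_add hfi.integrableOn hgi.integrableOn]
        refine ((hF' A).add (hG' A)).congr fun m => ?_
        rw [← mean_add, Set.indicator_add']
    · exact fun f hf => hf.1.aestronglyMeasurable
  obtain ⟨g, hg, hgm, hgi, G, hG, hG'⟩ := key
  refine ⟨G, hG, fun A => ?_⟩
  have h1 : |∫ x in internal A, g x ∂μ - ∫ x in internal A, u x ∂μ| ≤ ε / 2 := by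
    rw [eLpNorm_trim hm (hu.sub hgm), eLpNorm_one_eq_lintegral_enorm] at hg
    rw [← integral_sub hgi.integrableOn hi.integrableOn, ← Real.norm_eq_abs]
    have h2 : ENNReal.ofReal ‖∫ x in internal A, (g x - u x) ∂μ‖ ≤ ENNReal.ofReal (ε / 2) := by
      rw [ofReal_norm]
      refine (enorm_integral_le_lintegral_enorm _).trans
        ((setLIntegral_le_lintegral _ _).trans (le_trans (le_of_eq ?_) hg))
      refine lintegral_congr fun x => ?_
      rw [Pi.sub_apply, enorm_sub_rev]
    exact (ENNReal.ofReal_le_ofReal_iff (by positivity)).1 h2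
  filter_upwards [(hG' A).eventually (Metric.ball_mem_nhds _ (half_pos hε))] with m hm
  have hm' : |mean ((A m).indicator (G m)) - ∫ x in internal A, g x ∂μ| < ε / 2 := by
    simpa [Real.dist_eq] using hm
  calc _ ≤ |mean ((A m).indicator (G m)) - ∫ x in internal A, g x ∂μ| +
        |∫ x in internal A, g x ∂μ - ∫ x in internal A, u x ∂μ| := abs_sub_le _ _ _
    _ ≤ ε := by linarith

/-- The members of `D` contained in `e`. -/
def below (D : Finset (Finset ι)) (e : Finset ι) : Finset (Finset ι) := D.filter (· ⊆ e)

omit [Fintype ι] in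
lemma mem_below {D : Finset (Finset ι)} {e T : Finset ι} : T ∈ below D e ↔ T ∈ D ∧ T ⊆ e :=
  mem_filter

omit [Fintype ι] in
lemma below_subset (D : Finset (Finset ι)) (e : Finset ι) : below D e ⊆ D := filter_subset _ _

omit [Fintype ι] in
lemma below_subset_powerset (D : Finset (Finset ι)) (e : Finset ι) : below D e ⊆ e.powerset :=
  fun _ hT => mem_powerset.2 (mem_below.1 hT).2

lemma setIntegral_cyl_eq_zero {D : Finset (Finset ι)} (hD : ∀ T ∈ D, ∀ S ⊆ T, S ∈ D)
    (e : Finset ι) {u : (Space fun m => ι → V m) → ℝ}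
    (hu : StronglyMeasurable[sig V e.powerset] u) (hi : Integrable u (loeb fun m => ι → V m))
    (h0 : ∀ s ∈ cyl V (below D e), ∫ x in s, u x ∂(loeb fun m => ι → V m) = 0)
    {s : Set (Space fun m => ι → V m)} (hs : s ∈ cyl V D) :
    ∫ x in s, u x ∂(loeb fun m => ι → V m) = 0 := by
  obtain ⟨A, hA, rfl⟩ := hs
  refine abs_eq_zero.1 (le_antisymm (le_of_forall_pos_le_add fun ε hε => ?_) (abs_nonneg _))
  obtain ⟨G, hG, hG'⟩ := exists_lift e hu hi (half_pos hε)
  choose z hz using fun m => exists_abs_mean_le e (G m) (hG m) (⋂ T ∈ D, A T m)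
  have hB : internal (fun m => {x | e.piecewise x (z m) ∈ ⋂ T ∈ D, A T m}) ∈
      cyl V (below D e) := by
    refine ⟨fun S m => {x | ∀ T ∈ D, T ∩ e = S → e.piecewise x (z m) ∈ A T m},
      fun S m x y hxy => ?_, ?_⟩
    · refine forall_congr' fun T => forall_congr' fun hT => forall_congr' fun hTS => ?_
      refine hA T m fun i hi => ?_
      by_cases hie : i ∈ e
      · simpa [hie] using hxy i (hTS ▸ mem_inter.2 ⟨hi, hie⟩)
      · simp [hie]
    · congr 1
      ext m x
      simp only [Set.mem_ofPred_eq, Set.mem_iInter, mem_below]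
      exact ⟨fun h S _ T hT _ => h T hT, fun h T hT => h (T ∩ e)
        ⟨hD T hT _ inter_subset_left, inter_subset_right⟩ T hT rfl⟩
  have h1 := hG' fun m => {x | e.piecewise x (z m) ∈ ⋂ T ∈ D, A T m}
  rw [h0 _ hB] at h1
  obtain ⟨m, h1, h2⟩ := (h1.and (hG' fun m => ⋂ T ∈ D, A T m)).exists
  rw [sub_zero] at h1
  rw [abs_le] at h1 h2
  have h3 := (hz m).trans (abs_le.2 h1)
  rw [abs_le] at h3
  rw [abs_le]
  constructor <;> linarith

/-- Conditional independence: the conditional expectation of an `e`-measurable set on the part of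
`D` lying below `e` has the right integral over every `D`-measurable set. -/
lemma setIntegral_condExp_below {D : Finset (Finset ι)} (hD : ∀ T ∈ D, ∀ S ⊆ T, S ∈ D)
    (e : Finset ι) {Y s : Set (Space fun m => ι → V m)}
    (hY : MeasurableSet[sig V e.powerset] Y) (hs : MeasurableSet[sig V D] s) :
    ∫ x in s, ((loeb fun m => ι → V m)[Y.indicator fun _ => (1 : ℝ) | sig V (below D e)]) x
      ∂(loeb fun m => ι → V m) = (loeb fun m => ι → V m).real (Y ∩ s) := by
  set μ := loeb fun m => ι → V m
  have hY' : MeasurableSet Y := sig_le _ _ hY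
  have hYi : Integrable (Y.indicator fun _ => (1 : ℝ)) μ := (integrable_const 1).indicator hY'
  set c := μ[Y.indicator fun _ => (1 : ℝ) | sig V (below D e)] with hc
  have hci : Integrable c μ := integrable_condExp
  set v : (Space fun m => ι → V m) → ℝ := Y.indicator (fun _ => 1) - c with hv
  have hvi : Integrable v μ := hYi.sub hci
  have hvm : StronglyMeasurable[sig V e.powerset] v :=
    (stronglyMeasurable_const.indicator hY).sub
      (stronglyMeasurable_condExp.mono (sig_mono (below_subset_powerset D e)))
  have hint : ∀ t, MeasurableSet t → ∫ x in t, v x ∂μ = μ.real (Y ∩ t) - ∫ x in t, c x ∂μ := by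
    intro t ht
    rw [hv]
    simp only [Pi.sub_apply]
    rw [integral_sub hYi.integrableOn hci.integrableOn, setIntegral_indicator hY',
      setIntegral_const, smul_eq_mul, mul_one, Set.inter_comm]
  have hlow : ∀ t, MeasurableSet[sig V (below D e)] t → ∫ x in t, v x ∂μ = 0 := by
    intro t ht
    have ht' : MeasurableSet t := sig_le _ _ ht
    rw [hint t ht', setIntegral_condExp (sig_le _) hYi ht, setIntegral_indicator hY',
      setIntegral_const, smul_eq_mul, mul_one, Set.inter_comm, sub_self]
  suffices h : ∫ x in s, v x ∂μ = 0 by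
    rw [hint s (sig_le _ _ hs)] at h
    linarith
  induction s, hs using MeasurableSpace.induction_on_inter (s := cyl V D) rfl
    (isPiSystem_cyl D) with
  | empty => simp
  | basic t ht =>
    exact setIntegral_cyl_eq_zero hD e hvm hvi
      (fun t ht => hlow t (MeasurableSpace.measurableSet_generateFrom ht)) ht
  | compl t ht ih =>
    have h1 := integral_add_compl (sig_le _ _ ht) hvi
    have h2 := hlow Set.univ MeasurableSet.univ
    rw [setIntegral_univ] at h2
    rw [ih, h2, zero_add] at h1
    exact h1
  | iUnion f hd hf ih =>
    rw [integral_iUnion (fun i => sig_le _ _ (hf i)) hd hvi.integrableOn]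
    simp [ih]

end measure

end Loeb

namespace Loeb

universe u

variable {ι : Type u} {V : ℕ → Type*}

/-- The points whose eventual colour is `κ`. -/
def cell {K : Type*} (col : ∀ m, (ι → V m) → K) (κ : K) : Set (Space fun m => ι → V m) :=
  internal fun m => {w | col m w = κ}

lemma exists_mem_cell {K : Type*} [Finite K] (col : ∀ m, (ι → V m) → K)
    (x : Space fun m => ι → V m) : ∃ κ, x ∈ cell col κ := by
  have h : ∀ᶠ m in hyperfilter ℕ, ∃ κ, col m (x m) = κ := Eventually.of_forall fun m => ⟨_, rfl⟩
  have h2 : (⋃ κ ∈ (Set.univ : Set K), {m | col m (x m) = κ}) ∈ hyperfilter ℕ := by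
    filter_upwards with m
    simp
  obtain ⟨κ, -, hκ⟩ := (Ultrafilter.finite_biUnion_mem_iff Set.finite_univ).1 h2
  exact ⟨κ, hκ⟩

lemma eq_of_mem_cell {K : Type*} {col : ∀ m, (ι → V m) → K} {x : Space fun m => ι → V m}
    {κ κ' : K} (h : x ∈ cell col κ) (h' : x ∈ cell col κ') : κ = κ' := by
  obtain ⟨m, h1, h2⟩ := (Eventually.and (mem_internal.1 h) (mem_internal.1 h')).exists
  exact h1.symm.trans h2

lemma measurableSet_cell {K : Type*} (col : ∀ m, (ι → V m) → K) (κ : K) :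
    MeasurableSet (cell col κ) := measurableSet_internal _

variable [DecidableEq ι]

/-- `R` agrees on each cell of a colouring with a measurable set. -/
def Rep {K : Type*} (m : MeasurableSpace (Space fun m => ι → V m)) (T : Finset ι)
    (col : ∀ m, (ι → V m) → K) (L : K → Set (Space fun m => ι → V m))
    (R : Set (Space fun m => ι → V m)) : Prop :=
  (∀ m, DependsOn (col m) T) ∧ (∀ κ, MeasurableSet[m] (L κ)) ∧
    ∀ x κ, x ∈ cell col κ → (x ∈ R ↔ x ∈ L κ)

/-- The sets which agree on each cell of some finite colouring with a measurable set. -/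
def repSets (m : MeasurableSpace (Space fun m => ι → V m)) (T : Finset ι) :
    Set (Set (Space fun m => ι → V m)) :=
  {R | ∃ (K : Type) (_ : Finite K) (col : ∀ m, (ι → V m) → K)
    (L : K → Set (Space fun m => ι → V m)), Rep m T col L R}

omit [DecidableEq ι] in
lemma isSetAlgebra_repSets (m : MeasurableSpace (Space fun m => ι → V m)) (T : Finset ι) :
    IsSetAlgebra (repSets m T) where
  empty_mem := ⟨Unit, inferInstance, fun _ _ => (), fun _ => ∅, fun _ _ _ _ => rfl,
    fun _ => MeasurableSet.empty, fun _ _ _ => Iff.rfl⟩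
  compl_mem := by
    rintro R ⟨K, hK, col, L, h1, h2, h3⟩
    exact ⟨K, hK, col, fun κ => (L κ)ᶜ, h1, fun κ => (h2 κ).compl,
      fun x κ hx => not_congr (h3 x κ hx)⟩
  union_mem := by
    rintro R R' ⟨K, hK, col, L, h1, h2, h3⟩ ⟨K', hK', col', L', h1', h2', h3'⟩
    refine ⟨K × K', inferInstance, fun m w => (col m w, col' m w), fun κ => L κ.1 ∪ L' κ.2,
      fun m x y hxy => ?_, fun κ => (h2 _).union (h2' _), fun x κ hx => ?_⟩
    · simp only [h1 m hxy, h1' m hxy]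
    · refine or_congr (h3 x κ.1 ?_) (h3' x κ.2 ?_)
      · exact Eventually.mono (mem_internal.1 hx) fun m hm => congrArg Prod.fst hm
      · exact Eventually.mono (mem_internal.1 hx) fun m hm => congrArg Prod.snd hm

omit [DecidableEq ι] in
lemma measurableSet_of_mem_repSets {m : MeasurableSpace (Space fun m => ι → V m)}
    (hm : m ≤ instMeasurableSpaceSpace) {T : Finset ι} {R : Set (Space fun m => ι → V m)}
    (hR : R ∈ repSets m T) : MeasurableSet[instMeasurableSpaceSpace] R := by
  obtain ⟨K, hK, col, L, -, h2, h3⟩ := hR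
  have : R = ⋃ κ, cell col κ ∩ L κ := by
    ext x
    simp only [Set.mem_iUnion, Set.mem_inter_iff]
    refine ⟨fun hx => ?_, fun ⟨κ, h, h'⟩ => (h3 x κ h).2 h'⟩
    obtain ⟨κ, hκ⟩ := exists_mem_cell col x
    exact ⟨κ, hκ, (h3 x κ hκ).1 hx⟩
  rw [this]
  exact @MeasurableSet.iUnion _ _ instMeasurableSpaceSpace _ _ fun κ =>
    @MeasurableSet.inter _ instMeasurableSpaceSpace _ _ (measurableSet_cell col κ) (hm _ (h2 κ))

lemma cyl_subset_repSets {D : Finset (Finset ι)} {e T : Finset ι} :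
    cyl V (below D e) ⊆ repSets (sig V (below (D.erase T) e)) T := by
  classical
  rintro _ ⟨A, hA, rfl⟩
  refine ⟨Prop, inferInstance, fun m w => T ∈ below D e → w ∈ A T m, fun κ => {x | κ} ∩
    internal fun m => ⋂ S ∈ below (D.erase T) e, A S m, fun m x y hxy => ?_, fun κ => ?_,
    fun x κ hx => ?_⟩
  · exact propext (imp_congr_right fun _ => hA T m hxy)
  · exact (MeasurableSet.const κ).inter
      (MeasurableSpace.measurableSet_generateFrom ⟨A, hA, rfl⟩)
  · have h1 : ∀ᶠ m in hyperfilter ℕ, (T ∈ below D e → x m ∈ A T m) = κ := mem_internal.1 hx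
    have h2 : κ ↔ ∀ᶠ m in hyperfilter ℕ, (T ∈ below D e → x m ∈ A T m) := by
      rw [eventually_congr (h1.mono fun m hm => iff_of_eq hm)]
      simp
    have h3 : x ∈ {x : Space fun m => ι → V m | κ} ↔ κ := Iff.rfl
    rw [Set.mem_inter_iff, h3, h2, mem_internal, mem_internal, ← eventually_and]
    refine eventually_congr (Eventually.of_forall fun m => ?_)
    simp only [Set.mem_iInter, mem_below, mem_erase]
    refine ⟨fun h => ⟨h T, fun S hS => h S ⟨hS.1.2, hS.2⟩⟩, fun h S hS => ?_⟩
    by_cases hST : S = T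
    · exact hST ▸ h.1 (hST ▸ hS)
    · exact h.2 S ⟨⟨hST, hS.1⟩, hS.2⟩

variable [Fintype ι] [∀ m, Fintype (V m)] [∀ m, Nonempty (V m)]

lemma exists_rep {D : Finset (Finset ι)} {e T : Finset ι} {B : Set (Space fun m => ι → V m)}
    (hB : MeasurableSet[sig V (below D e)] B) {ε : ENNReal} (hε : 0 < ε) :
    ∃ (K : Type) (_ : Finite K) (col : ∀ m, (ι → V m) → K)
      (L : K → Set (Space fun m => ι → V m)) (R : Set (Space fun m => ι → V m)),
      Rep (sig V (below (D.erase T) e)) T col L R ∧ MeasurableSet R ∧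
        (loeb fun m => ι → V m) (symmDiff R B) < ε := by
  have hB' : MeasurableSet[MeasurableSpace.generateFrom
      (repSets (sig V (below (D.erase T) e)) T)] B :=
    MeasurableSpace.generateFrom_mono cyl_subset_repSets _ hB
  have hle : MeasurableSpace.generateFrom (repSets (sig V (below (D.erase T) e)) T) ≤
      instMeasurableSpaceSpace :=
    MeasurableSpace.generateFrom_le fun R hR => measurableSet_of_mem_repSets (sig_le _) hR
  obtain ⟨R, hR, -, h⟩ := exists_mem_real_symmDiff_lt (μ := loeb fun m => ι → V m) hle
    (isSetAlgebra_repSets _ T) rfl hB' hε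
  have hR' := measurableSet_of_mem_repSets (sig_le _) hR
  obtain ⟨K, hK, col, L, hrep⟩ := hR
  exact ⟨K, hK, col, L, R, hrep, hR', h⟩

lemma exists_regular {D : Finset (Finset ι)} (hD : ∀ T ∈ D, ∀ S ⊆ T, S ∈ D) {T : Finset ι}
    {a : Set (Space fun m => ι → V m)} (ha : a ∈ cyl V T.powerset) {I : Type*} [Fintype I]
    {e : I → Finset ι} {B : I → Set (Space fun m => ι → V m)}
    (hB : ∀ i, T ⊆ e i → MeasurableSet[sig V (e i).powerset] (B i))
    (hB' : ∀ i, ¬ T ⊆ e i → MeasurableSet[sig V (below D (e i))] (B i))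
    (h0 : (loeb fun m => ι → V m).real (⋂ i, B i) = 0) {c : ℝ}
    (hc0 : 0 ≤ c) (hc1 : c * Fintype.card I < 1) :
    ∃ (S : Set (Space fun m => ι → V m)) (E : I → Set (Space fun m => ι → V m)),
      MeasurableSet[sig V (below D T)] S ∧ (∀ i, MeasurableSet[sig V (below D (e i))] (E i)) ∧
      (loeb fun m => ι → V m) ((⋂ i, E i) ∩ S) = 0 ∧ (loeb fun m => ι → V m).real (a \ S) = 0 ∧
      (∀ i, T ⊆ e i → ∀ L, MeasurableSet[sig V (below D (e i))] L →
        c * (loeb fun m => ι → V m).real ((a ∩ L) \ E i) ≤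
          (loeb fun m => ι → V m).real ((a ∩ L) \ B i)) ∧
      ∀ i, ¬ T ⊆ e i → E i = B i := by
  classical
  set μ := loeb fun m => ι → V m
  have ha' : MeasurableSet[sig V T.powerset] a := MeasurableSpace.measurableSet_generateFrom ha
  have haB : ∀ i, T ⊆ e i → MeasurableSet[sig V (e i).powerset] (a \ B i) := fun i hi =>
    (sig_mono (powerset_mono.2 hi) _ ha').diff (hB i hi)
  set g := μ[a.indicator fun _ => (1 : ℝ) | sig V (below D T)] with hg
  set f : I → (Space fun m => ι → V m) → ℝ := fun i =>
    μ[(a \ B i).indicator fun _ => (1 : ℝ) | sig V (below D (e i))] with hf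
  have hgi : Integrable g μ := integrable_condExp
  have hfi : ∀ i, Integrable (f i) μ := fun i => integrable_condExp
  have hgm : StronglyMeasurable[sig V (below D T)] g := stronglyMeasurable_condExp
  have hfm : ∀ i, StronglyMeasurable[sig V (below D (e i))] (f i) := fun i =>
    stronglyMeasurable_condExp
  have hgm' : ∀ i, T ⊆ e i → StronglyMeasurable[sig V (below D (e i))] g := fun i hi =>
    hgm.mono (sig_mono fun S hS => mem_below.2 ⟨(mem_below.1 hS).1, (mem_below.1 hS).2.trans hi⟩)
  have hgint : ∀ s, MeasurableSet[sig V D] s → ∫ x in s, g x ∂μ = μ.real (a ∩ s) := fun s hs =>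
    setIntegral_condExp_below hD T ha' hs
  have hfint : ∀ i, T ⊆ e i → ∀ s, MeasurableSet[sig V D] s →
      ∫ x in s, f i x ∂μ = μ.real ((a \ B i) ∩ s) := fun i hi s hs =>
    setIntegral_condExp_below hD (e i) (haB i hi) hs
  have hup : ∀ e', sig V (below D e') ≤ sig V D := fun e' => sig_mono (below_subset D e')
  set S : Set (Space fun m => ι → V m) := {x | 0 < g x} with hS
  set E : I → Set (Space fun m => ι → V m) := fun i =>
    if T ⊆ e i then {x | f i x ≤ c * g x} else B i with hE
  have hSm : MeasurableSet[sig V (below D T)] S :=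
    stronglyMeasurable_const.measurableSet_lt hgm
  have hEm : ∀ i, MeasurableSet[sig V (below D (e i))] (E i) := by
    intro i
    by_cases hi : T ⊆ e i
    · simp only [hE, hi, if_true]
      exact (hfm i).measurableSet_le ((hgm' i hi).const_mul c)
    · simp only [hE, hi, if_false]
      exact hB' i hi
  refine ⟨S, E, hSm, hEm, ?_, ?_, ?_, ?_⟩
  · set Q := (⋂ i, E i) ∩ S with hQ
    have hQm : MeasurableSet[sig V D] Q :=
      (MeasurableSet.iInter fun i => hup _ _ (hEm i)).inter (hup _ _ hSm)
    have hQm' : MeasurableSet Q := sig_le _ _ hQm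
    have h1 : μ.real (a ∩ Q) ≤ ∑ i with T ⊆ e i, μ.real ((a \ B i) ∩ Q) := by
      have hsub : a ∩ Q ⊆ (⋂ i, B i) ∪ ⋃ i ∈ univ.filter (fun i => T ⊆ e i), (a \ B i) ∩ Q := by
        rintro x ⟨hxa, hxQ⟩
        by_cases hx : x ∈ ⋂ i, B i
        · exact Or.inl hx
        · right
          simp only [Set.mem_iInter, not_forall] at hx
          obtain ⟨i, hi⟩ := hx
          have hxE : x ∈ E i := Set.mem_iInter.1 hxQ.1 i
          have hTi : T ⊆ e i := by
            by_contra hTi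
            simp only [hE, hTi, if_false] at hxE
            exact hi hxE
          simp only [Set.mem_iUnion]
          exact ⟨i, by simpa using hTi, ⟨hxa, hi⟩, hxQ⟩
      refine (measureReal_mono hsub).trans ((measureReal_union_le _ _).trans ?_)
      rw [h0, zero_add]
      exact measureReal_biUnion_finset_le _ _
    have h2 : ∀ i, T ⊆ e i → μ.real ((a \ B i) ∩ Q) ≤ c * μ.real (a ∩ Q) := by
      intro i hi
      rw [← hgint Q hQm, ← hfint i hi Q hQm, ← integral_const_mul]
      refine setIntegral_mono_on (hfi i).integrableOn (hgi.const_mul c).integrableOn hQm'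
        fun x hx => ?_
      have hxE : x ∈ E i := Set.mem_iInter.1 hx.1 i
      simp only [hE, hi, if_true] at hxE
      exact hxE
    have h3 : μ.real (a ∩ Q) ≤ 0 := by
      have h4 := (h1.trans (Finset.sum_le_sum fun i hi => h2 i (mem_filter.1 hi).2)).trans
        (Finset.sum_le_sum_of_subset_of_nonneg (filter_subset _ _) fun _ _ _ =>
          mul_nonneg hc0 measureReal_nonneg)
      rw [Finset.sum_const, card_univ, nsmul_eq_mul] at h4
      have h5 : 0 ≤ μ.real (a ∩ Q) := measureReal_nonneg
      nlinarith
    rw [← hgint Q hQm] at h3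
    by_contra hne
    have h4 : 0 < ∫ x in Q, g x ∂μ := by
      rw [setIntegral_pos_iff_support_of_nonneg_ae]
      · have h5 : Function.support g ∩ Q = Q :=
          Set.inter_eq_right.2 fun x hx => (show 0 < g x from hx.2).ne'
        rw [h5]
        exact pos_iff_ne_zero.2 hne
      · exact (ae_restrict_iff' hQm').2 (ae_of_all _ fun x hx => hx.2.le)
      · exact hgi.integrableOn
    linarith
  · have hm : MeasurableSet[sig V (below D T)] Sᶜ := hSm.compl
    rw [Set.sdiff_eq]
    refine le_antisymm ?_ measureReal_nonneg
    rw [← hgint _ (hup _ _ hm)]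
    exact setIntegral_nonpos (sig_le _ _ hm) fun x hx => not_lt.1 hx
  · intro i hi L hL
    set t := L \ E i with ht
    have htm : MeasurableSet[sig V D] t := hup _ _ (hL.diff (hEm i))
    have h1 : (a ∩ L) \ E i = a ∩ t := by rw [ht, Set.inter_sdiff_assoc]
    rw [h1, ← hgint t htm, ← integral_const_mul]
    calc _ ≤ ∫ x in t, f i x ∂μ := by
          refine setIntegral_mono_on (hgi.const_mul c).integrableOn (hfi i).integrableOn
            (sig_le _ _ htm) fun x hx => ?_
          have hxE : x ∉ E i := hx.2
          simp only [hE, hi, if_true] at hxE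
          exact (not_le.1 hxE).le
      _ = μ.real ((a \ B i) ∩ t) := hfint i hi t htm
      _ ≤ _ := measureReal_mono (show (a \ B i) ∩ t ⊆ (a ∩ L) \ B i from
        fun x hx => ⟨⟨hx.1.1, hx.2.1⟩, hx.1.2⟩)
  · intro i hi
    simp only [hE, hi, if_false]

end Loeb

namespace Loeb

universe u v

variable {ι : Type u} [DecidableEq ι] [Fintype ι] {V : ℕ → Type*} [∀ m, Fintype (V m)]
  [∀ m, Nonempty (V m)]

omit [Fintype ι] in
lemma below_erase_of_not_subset {D : Finset (Finset ι)} {T e : Finset ι} (h : ¬ T ⊆ e) :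
    below (D.erase T) e = below D e := by
  ext S
  simp only [mem_below, mem_erase]
  exact ⟨fun hS => ⟨hS.1.2, hS.2⟩, fun hS => ⟨⟨fun hST => h (hST ▸ hS.2), hS.1⟩, hS.2⟩⟩

omit [DecidableEq ι] in
/-- The union bound controlling the measure of the part of `B` which is removed. -/
lemma measureReal_sdiff_le_of_cells {K : Type*} [Fintype K] {T : Finset ι}
    {m : MeasurableSpace (Space fun m => ι → V m)} (hm : m ≤ instMeasurableSpaceSpace)
    {col : ∀ m, (ι → V m) → K}
    {L : K → Set (Space fun m => ι → V m)} {B R B' : Set (Space fun m => ι → V m)}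
    (hrep : Rep m T col L R) (hB : MeasurableSet[instMeasurableSpaceSpace] B)
    {E S E' S' : K → Set (Space fun m => ι → V m)} {c η ε : ℝ} (hc : 0 < c)
    (hRB : (loeb fun m => ι → V m).real (symmDiff R B) ≤ η)
    (hS : ∀ κ, (loeb fun m => ι → V m).real (cell col κ \ S κ) = 0)
    (hE : ∀ κ, c * (loeb fun m => ι → V m).real ((cell col κ ∩ L κ) \ E κ) ≤
      (loeb fun m => ι → V m).real ((cell col κ ∩ L κ) \ B))
    (hE' : ∀ κ, (loeb fun m => ι → V m).real (E κ \ E' κ) ≤ ε)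
    (hS' : ∀ κ, (loeb fun m => ι → V m).real (S κ \ S' κ) ≤ ε)
    (hB' : ∀ κ, cell col κ ∩ E' κ ∩ S' κ ⊆ B') :
    (loeb fun m => ι → V m).real (B \ B') ≤ η + η / c + Fintype.card K * (2 * ε) := by
  set μ := loeb fun m => ι → V m
  have hsub : B \ B' ⊆ symmDiff R B ∪ ⋃ κ, (((cell col κ ∩ L κ) \ E κ ∪ cell col κ \ S κ) ∪
      (E κ \ E' κ ∪ S κ \ S' κ)) := by
    rintro x ⟨hxB, hxB'⟩
    by_cases hxR : x ∈ R
    · right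
      obtain ⟨κ, hκ⟩ := exists_mem_cell col x
      have hxL := (hrep.2.2 x κ hκ).1 hxR
      have := fun h1 h2 => hxB' (hB' κ ⟨⟨hκ, h1⟩, h2⟩)
      refine Set.mem_iUnion.2 ⟨κ, ?_⟩
      simp only [Set.mem_union, Set.mem_sdiff, Set.mem_inter_iff]
      tauto
    · exact Or.inl (Or.inr ⟨hxB, hxR⟩)
  have hcell : ∑ κ, μ.real ((cell col κ ∩ L κ) \ B) ≤ η := by
    rw [← measureReal_iUnion_fintype]
    · refine (measureReal_mono ?_).trans hRB
      refine Set.iUnion_subset fun κ x hx => Or.inl ⟨(hrep.2.2 x κ hx.1.1).2 hx.1.2, hx.2⟩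
    · intro κ κ' hne
      refine Set.disjoint_left.2 fun x hx hx' => hne (eq_of_mem_cell hx.1.1 hx'.1.1)
    · exact fun κ => @MeasurableSet.diff _ instMeasurableSpaceSpace _ _
        (@MeasurableSet.inter _ instMeasurableSpaceSpace _ _ (measurableSet_cell col κ)
          (hm _ (hrep.2.1 κ))) hB
  calc μ.real (B \ B') ≤ μ.real (symmDiff R B) + ∑ κ, μ.real (((cell col κ ∩ L κ) \ E κ ∪
        cell col κ \ S κ) ∪ (E κ \ E' κ ∪ S κ \ S' κ)) :=
        (measureReal_mono hsub).trans ((measureReal_union_le _ _).trans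
          (by gcongr; exact measureReal_iUnion_fintype_le _))
    _ ≤ η + ∑ κ, (μ.real ((cell col κ ∩ L κ) \ B) / c + 2 * ε) := by
        gcongr with κ
        have h1 : μ.real ((cell col κ ∩ L κ) \ E κ) ≤ μ.real ((cell col κ ∩ L κ) \ B) / c := by
          rw [le_div_iff₀' hc]
          exact hE κ
        have h2 := measureReal_union_le (μ := μ) ((cell col κ ∩ L κ) \ E κ) (cell col κ \ S κ)
        have h3 := measureReal_union_le (μ := μ) (E κ \ E' κ) (S κ \ S' κ)
        have h4 := measureReal_union_le (μ := μ) ((cell col κ ∩ L κ) \ E κ ∪ cell col κ \ S κ)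
          (E κ \ E' κ ∪ S κ \ S' κ)
        linarith [hS κ, hE' κ, hS' κ]
    _ ≤ η + η / c + Fintype.card K * (2 * ε) := by
        rw [Finset.sum_add_distrib, ← Finset.sum_div, Finset.sum_const, card_univ, nsmul_eq_mul,
          ← add_assoc]
        gcongr

theorem exists_internal_removal (n : ℕ) : ∀ (D : Finset (Finset ι)), D.card = n →
    (∀ T ∈ D, ∀ S ⊆ T, S ∈ D) → ∀ (I : Type v) [Fintype I] (e : I → Finset ι)
    (B : I → Set (Space fun m => ι → V m)),
    (∀ i, MeasurableSet[sig V (below D (e i))] (B i)) →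
    (loeb fun m => ι → V m) (⋂ i, B i) = 0 → ∀ ε : ℝ, 0 < ε →
    ∃ B' : I → ∀ m, Set (ι → V m), (∀ i m, DepSet (B' i m) (e i)) ∧
      (∀ i, (loeb fun m => ι → V m).real (B i \ internal (B' i)) ≤ ε) ∧
      ⋂ i, internal (B' i) = ∅ := by
  classical
  induction n with
  | zero =>
    intro D hcard hD I _ e B hB h0 ε hε
    obtain rfl := Finset.card_eq_zero.1 hcard
    have hB' : ∀ i, B i = ∅ ∨ B i = Set.univ := fun i =>
      eq_empty_or_univ_of_measurableSet_sig_empty (by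
        have := hB i
        rwa [below, filter_empty] at this)
    have hex : ∃ i, B i = ∅ := by
      by_contra! hne
      have : ⋂ i, B i = Set.univ := Set.iInter_eq_univ.2 fun i =>
        (hB' i).resolve_left (hne i).ne_empty
      rw [this, measure_univ] at h0
      exact one_ne_zero h0
    obtain ⟨i₀, hi₀⟩ := hex
    refine ⟨fun i m => if B i = ∅ then ∅ else Set.univ, fun i m => ?_, fun i => ?_, ?_⟩
    · dsimp only
      split_ifs
      exacts [depSet_empty, depSet_univ]
    · rcases hB' i with h | h
      · simp [h, hε.le]
      · by_cases h' : B i = ∅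
        · simp [h', hε.le]
        · simp [h', internal_univ, hε.le]
    · refine Set.eq_empty_of_subset_empty ((Set.iInter_subset _ i₀).trans ?_)
      simp [hi₀, internal_empty]
  | succ n ih =>
    intro D hcard hD I _ e B hB h0 ε hε
    have hDne : D.Nonempty := Finset.card_pos.1 (by omega)
    obtain ⟨T, hTmax⟩ := D.exists_maximal hDne
    have hTD := hTmax.prop
    have hcard' : (D.erase T).card = n := by rw [Finset.card_erase_of_mem hTD]; omega
    have hD' : ∀ S ∈ D.erase T, ∀ S' ⊆ S, S' ∈ D.erase T := by
      intro S hS S' hS'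
      refine mem_erase.2 ⟨?_, hD S (mem_erase.1 hS).2 S' hS'⟩
      rintro rfl
      exact (mem_erase.1 hS).1 (subset_antisymm (hTmax.le_of_ge (mem_erase.1 hS).2 hS') hS')
    by_cases hex : ∃ i, T ⊆ e i
    swap
    · push Not at hex
      exact ih _ hcard' hD' I e B (fun i => by
        rw [below_erase_of_not_subset (hex i)]; exact hB i) h0 ε hε
    obtain ⟨i₀, hi₀⟩ := hex
    set μ := loeb fun m => ι → V m with hμ
    set c : ℝ := 1 / (Fintype.card I + 1) with hc
    have hc0 : 0 < c := by positivity
    have hc1 : c * Fintype.card I < 1 := by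
      rw [hc, one_div_mul_eq_div, div_lt_one (by positivity)]
      linarith
    obtain ⟨η, hη, hηε⟩ : ∃ η : ℝ, 0 < η ∧ η + η / c ≤ ε / 2 := by
      refine ⟨ε / 2 / (1 + 1 / c), by positivity, le_of_eq ?_⟩
      field_simp
    choose K hK col L R hrep hR hRB using fun i =>
      exists_rep (T := T) (hB i) (ENNReal.ofReal_pos.2 hη)
    have hcolm : ∀ m, DependsOn (fun w i => col i m w) (T : Set ι) := fun m x y hxy => by
      funext i
      exact (hrep i).1 m hxy
    let κcol : ∀ m, (ι → V m) → ∀ i, K i := fun m w i => col i m w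
    let _ : ∀ i, Fintype (K i) := fun i => Fintype.ofFinite _
    have hreg := fun κ : ∀ i, K i => exists_regular hD' (T := T) (a := cell κcol κ)
      (mem_cyl_powerset.2 ⟨_, fun m x y hxy => by
        rw [Set.mem_ofPred_eq, Set.mem_ofPred_eq, show κcol m x = κcol m y from hcolm m hxy], rfl⟩)
      (fun i _ => sig_mono (below_subset_powerset D (e i)) _ (hB i))
      (fun i hi => by rw [below_erase_of_not_subset hi]; exact hB i)
      (by rw [measureReal_def, h0, ENNReal.toReal_zero]) hc0.le hc1
    choose S E hS hE hES hS0 hEL hEB using hreg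
    set ε' : ℝ := ε / (4 * (Fintype.card (∀ i, K i) + 1)) with hε'
    have hε'0 : 0 < ε' := by positivity
    have hε'ε : Fintype.card (∀ i, K i) * (2 * ε') ≤ ε / 2 := by
      rw [hε']
      have : (0 : ℝ) ≤ Fintype.card (∀ i, K i) := by positivity
      field_simp
      nlinarith
    have hIH := fun κ : ∀ i, K i => ih _ hcard' hD' (Option I) (fun o => o.elim T e)
      (fun o => o.elim (S κ) (E κ)) (fun o => by
        cases o with
        | none => exact hS κ
        | some i => exact hE κ i) (by
        refine measure_mono_null (fun x hx => ?_) (hES κ)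
        rw [Set.mem_iInter] at hx
        exact ⟨Set.mem_iInter.2 fun i => hx (some i), hx none⟩) ε' hε'0
    choose C hC hCε hC0 using hIH
    let B' : I → ∀ m, Set (ι → V m) := fun i m =>
      if T ⊆ e i then {w | w ∈ C (κcol m w) (some i) m ∧ w ∈ C (κcol m w) none m}
      else ⋂ κ, C κ (some i) m
    have hB'cell : ∀ i, T ⊆ e i → ∀ κ x, x ∈ cell κcol κ → (x ∈ internal (B' i) ↔
        x ∈ internal (C κ (some i)) ∧ x ∈ internal (C κ none)) := by
      intro i hi κ x hx
      simp only [mem_internal, B', hi, if_true, Set.mem_ofPred_eq]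
      rw [← eventually_and]
      refine eventually_congr (Eventually.mono (mem_internal.1 hx) fun m hm => ?_)
      rw [show κcol m (x m) = κ from hm]
    refine ⟨B', fun i m => ?_, fun i => ?_, ?_⟩
    · by_cases hi : T ⊆ e i
      · simp only [B', hi, if_true]
        intro x y hxy
        have h1 : κcol m x = κcol m y := hcolm m fun i' hi' => hxy i' (hi hi')
        simp only [Set.mem_ofPred_eq, h1]
        exact and_congr (hC _ (some i) m hxy) (hC _ none m fun i' hi' => hxy i' (hi hi'))
      · simp only [B', hi, if_false]
        exact DepSet.iInter fun κ => hC κ (some i) m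
    · have hη' : μ.real (symmDiff (R i) (B i)) ≤ η :=
        ENNReal.toReal_le_of_le_ofReal hη.le (hRB i).le
      by_cases hi : T ⊆ e i
      · have hrep' : Rep (sig V (below (D.erase T) (e i))) T κcol (fun κ => L i (κ i)) (R i) := by
          refine ⟨hcolm, fun κ => (hrep i).2.1 _, fun x κ hx => (hrep i).2.2 x (κ i) ?_⟩
          exact Eventually.mono (mem_internal.1 hx) fun m hm => congrFun hm i
        refine (measureReal_sdiff_le_of_cells (sig_le _) hrep' (sig_le _ _ (hB i))
          (E := fun κ => E κ i) (S := S) (E' := fun κ => internal (C κ (some i)))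
          (S' := fun κ => internal (C κ none)) hc0 hη' hS0
          (fun κ => hEL κ i hi _ ((hrep i).2.1 _)) (fun κ => hCε κ (some i))
          (fun κ => hCε κ none) fun κ x hx => ?_).trans (by linarith)
        exact (hB'cell i hi κ x hx.1.1).2 ⟨hx.1.2, hx.2⟩
      · have h1 : internal (B' i) = ⋂ κ, internal (C κ (some i)) := by
          rw [internal_iInter]
          simp only [B', hi, if_false]
        rw [h1, Set.sdiff_iInter]
        refine (measureReal_iUnion_fintype_le _).trans ?_
        have h2 : ∀ κ, μ.real (B i \ internal (C κ (some i))) ≤ 2 * ε' := fun κ => by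
          have := hCε κ (some i)
          simp only [Option.elim, hEB κ i hi] at this
          linarith
        refine (Finset.sum_le_sum fun κ _ => h2 κ).trans ?_
        rw [Finset.sum_const, card_univ, nsmul_eq_mul]
        linarith
    · refine Set.eq_empty_of_forall_notMem fun x hx => ?_
      rw [Set.mem_iInter] at hx
      obtain ⟨κ, hκ⟩ := exists_mem_cell κcol x
      have h1 : x ∈ ⋂ o, internal (C κ o) := by
        refine Set.mem_iInter.2 fun o => ?_
        cases o with
        | none => exact ((hB'cell i₀ hi₀ κ x hκ).1 (hx i₀)).2
        | some i =>
          by_cases hi : T ⊆ e i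
          · exact ((hB'cell i hi κ x hκ).1 (hx i)).1
          · have h2 : internal (B' i) = ⋂ κ, internal (C κ (some i)) := by
              rw [internal_iInter]
              simp only [B', hi, if_false]
            have h3 := hx i
            rw [h2] at h3
            exact Set.mem_iInter.1 h3 κ
      rw [hC0 κ] at h1
      exact h1

/-- The hypergraph removal lemma, for homomorphisms into partite systems. -/
theorem hypergraph_removal (I : Type v) [Fintype I] (e : I → Finset ι) {ε : ℝ} (hε : 0 < ε) :
    ∃ δ : ℝ, 0 < δ ∧ ∀ n : ℕ, 0 < n → ∀ E : I → Set (ι → Fin n), (∀ i, DepSet (E i) (e i)) →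
      dens (⋂ i, E i) ≤ δ → ∃ B : I → Set (ι → Fin n), (∀ i, DepSet (B i) (e i)) ∧
        (∀ i, dens (E i \ B i) ≤ ε) ∧ ⋂ i, B i = ∅ := by
  by_contra! hcon
  choose n hn E hE hdens hbad using fun m : ℕ => hcon (1 / ((m : ℝ) + 1)) (by positivity)
  have : ∀ m, Nonempty (Fin (n m)) := fun m => ⟨⟨0, hn m⟩⟩
  have hint : ⋂ i, internal (fun m => E m i) = internal fun m => ⋂ i, E m i :=
    internal_iInter fun i m => E m i
  have h0 : (loeb fun m => ι → Fin (n m)).real (⋂ i, internal fun m => E m i) = 0 := by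
    rw [hint]
    refine tendsto_nhds_unique (tendsto_dens _) ?_
    refine tendsto_of_tendsto_of_tendsto_of_le_of_le tendsto_const_nhds
      (tendsto_one_div_add_atTop_nhds_zero_nat.mono_left Nat.hyperfilter_le_atTop)
      (fun m => dens_nonneg _) hdens
  obtain ⟨B, hB, hBε, hB0⟩ := exists_internal_removal (V := fun m => Fin (n m))
    (univ : Finset (Finset ι)).card univ rfl (fun _ _ _ _ => mem_univ _) I e
    (fun i => internal fun m => E m i)
    (fun i => MeasurableSpace.measurableSet_generateFrom
      (internal_mem_cyl (mem_below.2 ⟨mem_univ _, subset_rfl⟩) fun m => hE m i))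
    ((measureReal_eq_zero_iff).1 h0) (ε / 2) (half_pos hε)
  have h1 : ∀ᶠ m in hyperfilter ℕ, ∀ i, dens (E m i \ B i m) ≤ ε := by
    refine eventually_all.2 fun i => ?_
    have h2 := tendsto_dens fun m => E m i ∩ (B i m)ᶜ
    rw [← internal_inter, ← compl_internal, ← Set.sdiff_eq] at h2
    refine (h2.eventually (gt_mem_nhds ((hBε i).trans_lt (half_lt_self hε)))).mono fun m hm => ?_
    rw [Set.sdiff_eq]
    exact hm.le
  rw [internal_iInter, internal_eq_empty_iff] at hB0
  obtain ⟨m, h1, h2⟩ := (h1.and hB0).exists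
  exact (hbad m (fun i => B i m) (fun i => hB i m) h1).ne_empty h2

end Loeb

end

namespace Berge

universe u

/-- If every `k`-subset of `h` contains a member of the family `D` of `r`-sets, then `D` contains a
positive proportion of the `r`-subsets of `h`. -/
lemma choose_card_le {β : Type*} [DecidableEq β] {r k : ℕ} (hrk : r ≤ k) {h : Finset β}
    (hk : k ≤ #h) {D : Finset (Finset β)} (hDr : ∀ S ∈ D, #S = r)
    (hD : ∀ K ⊆ h, #K = k → ∃ S ∈ D, S ⊆ K) :
    (#h).choose r ≤ k.choose r * #{S ∈ D | S ⊆ h} := by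
  have hpos : 0 < (#h - r).choose (k - r) := Nat.choose_pos (by omega)
  have hfib : ∀ S ∈ D.filter (· ⊆ h),
      #{K ∈ h.powersetCard k | S ⊆ K} ≤ (#h - r).choose (k - r) := by
    intro S hS
    obtain ⟨hSD, hSh⟩ := mem_filter.1 hS
    rw [← hDr S hSD, ← card_sdiff_of_subset hSh, ← card_powersetCard]
    refine card_le_card_of_injOn (· \ S) (fun K hK => ?_) (fun K hK K' hK' hKK => ?_)
    · obtain ⟨hK, hSK⟩ := mem_filter.1 hK
      obtain ⟨hKh, hKc⟩ := mem_powersetCard.1 hK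
      refine mem_coe.2 (mem_powersetCard.2 ⟨sdiff_subset_sdiff hKh subset_rfl, ?_⟩)
      rw [card_sdiff_of_subset hSK, hKc]
    · have h1 := sdiff_union_of_subset (mem_filter.1 hK).2
      have h2 := sdiff_union_of_subset (mem_filter.1 hK').2
      rw [← h1, ← h2]
      exact congrArg (· ∪ S) hKK
  have hcover : (#h).choose k ≤ #{S ∈ D | S ⊆ h} * (#h - r).choose (k - r) := by
    rw [← card_powersetCard, ← smul_eq_mul]
    refine (card_le_card (t := (D.filter (· ⊆ h)).biUnion fun S =>
      (h.powersetCard k).filter (S ⊆ ·)) fun K hK => ?_).trans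
        (card_biUnion_le.trans (sum_le_card_nsmul _ _ _ hfib))
    obtain ⟨hKh, hKc⟩ := mem_powersetCard.1 hK
    obtain ⟨S, hSD, hSK⟩ := hD K hKh hKc
    exact mem_biUnion.2 ⟨S, mem_filter.2 ⟨hSD, hSK.trans hKh⟩, mem_filter.2 ⟨hK, hSK⟩⟩
  refine Nat.le_of_mul_le_mul_right ?_ hpos
  rw [← Nat.choose_mul hrk]
  calc _ ≤ #{S ∈ D | S ⊆ h} * (#h - r).choose (k - r) * k.choose r := by gcongr
    _ = _ := by ring

lemma pow_le_mul_choose {r a : ℕ} (hr : 1 ≤ r) (hra : r ≤ a) :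
    a ^ r ≤ r ^ r * r.factorial * a.choose r := by
  have h1 : a ≤ r * (a + 1 - r) := by
    obtain ⟨b, rfl⟩ := Nat.exists_eq_add_of_le hra
    rw [show r + b + 1 - r = b + 1 by omega]
    nlinarith
  calc a ^ r ≤ (r * (a + 1 - r)) ^ r := Nat.pow_le_pow_left h1 r
    _ = r ^ r * (a + 1 - r) ^ r := mul_pow _ _ _
    _ ≤ r ^ r * a.descFactorial r := by gcongr; exact Nat.pow_sub_le_descFactorial a r
    _ = _ := by rw [Nat.descFactorial_eq_factorial_mul_choose, mul_assoc]

/-- The constant in the counting bound. -/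
def countConst (r k : ℕ) : ℕ := r ^ r * r.factorial * k.choose r

lemma sum_card_pow_le {β : Type*} [DecidableEq β] {r k m : ℕ} (hr : 1 ≤ r) (hrk : r ≤ k)
    {H : Finset (Finset β)} (hk : ∀ h ∈ H, k ≤ #h) {D : Finset (Finset β)}
    (hDr : ∀ S ∈ D, #S = r) (hDm : ∀ S ∈ D, #{h ∈ H | S ⊆ h} < m)
    (hD : ∀ h ∈ H, ∀ K ⊆ h, #K = k → ∃ S ∈ D, S ⊆ K) :
    ∑ h ∈ H, #h ^ r ≤ countConst r k * m * #D := by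
  calc ∑ h ∈ H, #h ^ r ≤ ∑ h ∈ H, countConst r k * #{S ∈ D | S ⊆ h} := by
        refine sum_le_sum fun h hh => ?_
        refine (pow_le_mul_choose hr (hrk.trans (hk h hh))).trans ?_
        rw [countConst, mul_assoc _ (k.choose r)]
        gcongr
        exact choose_card_le hrk (hk h hh) hDr (hD h hh)
    _ = countConst r k * ∑ S ∈ D, #{h ∈ H | S ⊆ h} := by
        rw [← mul_sum]
        congr 1
        exact sum_card_bipartiteAbove_eq_sum_card_bipartiteBelow
          fun (h S : Finset β) => S ⊆ h
    _ ≤ countConst r k * (#D * m) := by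
        gcongr
        exact sum_le_card_nsmul _ _ _ fun S hS => (hDm S hS).le
    _ = _ := by ring

variable {α : Type u} [DecidableEq α] {β : Type*} [DecidableEq β]

lemma exists_embedding_of_ramsey {k r : ℕ} {F : Finset (Finset α)} (hF : RamseyProp k r F) :
    ∃ φ : α → Fin k, Function.Injective φ := by
  obtain ⟨c, φ, hφ, -⟩ := hF fun _ => true
  exact ⟨φ, hφ⟩

/-- In a Berge-`F`-free hypergraph, every `k`-set contains a copy of `F` all of whose edges lie in
few hyperedges. -/
lemma exists_light_copy {k r : ℕ} {F : Finset (Finset α)} (hF : RamseyProp k r F)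
    {H : Finset (Finset β)} (hH : ¬ ContainsBerge F H) {K : Finset β} (hK : #K = k) :
    ∃ x : α → β, Function.Injective x ∧ (∀ a, x a ∈ K) ∧
      ∀ e ∈ F, #{h ∈ H | e.image x ⊆ h} < #F := by
  classical
  let ψ : Fin k → β := fun i => (K.equivFinOfCardEq hK).symm i
  have hψ : Function.Injective ψ :=
    Subtype.val_injective.comp (K.equivFinOfCardEq hK).symm.injective
  obtain ⟨c, φ, hφ, hφF⟩ := hF fun S => decide (#{h ∈ H | S.image ψ ⊆ h} < #F)
  refine ⟨ψ ∘ φ, hψ.comp hφ, fun a => ((K.equivFinOfCardEq hK).symm (φ a)).2, ?_⟩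
  simp only [← image_image]
  cases c with
  | true => exact fun e he => by simpa using (mem_filter.1 (hφF e he)).2
  | false =>
    exfalso
    have hbig : ∀ e ∈ F, #F ≤ #{h ∈ H | (e.image φ).image ψ ⊆ h} := fun e he => by
      simpa using (mem_filter.1 (hφF e he)).2
    obtain ⟨f, hf, hfH⟩ := (Finset.all_card_le_biUnion_card_iff_exists_injective
      fun e : F => H.filter fun h => ((e : Finset α).image φ).image ψ ⊆ h).1 (by
        intro s
        rcases s.eq_empty_or_nonempty with rfl | ⟨e, he⟩
        · simp
        · calc #s ≤ Fintype.card F := card_le_univ s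
            _ = #F := Fintype.card_coe F
            _ ≤ _ := hbig e e.2
            _ ≤ _ := card_le_card (subset_biUnion_of_mem
              (fun e : F => H.filter fun h => ((e : Finset α).image φ).image ψ ⊆ h) he))
    refine hH ⟨ψ ∘ φ, fun e => if he : e ∈ F then f ⟨e, he⟩ else ∅, hψ.comp hφ, ?_, ?_, ?_⟩
    · intro e he e' he' h
      simp only [mem_coe.1 he, mem_coe.1 he', dite_true] at h
      exact congrArg Subtype.val (hf h)
    · intro e he
      simp only [he, dite_true]
      exact (mem_filter.1 (hfH ⟨e, he⟩)).1
    · intro e he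
      simp only [he, dite_true, ← image_image]
      exact (mem_filter.1 (hfH ⟨e, he⟩)).2

/-- A copy of `F` in the shadow of a Berge-`F`-free hypergraph has two edges in one hyperedge. -/
lemma exists_subset_of_shadow_copy {r : ℕ} {F : Finset (Finset α)} (hF : ∀ e ∈ F, #e = r)
    {H : Finset (Finset β)} (hH : ¬ ContainsBerge F H) {x : α → β} (hx : Function.Injective x)
    (hxH : ∀ e ∈ F, ∃ h ∈ H, e.image x ⊆ h) :
    ∃ U : Finset α, #U = r + 1 ∧ ∃ h ∈ H, ∀ a ∈ U, x a ∈ h := by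
  classical
  choose! f hfH hf using hxH
  have hinj : ¬ Set.InjOn f (F : Set (Finset α)) := fun hinj => hH ⟨x, f, hx, hinj, hfH, hf⟩
  simp only [Set.InjOn, not_forall] at hinj
  obtain ⟨e, he, e', he', hee', hne⟩ := hinj
  have hcard : r + 1 ≤ #(e ∪ e') := by
    rw [Nat.succ_le_iff, ← hF e he]
    refine card_lt_card (ssubset_of_subset_of_ne subset_union_left fun h => hne ?_)
    refine (eq_of_subset_of_card_le ?_ ?_).symm
    · rw [h]
      exact subset_union_right
    · rw [hF e he, hF e' he']
  obtain ⟨U, hU, hUc⟩ := exists_subset_card_eq hcard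
  refine ⟨U, hUc, f e, hfH e he, fun a ha => ?_⟩
  rcases mem_union.1 (hU ha) with h | h
  · exact hf e he (mem_image_of_mem x h)
  · rw [hee']
    exact hf e' he' (mem_image_of_mem x h)

variable [Fintype α]

lemma card_forall_mem {n : ℕ} (U : Finset α) (h : Finset (Fin n)) :
    #{x : α → Fin n | ∀ a ∈ U, x a ∈ h} = #h ^ #U * n ^ (Fintype.card α - #U) := by
  have : ({x : α → Fin n | ∀ a ∈ U, x a ∈ h} : Finset _) =
      Fintype.piFinset fun a => if a ∈ U then h else univ := by
    ext x
    simp only [mem_filter, mem_univ, true_and, Fintype.mem_piFinset]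
    refine forall_congr' fun a => ?_
    by_cases ha : a ∈ U <;> simp [ha]
  rw [this, Fintype.card_piFinset]
  simp only [apply_ite card, card_univ, Fintype.card_fin]
  rw [prod_ite, prod_const, prod_const, filter_mem_eq_inter, univ_inter, ← card_compl]
  congr 3
  ext a
  simp

lemma card_not_injective_le (n : ℕ) :
    #{x : α → Fin n | ¬ Function.Injective x} ≤
      Fintype.card α ^ 2 * n ^ (Fintype.card α - 1) := by
  classical
  have hsub : ({x : α → Fin n | ¬ Function.Injective x} : Finset _) ⊆
      (univ.filter fun p : α × α => p.1 ≠ p.2).biUnion fun p => {x | x p.1 = x p.2} := by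
    intro x hx
    have hx' : ¬ Function.Injective x := (mem_filter.1 hx).2
    simp only [Function.Injective, not_forall] at hx'
    obtain ⟨a, b, hab, hne⟩ := hx'
    exact mem_biUnion.2 ⟨(a, b), by simpa using hne, by simpa using hab⟩
  have hfib : ∀ p ∈ univ.filter (fun p : α × α => p.1 ≠ p.2),
      #{x : α → Fin n | x p.1 = x p.2} ≤ n ^ (Fintype.card α - 1) := by
    rintro ⟨a, b⟩ hab
    have hab' : a ≠ b := (mem_filter.1 hab).2
    have hc : Fintype.card ({c // c ≠ a} → Fin n) = n ^ (Fintype.card α - 1) := by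
      simp
    rw [← hc, ← card_univ]
    refine card_le_card_of_injOn (fun x c => x c) (fun _ _ => mem_coe.2 (mem_univ _))
      fun x hx y hy hxy => ?_
    have hxy' : ∀ c, c ≠ a → x c = y c := fun c hc => congrFun hxy ⟨c, hc⟩
    have hx' : x a = x b := (mem_filter.1 hx).2
    have hy' : y a = y b := (mem_filter.1 hy).2
    funext c
    by_cases hc : c = a
    · rw [hc, hx', hy', hxy' b hab'.symm]
    · exact hxy' c hc
  refine (card_le_card hsub).trans (card_biUnion_le.trans
    ((sum_le_card_nsmul _ _ _ hfib).trans ?_))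
  rw [smul_eq_mul]
  gcongr
  refine (card_le_univ _).trans ?_
  rw [Fintype.card_prod, sq]

open Classical in
/-- A set of maps depending only on the coordinates in `e` contains many maps with each given image
of `e`. -/
lemma card_image_mul_le {n : ℕ} {e : Finset α} {A : Finset (α → Fin n)}
    (hA : Loeb.DepSet (A : Set (α → Fin n)) e) :
    #(A.image fun x => e.image x) * n ^ (Fintype.card α - #e) ≤ #A := by
  rcases A.eq_empty_or_nonempty with rfl | ⟨x₀, -⟩
  · simp
  have : Nonempty (α → Fin n) := ⟨x₀⟩
  have hc : Fintype.card ({a // a ∉ e} → Fin n) = n ^ (Fintype.card α - #e) := by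
    simp
  have hex : ∀ S ∈ A.image fun x => e.image x, ∃ x ∈ A, e.image x = S := fun S hS =>
    mem_image.1 hS
  choose! y hyA hy using hex
  let g : Finset (Fin n) × ({a // a ∉ e} → Fin n) → α → Fin n := fun p a =>
    if ha : a ∈ e then y p.1 a else p.2 ⟨a, ha⟩
  have hg : ∀ p, ∀ a ∈ e, g p a = y p.1 a := fun p a ha => by simp only [g, ha, dite_true]
  rw [← hc, ← card_univ, ← card_product]
  refine card_le_card_of_injOn g (fun p hp => ?_) fun p hp q hq hpq => ?_
  · exact (hA (hg p)).2 (hyA _ (mem_product.1 hp).1)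
  · refine Prod.ext ?_ ?_
    · rw [← hy _ (mem_product.1 hp).1, ← hy _ (mem_product.1 hq).1]
      refine image_congr fun a ha => ?_
      rw [← hg p a ha, ← hg q a ha, hpq]
    · funext a
      have h1 := congrFun hpq a
      simpa only [g, a.2, dite_false] using h1

end Berge

namespace Berge

universe u

section bounds

variable {α : Type u} [DecidableEq α] {k r n : ℕ} {F : Finset (Finset α)}
  {H : Finset (Finset (Fin n))}

lemma le_of_ramsey (hFr : ∀ e ∈ F, #e = r) (hk : RamseyProp k r F) (hne : F.Nonempty) : r ≤ k := by
  obtain ⟨φ, hφ⟩ := exists_embedding_of_ramsey hk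
  obtain ⟨e, he⟩ := hne
  rw [← hFr e he, ← card_image_of_injective e hφ]
  simpa using card_le_univ (e.image φ)

lemma sum_card_pow_le_mul_pow (hr : 1 ≤ r) (hFr : ∀ e ∈ F, #e = r) (hk : RamseyProp k r F)
    (hne : F.Nonempty) (hH : ¬ ContainsBerge F H) (hHk : ∀ h ∈ H, k ≤ #h) :
    ∑ h ∈ H, #h ^ r ≤ countConst r k * #F * n ^ r := by
  refine (sum_card_pow_le hr (le_of_ramsey hFr hk hne) hHk
    (D := ((univ : Finset (Fin n)).powersetCard r).filter fun S => #{h ∈ H | S ⊆ h} < #F)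
    (fun S hS => (mem_powersetCard.1 (mem_filter.1 hS).1).2)
    (fun S hS => (mem_filter.1 hS).2) fun h _ K _ hK => ?_).trans ?_
  · obtain ⟨x, hx, hxK, hxF⟩ := exists_light_copy hk hH hK
    obtain ⟨e, he⟩ := hne
    refine ⟨e.image x, mem_filter.2 ⟨mem_powersetCard.2 ⟨subset_univ _, ?_⟩, hxF e he⟩, ?_⟩
    · rw [card_image_of_injective e hx, hFr e he]
    · exact image_subset_iff.2 fun a _ => hxK a
  · gcongr
    refine (card_filter_le _ _).trans ?_
    rw [card_powersetCard, card_fin]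
    exact Nat.choose_le_pow n r

variable [Fintype α]

/-- There are few copies of `F` in the shadow of a Berge-`F`-free hypergraph with small
hyperedges. -/
lemma card_shadow_copies_le (hr : 1 ≤ r) (hFr : ∀ e ∈ F, #e = r) (hk : RamseyProp k r F)
    (hne : F.Nonempty) (hH : ¬ ContainsBerge F H) (hHk : ∀ h ∈ H, k ≤ #h) {δ : ℝ} (hδ : 0 ≤ δ)
    (hHδ : ∀ h ∈ H, (#h : ℝ) ≤ δ * n) (P : Finset (α → Fin n))
    (hP : ∀ x ∈ P, ∀ e ∈ F, ∃ h ∈ H, e.image x ⊆ h) :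
    (#P : ℝ) ≤ Fintype.card α ^ 2 * (n : ℝ) ^ (Fintype.card α - 1) +
      2 ^ Fintype.card α * (δ * (countConst r k * #F) * (n : ℝ) ^ Fintype.card α) := by
  classical
  have hsub : P ⊆ ({x : α → Fin n | ¬ Function.Injective x} : Finset _) ∪
      ((univ : Finset α).powersetCard (r + 1)).biUnion fun U => H.biUnion fun h =>
        {x : α → Fin n | ∀ a ∈ U, x a ∈ h} := by
    intro x hx
    by_cases hinj : Function.Injective x
    · obtain ⟨U, hU, h, hh, hUh⟩ := exists_subset_of_shadow_copy hFr hH hinj (hP x hx)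
      refine mem_union_right _ (mem_biUnion.2 ⟨U, mem_powersetCard.2 ⟨subset_univ _, hU⟩,
        mem_biUnion.2 ⟨h, hh, ?_⟩⟩)
      simpa using hUh
    · exact mem_union_left _ (by simpa using hinj)
  have hU : ∀ U ∈ (univ : Finset α).powersetCard (r + 1),
      ((#(H.biUnion fun h => {x : α → Fin n | ∀ a ∈ U, x a ∈ h}) : ℕ) : ℝ) ≤
        δ * (countConst r k * #F) * (n : ℝ) ^ Fintype.card α := by
    intro U hU
    have hUc := (mem_powersetCard.1 hU).2
    have hle : r + 1 ≤ Fintype.card α := hUc ▸ card_le_univ U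
    have h1 : (∑ h ∈ H, (#h : ℝ) ^ r) ≤ countConst r k * #F * (n : ℝ) ^ r := by
      exact_mod_cast sum_card_pow_le_mul_pow hr hFr hk hne hH hHk
    calc ((#(H.biUnion fun h => {x : α → Fin n | ∀ a ∈ U, x a ∈ h}) : ℕ) : ℝ)
        ≤ ((∑ h ∈ H, #{x : α → Fin n | ∀ a ∈ U, x a ∈ h} : ℕ) : ℝ) := by
          exact_mod_cast card_biUnion_le
      _ = ∑ h ∈ H, (#h : ℝ) ^ r * #h * (n : ℝ) ^ (Fintype.card α - (r + 1)) := by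
          rw [Nat.cast_sum]
          refine sum_congr rfl fun h _ => ?_
          rw [card_forall_mem, hUc]
          push_cast
          ring
      _ ≤ ∑ h ∈ H, (#h : ℝ) ^ r * (δ * n) * (n : ℝ) ^ (Fintype.card α - (r + 1)) := by
          refine sum_le_sum fun h hh => ?_
          gcongr
          exact hHδ h hh
      _ = (∑ h ∈ H, (#h : ℝ) ^ r) * (δ * n * (n : ℝ) ^ (Fintype.card α - (r + 1))) := by
          rw [sum_mul]
          exact sum_congr rfl fun h _ => by ring
      _ ≤ (countConst r k * #F * (n : ℝ) ^ r) *
          (δ * n * (n : ℝ) ^ (Fintype.card α - (r + 1))) := by gcongr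
      _ = _ := by
          obtain ⟨b, hb⟩ := Nat.exists_eq_add_of_le hle
          rw [hb, Nat.add_sub_cancel_left]
          ring
  calc (#P : ℝ) ≤ #{x : α → Fin n | ¬ Function.Injective x} +
        ((#(((univ : Finset α).powersetCard (r + 1)).biUnion fun U => H.biUnion fun h =>
          {x : α → Fin n | ∀ a ∈ U, x a ∈ h}) : ℕ) : ℝ) := by
        exact_mod_cast (card_le_card hsub).trans (card_union_le _ _)
    _ ≤ _ := by
        gcongr
        · exact_mod_cast card_not_injective_le n
        · calc _ ≤ ∑ U ∈ (univ : Finset α).powersetCard (r + 1),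
              ((#(H.biUnion fun h => {x : α → Fin n | ∀ a ∈ U, x a ∈ h}) : ℕ) : ℝ) := by
                exact_mod_cast card_biUnion_le
            _ ≤ #((univ : Finset α).powersetCard (r + 1)) •
                (δ * (countConst r k * #F) * (n : ℝ) ^ Fintype.card α) :=
                sum_le_card_nsmul _ _ _ hU
            _ ≤ _ := by
                rw [nsmul_eq_mul]
                gcongr
                have := card_le_univ ((univ : Finset α).powersetCard (r + 1))
                rw [Fintype.card_finset] at this
                exact_mod_cast this

lemma dens_coe (P : Finset (α → Fin n)) :
    Loeb.dens (P : Set (α → Fin n)) = #P / (n : ℝ) ^ Fintype.card α := by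
  rw [Loeb.dens, Set.ncard_coe_finset, Nat.card_eq_fintype_card, Fintype.card_fun,
    Fintype.card_fin, Nat.cast_pow]

open Classical in
/-- The conclusion, given that light shadow copies of `F` can be destroyed by removing few
light edges. -/
lemma sum_card_pow_le_of_removal (hr : 1 ≤ r) (hn : 0 < n) (hFr : ∀ e ∈ F, #e = r)
    (hk : RamseyProp k r F) (hne : F.Nonempty) (hH : ¬ ContainsBerge F H)
    (hHk : ∀ h ∈ H, k ≤ #h) {E B : F → Set (α → Fin n)}
    (hE : ∀ e x, x ∈ E e ↔ #((e : Finset α).image x) = r ∧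
      #{h ∈ H | (e : Finset α).image x ⊆ h} < #F ∧ ∃ h ∈ H, (e : Finset α).image x ⊆ h)
    (hEdep : ∀ e : F, Loeb.DepSet (E e) (e : Finset α))
    (hB : ∀ e : F, Loeb.DepSet (B e) (e : Finset α)) {ε : ℝ}
    (hdens : ∀ e, Loeb.dens (E e \ B e) ≤ ε) (hempty : ⋂ e, B e = ∅) :
    ∑ h ∈ H, (#h : ℝ) ^ r ≤ countConst r k * #F * (#F * (ε * (n : ℝ) ^ r)) := by
  let A : F → Finset (α → Fin n) := fun e => (E e \ B e).toFinset
  have hA : ∀ e, (A e : Set (α → Fin n)) = E e \ B e := fun e => Set.coe_toFinset _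
  have hmem : ∀ e x, x ∈ A e ↔ x ∈ E e ∧ x ∉ B e := fun e x => Set.mem_toFinset
  let D : Finset (Finset (Fin n)) := univ.biUnion fun e : F =>
    (A e).image fun x => (e : Finset α).image x
  have hD : ∀ S ∈ D, ∃ e x, x ∈ E e ∧ (e : Finset α).image x = S := by
    intro S hS
    obtain ⟨e, -, hS⟩ := mem_biUnion.1 hS
    obtain ⟨x, hx, rfl⟩ := mem_image.1 hS
    exact ⟨e, x, ((hmem e x).1 hx).1, rfl⟩
  have hDcard : (#D : ℝ) ≤ #F * (ε * (n : ℝ) ^ r) := by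
    have hDe : ∀ e : F, ((#((A e).image fun x => (e : Finset α).image x) : ℕ) : ℝ) ≤
        ε * (n : ℝ) ^ r := by
      intro e
      have hle : r ≤ Fintype.card α := hFr e e.2 ▸ card_le_univ (e : Finset α)
      have h1 := card_image_mul_le (A := A e) (e := (e : Finset α)) (by
        rw [hA]
        exact (hEdep e).inter (hB e).compl)
      have h2 := hdens e
      have hn' : (0 : ℝ) < n := by exact_mod_cast hn
      rw [← hA, dens_coe, div_le_iff₀ (by positivity)] at h2
      rw [hFr e e.2] at h1
      have h3 : ((#((A e).image fun x => (e : Finset α).image x) : ℕ) : ℝ) *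
          (n : ℝ) ^ (Fintype.card α - r) ≤ #(A e) := by exact_mod_cast h1
      refine le_of_mul_le_mul_right (h3.trans (h2.trans (le_of_eq ?_)))
        (pow_pos hn' (Fintype.card α - r))
      rw [mul_assoc, ← pow_add, Nat.add_sub_cancel' hle]
    calc (#D : ℝ) ≤ ∑ e : F, ((#((A e).image fun x => (e : Finset α).image x) : ℕ) : ℝ) := by
          exact_mod_cast card_biUnion_le
      _ ≤ #(univ : Finset F) • (ε * (n : ℝ) ^ r) := sum_le_card_nsmul _ _ _ fun e _ => hDe e
      _ = _ := by rw [nsmul_eq_mul, card_univ, Fintype.card_coe]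
  have hsum : ∑ h ∈ H, #h ^ r ≤ countConst r k * #F * #D := by
    refine sum_card_pow_le hr (le_of_ramsey hFr hk hne) hHk (fun S hS => ?_) (fun S hS => ?_)
      fun h hh K hKh hK => ?_
    · obtain ⟨e, x, hx, rfl⟩ := hD S hS
      exact ((hE e x).1 hx).1
    · obtain ⟨e, x, hx, rfl⟩ := hD S hS
      convert ((hE e x).1 hx).2.1
    · obtain ⟨x, hx, hxK, hxF⟩ := exists_light_copy hk hH hK
      have hsubK : ∀ e : Finset α, e.image x ⊆ K := fun e => image_subset_iff.2 fun a _ => hxK a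
      have hxE : ∀ e : F, x ∈ E e := fun e => (hE e x).2
        ⟨by rw [card_image_of_injective _ hx, hFr e e.2], by convert hxF e e.2,
          h, hh, (hsubK e).trans hKh⟩
      have hxB : x ∉ ⋂ e, B e := by simp [hempty]
      rw [Set.mem_iInter, not_forall] at hxB
      obtain ⟨e, he⟩ := hxB
      exact ⟨(e : Finset α).image x, mem_biUnion.2 ⟨e, mem_univ _,
        mem_image.2 ⟨x, (hmem e x).2 ⟨hxE e, he⟩, rfl⟩⟩, hsubK e⟩
  calc ∑ h ∈ H, (#h : ℝ) ^ r ≤ countConst r k * #F * #D := by exact_mod_cast hsum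
    _ ≤ _ := by gcongr

end bounds

end Berge

theorem statement1 {α : Type*} [DecidableEq α] (r k : ℕ) (hr : 2 ≤ r)
    (F : Finset (Finset α)) (hF : ∀ e ∈ F, e.card = r)
    (hk : RamseyProp k r F) :
    ∀ ε : ℝ, 0 < ε → ∃ δ : ℝ, 0 < δ ∧ ∃ N : ℕ, ∀ n ≥ N, ∀ H : Finset (Finset (Fin n)),
      ¬ ContainsBerge F H →
      (∀ h ∈ H, k ≤ h.card ∧ (h.card : ℝ) ≤ δ * n) →
      ∑ h ∈ H, (h.card : ℝ) ^ r ≤ ε * (n : ℝ) ^ r := by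
  classical
  intro ε hε
  obtain ⟨φ, hφ⟩ := Berge.exists_embedding_of_ramsey hk
  rcases F.eq_empty_or_nonempty with rfl | hne
  · refine ⟨1, one_pos, k, fun n hn H hH _ => absurd ?_ hH⟩
    exact ⟨Fin.castLE hn ∘ φ, fun _ => ∅, (Fin.castLE_injective hn).comp hφ, by simp, by simp,
      by simp⟩
  have : Fintype α := Fintype.ofInjective φ hφ
  set v := Fintype.card α with hv
  set C : ℝ := Berge.countConst r k * #F with hC
  have hC0 : 0 ≤ C := by positivity
  set ε' : ℝ := ε / (C * #F + 1) with hε'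
  have hε'0 : 0 < ε' := by positivity
  obtain ⟨δ, hδ, hrem⟩ := Loeb.hypergraph_removal F (fun e => (e : Finset α)) hε'0
  set δ' : ℝ := δ / 2 / (2 ^ v * C + 1) with hδ'
  have hδ'0 : 0 < δ' := by positivity
  obtain ⟨N, hN⟩ := exists_nat_gt ((v : ℝ) ^ 2 / (δ / 2))
  refine ⟨δ', hδ'0, N + 1, fun n hn H hH hHk => ?_⟩
  have hn0 : 0 < n := by omega
  have hn0' : (0 : ℝ) < n := by exact_mod_cast hn0
  have hnN : (N : ℝ) ≤ n := by exact_mod_cast (by omega : N ≤ n)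
  have hv0 : 1 ≤ v := by
    obtain ⟨e, he⟩ := hne
    have := hF e he ▸ card_le_univ e
    omega
  let E : F → Set (α → Fin n) := fun e => {x | #((e : Finset α).image x) = r ∧
    #{h ∈ H | (e : Finset α).image x ⊆ h} < #F ∧ ∃ h ∈ H, (e : Finset α).image x ⊆ h}
  have hEdep : ∀ e : F, Loeb.DepSet (E e) (e : Finset α) := fun e x y hxy => by
    have : (e : Finset α).image x = (e : Finset α).image y := image_congr hxy
    simp only [E, Set.mem_ofPred_eq, this]
  have hdens : Loeb.dens (⋂ e, E e) ≤ δ := by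
    rw [← Set.coe_toFinset (⋂ e, E e), Berge.dens_coe, div_le_iff₀ (by positivity)]
    refine (Berge.card_shadow_copies_le (by omega) hF hk hne hH (fun h hh => (hHk h hh).1)
      hδ'0.le (fun h hh => (hHk h hh).2) _ fun x hx e he => ?_).trans ?_
    · exact (Set.mem_iInter.1 (Set.mem_toFinset.1 hx) ⟨e, he⟩).2.2
    · have h1 : (v : ℝ) ^ 2 ≤ δ / 2 * n := by
        rw [div_lt_iff₀ (by positivity)] at hN
        nlinarith
      have h2 : 2 ^ v * (δ' * C) ≤ δ / 2 := by
        rw [hδ', show (2 : ℝ) ^ v * (δ / 2 / (2 ^ v * C + 1) * C) =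
          δ / 2 * ((2 ^ v * C) / (2 ^ v * C + 1)) by ring]
        refine mul_le_of_le_one_right (by positivity) (div_le_one_of_le₀ ?_ (by positivity))
        linarith
      have h3 : (n : ℝ) * (n : ℝ) ^ (v - 1) = (n : ℝ) ^ v := by
        rw [← pow_succ', Nat.sub_add_cancel hv0]
      calc (v : ℝ) ^ 2 * (n : ℝ) ^ (v - 1) + 2 ^ v * (δ' * C * (n : ℝ) ^ v)
          = (v : ℝ) ^ 2 * (n : ℝ) ^ (v - 1) + 2 ^ v * (δ' * C) * (n : ℝ) ^ v := by ring
        _ ≤ δ / 2 * n * (n : ℝ) ^ (v - 1) + δ / 2 * (n : ℝ) ^ v := by gcongr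
        _ = δ * (n : ℝ) ^ v := by rw [mul_assoc, h3]; ring
  obtain ⟨B, hB, hBε, hB0⟩ := hrem n hn0 E hEdep hdens
  have hfin := Berge.sum_card_pow_le_of_removal (by omega) hn0 hF hk hne hH
    (fun h hh => (hHk h hh).1) (fun e x => Iff.rfl) hEdep hB hBε hB0
  refine hfin.trans ?_
  have h1 : C * #F * ε' ≤ ε := by
    rw [hε', mul_div_left_comm]
    refine mul_le_of_le_one_right hε.le (div_le_one_of_le₀ ?_ (by positivity))
    linarith
  calc C * (#F * (ε' * (n : ℝ) ^ r)) = C * #F * ε' * (n : ℝ) ^ r := by ring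
    _ ≤ ε * (n : ℝ) ^ r := by gcongr
end

section
/- Let r ≥ 2, let F be an r-graph, and let k be an integer satisfying the Ramsey condition for F. For every ε > 0 there exists N such that for every n ≥ N, every k-uniform Berge-F-free hypergraph H on n vertices has at most ε · n^r hyperedges. -/
open Finset

open MeasureTheory Filter Topology

theorem integral_mul_condExp_eq {Ω : Type*} {m mΩ : MeasurableSpace Ω} {μ : Measure Ω}
    [IsProbabilityMeasure μ] (hm : m ≤ mΩ) {h f : Ω → ℝ}
    (hh : StronglyMeasurable[m] h) (hh2 : MemLp h 2 μ) (hf : MemLp f 2 μ) :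
    ∫ x, h x * (μ[f | m]) x ∂μ = ∫ x, h x * f x ∂μ := by
  have hprod : Integrable (h * f) μ := hh2.integrable_mul hf
  have h1 := condExp_mul_of_stronglyMeasurable_left (m := m) hh hprod
    (hf.integrable (by norm_num))
  calc ∫ x, h x * (μ[f | m]) x ∂μ = ∫ x, (μ[h * f | m]) x ∂μ := integral_congr_ae h1.symm
    _ = ∫ x, (h * f) x ∂μ := integral_condExp hm
    _ = _ := rfl

theorem ae_eq_of_integral_mul_le {Ω : Type*} {mΩ : MeasurableSpace Ω} {μ : Measure Ω}
    {g h : Ω → ℝ} (hg : MemLp g 2 μ) (hh : MemLp h 2 μ)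
    (hle : ∫ x, g x * g x ∂μ - 2 * ∫ x, g x * h x ∂μ + ∫ x, h x * h x ∂μ ≤ 0) :
    g =ᵐ[μ] h := by
  have i1 : Integrable (fun x => g x * g x) μ := hg.integrable_mul hg
  have i2 : Integrable (fun x => g x * h x) μ := hg.integrable_mul hh
  have i3 : Integrable (fun x => h x * h x) μ := hh.integrable_mul hh
  have e : ∫ x, (g x - h x) ^ 2 ∂μ
      = ∫ x, g x * g x ∂μ - 2 * ∫ x, g x * h x ∂μ + ∫ x, h x * h x ∂μ := by
    rw [← integral_const_mul, ← integral_sub i1 (i2.const_mul 2), ← integral_add]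
    · congr 1; ext x; ring
    · exact i1.sub (i2.const_mul 2)
    · exact i3
  have hi : Integrable (fun x => (g x - h x) ^ 2) μ := (hg.sub hh).integrable_sq
  have h0 : ∫ x, (g x - h x) ^ 2 ∂μ = 0 :=
    le_antisymm (e ▸ hle) (integral_nonneg fun x => sq_nonneg _)
  rw [integral_eq_zero_iff_of_nonneg (fun x => sq_nonneg _) hi] at h0
  filter_upwards [h0] with x hx
  have : (g x - h x) ^ 2 = 0 := hx
  nlinarith [pow_eq_zero_iff (two_ne_zero) |>.1 this]

/-- If a measure-preserving map fixes `f` and pulls `m` back into a smaller `m'`, then conditioning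
`f` on `m` is the same as conditioning on `m'`. -/
theorem condExp_ae_eq_of_measurePreserving {Ω : Type*} {m m' mΩ : MeasurableSpace Ω} {μ : Measure Ω}
    [IsProbabilityMeasure μ] (hm : m ≤ mΩ) (hm' : m' ≤ m)
    {T : Ω → Ω} (hT : MeasurePreserving T μ μ) (hTm : Measurable[m', m] T)
    {f : Ω → ℝ} (hf : MemLp f 2 μ) (hfT : ∀ x, f (T x) = f x) :
    μ[f | m] =ᵐ[μ] μ[f | m'] := by
  have hg : MemLp (μ[f | m]) 2 μ := hf.condExp (by norm_num)
  have hg' : MemLp (μ[f | m']) 2 μ := hf.condExp (by norm_num)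
  have sg : StronglyMeasurable[m] (μ[f | m]) := stronglyMeasurable_condExp
  have sg' : StronglyMeasurable[m'] (μ[f | m']) := stronglyMeasurable_condExp
  have hgT : MemLp (fun x => (μ[f | m]) (T x)) 2 μ := hg.comp_measurePreserving hT
  have sgT : StronglyMeasurable[m'] (fun x => (μ[f | m]) (T x)) :=
    sg.comp_measurable hTm
  have a1 := integral_mul_condExp_eq hm sg hg hf
  have a2 := integral_mul_condExp_eq (hm'.trans hm) sg' hg' hf
  have a3 := integral_mul_condExp_eq hm (sg'.mono hm') hg' hf
  have a4 := integral_mul_condExp_eq (hm'.trans hm) sgT hgT hf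
  have comp : ∀ u : Ω → ℝ, AEStronglyMeasurable u μ → ∫ x, u (T x) ∂μ = ∫ x, u x ∂μ := by
    intro u hu
    have := integral_map (f := u) hT.measurable.aemeasurable (by rw [hT.map_eq]; exact hu)
    rw [← this, hT.map_eq]
  have b1 := comp (fun x => (μ[f | m]) x * f x) (hg.1.mul hf.1)
  have b2 := comp (fun x => (μ[f | m]) x * (μ[f | m]) x) (hg.1.mul hg.1)
  simp only [hfT] at b1
  have key : 0 ≤ ∫ x, ((μ[f | m]) (T x) - (μ[f | m']) x) ^ 2 ∂μ :=
    integral_nonneg fun x => sq_nonneg _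
  have e : ∫ x, ((μ[f | m]) (T x) - (μ[f | m']) x) ^ 2 ∂μ
      = ∫ x, (μ[f | m]) (T x) * (μ[f | m]) (T x) ∂μ
        - 2 * ∫ x, (μ[f | m]) (T x) * (μ[f | m']) x ∂μ
        + ∫ x, (μ[f | m']) x * (μ[f | m']) x ∂μ := by
    have i1 : Integrable (fun x => (μ[f | m]) (T x) * (μ[f | m]) (T x)) μ :=
      hgT.integrable_mul hgT
    have i2 : Integrable (fun x => (μ[f | m]) (T x) * (μ[f | m']) x) μ := hgT.integrable_mul hg'
    have i3 : Integrable (fun x => (μ[f | m']) x * (μ[f | m']) x) μ := hg'.integrable_mul hg'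
    rw [← integral_const_mul, ← integral_sub i1 (i2.const_mul 2), ← integral_add]
    · congr 1; ext x; ring
    · exact i1.sub (i2.const_mul 2)
    · exact i3
  refine ae_eq_of_integral_mul_le hg hg' ?_
  have a5 : ∫ x, (μ[f | m]) x * (μ[f | m']) x ∂μ = ∫ x, (μ[f | m']) x * (μ[f | m]) x ∂μ := by
    congr 1; ext x; ring
  linarith

/-- Limiting form of `condExp_ae_eq_of_measurePreserving`. -/
theorem condExp_ae_eq_of_forall_measurePreserving {Ω : Type*} {m m' mΩ : MeasurableSpace Ω}
    {μ : Measure Ω} [IsProbabilityMeasure μ] (hm : m ≤ mΩ)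
    (hm' : m' ≤ m) (ℰ : Filtration ℕ mΩ) (M₀ : ℕ)
    (hT : ∀ M, M₀ ≤ M → ∃ T : Ω → Ω, MeasurePreserving T μ μ ∧ Measurable[m', m] T ∧
      ∀ f : Ω → ℝ, StronglyMeasurable[ℰ M] f → ∀ x, f (T x) = f x)
    {f : Ω → ℝ} (hf : MemLp f 2 μ) (hfm : StronglyMeasurable[⨆ M, ℰ M] f) :
    μ[f | m] =ᵐ[μ] μ[f | m'] := by
  have hfi : Integrable f μ := hf.integrable (by norm_num)
  have lim := hfi.tendsto_eLpNorm_condExp hfm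
  have step : ∀ M, M₀ ≤ M → μ[μ[f | ℰ M] | m] =ᵐ[μ] μ[μ[f | ℰ M] | m'] := by
    intro M hM
    obtain ⟨T, h1, h2, h3⟩ := hT M hM
    exact condExp_ae_eq_of_measurePreserving hm hm' h1 h2 (hf.condExp (by norm_num))
      (h3 _ stronglyMeasurable_condExp)
  have bound : ∀ M, M₀ ≤ M → eLpNorm (μ[f | m] - μ[f | m']) 1 μ
      ≤ eLpNorm (μ[f | ℰ M] - f) 1 μ + eLpNorm (μ[f | ℰ M] - f) 1 μ := by
    intro M hM
    have c1 := condExp_sub (μ := μ) (integrable_condExp (f := f) (m := ℰ M)) hfi m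
    have c2 := condExp_sub (μ := μ) (integrable_condExp (f := f) (m := ℰ M)) hfi m'
    have e : μ[f | m] - μ[f | m'] =ᵐ[μ]
        μ[μ[f | ℰ M] - f | m'] - μ[μ[f | ℰ M] - f | m] := by
      filter_upwards [c1, c2, step M hM] with x h1 h2 h3
      simp only [Pi.sub_apply] at *
      rw [h1, h2, h3]; ring
    rw [eLpNorm_congr_ae e]
    refine (eLpNorm_sub_le integrable_condExp.1 integrable_condExp.1 le_rfl).trans ?_
    gcongr <;> exact eLpNorm_condExp_le_eLpNorm _ le_rfl
  have lim2 : Tendsto (fun M => eLpNorm (μ[f | ℰ M] - f) 1 μ + eLpNorm (μ[f | ℰ M] - f) 1 μ)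
      atTop (nhds 0) := by simpa using lim.add lim
  have h0 : eLpNorm (μ[f | m] - μ[f | m']) 1 μ ≤ 0 :=
    ge_of_tendsto lim2 (eventually_atTop.2 ⟨M₀, bound⟩)
  have := (eLpNorm_eq_zero_iff (integrable_condExp.1.sub integrable_condExp.1) one_ne_zero).1
    (le_antisymm h0 zero_le)
  filter_upwards [this] with x hx
  simpa [sub_eq_zero] using hx

/-- The σ-algebra on `ι → Bool` generated by the coordinates in `K`. -/
@[reducible] def bitSigma {ι : Type*} (K : Set ι) : MeasurableSpace (ι → Bool) :=
  MeasurableSpace.comap K.domRestrict inferInstance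

theorem measurable_bitSigma_iff {ι Ω : Type*} {m : MeasurableSpace Ω} {K : Set ι}
    {T : Ω → ι → Bool} :
    Measurable[m, bitSigma K] T ↔ ∀ k ∈ K, Measurable[m] fun x => T x k := by
  unfold bitSigma
  rw [measurable_comap_iff, measurable_pi_iff]
  exact ⟨fun h k hk => h ⟨k, hk⟩, fun h k => h k k.2⟩

theorem bitSigma_le_iff {ι : Type*} {K : Set ι} {m : MeasurableSpace (ι → Bool)} :
    bitSigma K ≤ m ↔ ∀ k ∈ K, Measurable[m] fun ω : ι → Bool => ω k := by
  rw [← measurable_bitSigma_iff (T := fun ω => ω), measurable_iff_comap_le]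
  exact (MeasurableSpace.comap_id (m := bitSigma K)).symm ▸ Iff.rfl

theorem measurable_bitSigma_eval {ι : Type*} {K : Set ι} {k : ι} (hk : k ∈ K) :
    Measurable[bitSigma K] fun ω : ι → Bool => ω k :=
  bitSigma_le_iff.1 le_rfl k hk

theorem bitSigma_mono {ι : Type*} {K L : Set ι} (h : K ⊆ L) : bitSigma K ≤ bitSigma L :=
  bitSigma_le_iff.2 fun _ hk => measurable_bitSigma_eval (h hk)

theorem bitSigma_le {ι : Type*} (K : Set ι) : bitSigma K ≤ MeasurableSpace.pi :=
  bitSigma_le_iff.2 fun k _ => measurable_pi_apply k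

theorem eq_of_measurable_bitSigma {ι : Type*} {K : Set ι} {f : (ι → Bool) → ℝ}
    (hf : Measurable[bitSigma K] f) {ω ω' : ι → Bool} (h : ∀ k ∈ K, ω k = ω' k) :
    f ω = f ω' := by
  obtain ⟨B, -, hB⟩ := hf (measurableSet_singleton (f ω'))
  have h1 : ω' ∈ K.domRestrict ⁻¹' B := by rw [hB]; rfl
  have h2 : K.domRestrict ω = K.domRestrict ω' := funext fun k => h k k.2
  have h3 : ω ∈ K.domRestrict ⁻¹' B := by rw [Set.mem_preimage, h2]; exact h1
  rw [hB] at h3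
  exact h3

/-- The coordinates at which an index vanishes. -/
def zeroSet {J : Type*} [Fintype J] (i : J → ℕ) : Finset J := univ.filter fun j => i j = 0

theorem mem_zeroSet {J : Type*} [Fintype J] {i : J → ℕ} {j : J} : j ∈ zeroSet i ↔ i j = 0 := by
  simp [zeroSet]

/-- Move the coordinates outside `e` away from `0`, fixing all values between `1` and `M`. -/
def shiftOff {J : Type*} [DecidableEq J] (e : Finset J) (M : ℕ) (i : J → ℕ) : J → ℕ :=
  fun j => if j ∈ e then i j else if i j = 0 then M + 1 else if i j ≤ M then i j else i j + 1

theorem zeroSet_shiftOff {J : Type*} [Fintype J] [DecidableEq J] (e : Finset J) (M : ℕ)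
    (i : J → ℕ) : zeroSet (shiftOff e M i) = zeroSet i ∩ e := by
  ext j
  simp only [mem_zeroSet, shiftOff, Finset.mem_inter]
  split_ifs <;> simp_all

theorem shiftOff_eq_self {J : Type*} [Fintype J] [DecidableEq J] {e : Finset J} {M : ℕ}
    {i : J → ℕ} (h : zeroSet i ⊆ e) (hM : ∀ j, i j ≤ M) : shiftOff e M i = i := by
  ext j
  have : i j = 0 → j ∈ e := fun hj => h (mem_zeroSet.2 hj)
  have := hM j
  simp only [shiftOff]
  split_ifs <;> simp_all

/-- The action of `shiftOff` on the space of configurations. -/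
def shiftMap {A J : Type*} [DecidableEq J] (e : Finset J) (M : ℕ)
    (ω : A × (J → ℕ) → Bool) : A × (J → ℕ) → Bool :=
  fun k => ω (k.1, shiftOff e M k.2)

theorem condExp_bitSigma_ae_eq {A J : Type*} [Fintype J] [DecidableEq J]
    {μ : Measure (A × (J → ℕ) → Bool)} [IsProbabilityMeasure μ]
    (hμ : ∀ e M, MeasurePreserving (shiftMap (A := A) (J := J) e M) μ μ)
    (e : Finset J) {K K' : Set (A × (J → ℕ))} (hK : K' ⊆ K) (M₀ : ℕ)
    (hs : ∀ M, M₀ ≤ M → ∀ k ∈ K, (k.1, shiftOff e M k.2) ∈ K')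
    {f : (A × (J → ℕ) → Bool) → ℝ} (hf : MemLp f 2 μ)
    (hfm : StronglyMeasurable[bitSigma {k | zeroSet k.2 ⊆ e}] f) :
    μ[f | bitSigma K] =ᵐ[μ] μ[f | bitSigma K'] := by
  let ℰ : Filtration ℕ (MeasurableSpace.pi : MeasurableSpace (A × (J → ℕ) → Bool)) :=
    { seq := fun M => bitSigma {k | zeroSet k.2 ⊆ e ∧ ∀ j, k.2 j ≤ M}
      mono' := fun a b hab => bitSigma_mono fun k hk => ⟨hk.1, fun j => (hk.2 j).trans hab⟩
      le' := fun M => bitSigma_le _ }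
  refine condExp_ae_eq_of_forall_measurePreserving (bitSigma_le K) (bitSigma_mono hK) ℰ M₀ ?_ hf
    (hfm.mono ?_)
  · intro M hM
    refine ⟨shiftMap e M, hμ e M, measurable_bitSigma_iff.2 fun k hk =>
      measurable_bitSigma_eval (hs M hM k hk), fun f hf ω => ?_⟩
    refine eq_of_measurable_bitSigma hf.measurable fun k hk => ?_
    simp only [shiftMap]
    rw [shiftOff_eq_self hk.1 hk.2]
  · refine bitSigma_le_iff.2 fun k hk => ?_
    have : Measurable[ℰ (∑ j, k.2 j)] fun ω : A × (J → ℕ) → Bool => ω k :=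
      measurable_bitSigma_eval ⟨hk, fun j => single_le_sum (f := k.2) (fun _ _ => Nat.zero_le _)
        (mem_univ j)⟩
    exact this.mono (le_iSup (fun M => ℰ M) _) le_rfl

theorem setIntegral_condExp_indicator {Ω : Type*} {m mΩ : MeasurableSpace Ω} {μ : Measure Ω}
    [IsProbabilityMeasure μ] (hm : m ≤ mΩ) {Z D : Set Ω} (hZ : MeasurableSet[m] Z)
    (hD : MeasurableSet D) :
    ∫ x in Z, (μ[D.indicator (fun _ => (1 : ℝ)) | m]) x ∂μ = μ.real (Z ∩ D) := by
  rw [setIntegral_condExp hm ((integrable_const _).indicator hD) hZ, setIntegral_indicator hD]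
  simp

/-- Absolute continuity on the σ-algebras indexed by the members of `F` propagates to sets that
are intersections of sets measurable in these σ-algebras. -/
theorem measure_iInter_ne_zero_of_forall_absolutelyContinuous {A J : Type*} [Finite A] [Fintype J]
    [DecidableEq J] {μ ν : Measure (A × (J → ℕ) → Bool)} [IsProbabilityMeasure μ]
    (hμ : ∀ e M, MeasurePreserving (shiftMap (A := A) (J := J) e M) μ μ)
    (F : Finset (Finset J))
    (hν : ∀ e ∈ F, ∀ D, MeasurableSet[bitSigma {k | zeroSet k.2 ⊆ e}] D → μ D = 0 → ν D = 0)
    (n : ℕ) : ∀ W : Finset (Finset J), W.card = n → IsLowerSet (W : Set (Finset J)) →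
      ∀ X : Finset J → Set (A × (J → ℕ) → Bool),
      (∀ e ∈ F, MeasurableSet[bitSigma {k | zeroSet k.2 ∈ W ∧ zeroSet k.2 ⊆ e}] (X e)) →
      ν (⋂ e ∈ F, X e) ≠ 0 → μ (⋂ e ∈ F, X e) ≠ 0 := by
  induction n with
  | zero =>
    intro W hW _ X hX hνX
    obtain rfl := Finset.card_eq_zero.1 hW
    have h1 : ∀ e ∈ F, X e = Set.univ := by
      intro e he
      obtain ⟨B, -, hB⟩ := hX e he
      obtain ⟨ω, hω⟩ := nonempty_of_measure_ne_zero hνX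
      have hω' : ω ∈ X e := by simp only [Set.mem_iInter] at hω; exact hω e he
      refine Set.eq_univ_of_forall fun ω' => ?_
      rw [← hB] at hω' ⊢
      have heq : Set.domRestrict {k : A × (J → ℕ) | zeroSet k.2 ∈ (∅ : Finset (Finset J)) ∧
          zeroSet k.2 ⊆ e} ω' = Set.domRestrict _ ω := by
        funext k
        exact absurd k.2.1 (Finset.notMem_empty _)
      rw [Set.mem_preimage, heq]
      exact hω'
    have h2 : (⋂ e ∈ F, X e) = Set.univ := by
      simp only [Set.iInter_eq_univ]; exact h1
    rw [h2, measure_univ]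
    exact one_ne_zero
  | succ n ih =>
    intro W hW hWl X hX hνX
    obtain ⟨g, hg⟩ := W.exists_maximal (Finset.card_pos.1 (by omega))
    have hgW : g ∈ W := hg.1
    have hlow : ∀ {a b : Finset J}, a ∈ W → b ⊆ a → b ∈ W := fun ha hb => hWl hb ha
    have hlow' : ∀ {a b : Finset J}, a ∈ W.erase g → b ⊆ a → b ∈ W.erase g := by
      intro a b ha hb
      rw [Finset.mem_erase] at ha ⊢
      refine ⟨?_, hlow ha.2 hb⟩
      rintro rfl
      exact ha.1 (le_antisymm (hg.2 ha.2 hb) hb)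
    have hcard : (W.erase g).card = n := by rw [Finset.card_erase_of_mem hgW]; omega
    have hWl' : IsLowerSet ((W.erase g : Finset (Finset J)) : Set (Finset J)) :=
      fun a b hb ha => hlow' ha hb
    have IH := ih (W.erase g) hcard hWl'
    by_cases hgF : ∃ e ∈ F, g ⊆ e
    swap
    · refine IH X (fun e he => bitSigma_mono ?_ _ (hX e he)) hνX
      rintro k ⟨h1, h2⟩
      refine ⟨Finset.mem_erase.2 ⟨?_, h1⟩, h2⟩
      rintro h
      exact hgF ⟨e, he, h ▸ h2⟩
    obtain ⟨e₀, he₀, hge₀⟩ := hgF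
    set P : Finset J → ℕ → Set (A × (J → ℕ)) := fun e m =>
      {k | (zeroSet k.2 ∈ W.erase g ∨ (zeroSet k.2 = g ∧ ∀ j, k.2 j ≤ m)) ∧ zeroSet k.2 ⊆ e}
      with hP
    have hPe : ∀ e m, P e m ⊆ {k | zeroSet k.2 ⊆ e} := fun e m k hk => hk.2
    have hPuniv : ∀ e m, P e m ⊆ P univ m := fun e m k hk => ⟨hk.1, Finset.subset_univ _⟩
    have hXe : ∀ e ∈ F, MeasurableSet[bitSigma {k | zeroSet k.2 ⊆ e}] (X e) := fun e he =>
      bitSigma_mono (fun k hk => hk.2) _ (hX e he)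
    have hXm : ∀ e ∈ F, MeasurableSet (X e) := fun e he => bitSigma_le _ _ (hXe e he)
    set t : ℝ := 1 - 1 / (2 * F.card) with ht
    have hFc : 0 < (F.card : ℝ) := by exact_mod_cast Finset.card_pos.2 ⟨e₀, he₀⟩
    have ht1 : t < 1 := by
      have : 0 < 1 / (2 * (F.card : ℝ)) := by positivity
      linarith
    set I : Finset J → (A × (J → ℕ) → Bool) → ℝ := fun e => (X e).indicator fun _ => (1 : ℝ)
      with hI
    have hI2 : ∀ e ∈ F, MemLp (I e) 2 μ := fun e he =>
      memLp_indicator_const 2 (hXm e he) 1 (Or.inr (measure_ne_top _ _))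
    set φ : Finset J → ℕ → (A × (J → ℕ) → Bool) → ℝ := fun e m => μ[I e | bitSigma (P e m)]
      with hφ
    have hφm : ∀ e m, Measurable[bitSigma (P e m)] (φ e m) := fun e m =>
      (stronglyMeasurable_condExp).measurable
    set C : Finset J → ℕ → Set (A × (J → ℕ) → Bool) := fun e m => {ω | t < φ e m ω} with hC
    have hCm : ∀ e m, MeasurableSet[bitSigma (P e m)] (C e m) := fun e m =>
      hφm e m measurableSet_Ioi
    -- martingale convergence
    set N : Finset J → Set (A × (J → ℕ) → Bool) := fun e =>
      X e ∩ ⋂ m₀ : ℕ, ⋃ m : ℕ, ⋃ _ : m₀ ≤ m, (C e m)ᶜ with hN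
    have hN0 : ∀ e ∈ F, ν (N e) = 0 := by
      intro e he
      refine hν e he _ ?_ ?_
      · refine @MeasurableSet.inter _ (bitSigma _) _ _ (hXe e he) ?_
        refine @MeasurableSet.iInter _ _ (bitSigma _) _ _ fun m₀ => ?_
        refine @MeasurableSet.iUnion _ _ (bitSigma _) _ _ fun m => ?_
        refine @MeasurableSet.iUnion _ _ (bitSigma _) _ _ fun _ => ?_
        exact @MeasurableSet.compl _ _ (bitSigma _) (bitSigma_mono (hPe e m) _ (hCm e m))
      · let ℱ : Filtration ℕ (MeasurableSpace.pi : MeasurableSpace (A × (J → ℕ) → Bool)) :=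
          { seq := fun m => bitSigma (P e m)
            mono' := fun a b hab => bitSigma_mono fun k hk =>
              ⟨hk.1.imp id fun h => ⟨h.1, fun j => (h.2 j).trans hab⟩, hk.2⟩
            le' := fun M => bitSigma_le _ }
        have hle : bitSigma {k : A × (J → ℕ) | zeroSet k.2 ∈ W ∧ zeroSet k.2 ⊆ e} ≤ ⨆ m, ℱ m := by
          refine bitSigma_le_iff.2 fun k hk => ?_
          have : Measurable[ℱ (∑ j, k.2 j)] fun ω : A × (J → ℕ) → Bool => ω k := by
            refine measurable_bitSigma_eval ⟨?_, hk.2⟩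
            by_cases hkg : zeroSet k.2 = g
            · exact Or.inr ⟨hkg, fun j =>
                single_le_sum (f := k.2) (fun _ _ => Nat.zero_le _) (Finset.mem_univ j)⟩
            · exact Or.inl (Finset.mem_erase.2 ⟨hkg, hk.1⟩)
          exact this.mono (le_iSup (fun M => ℱ M) _) le_rfl
        have hsm : StronglyMeasurable[⨆ m, ℱ m] (I e) :=
          (@stronglyMeasurable_const _ _ (⨆ m, ℱ m) _ (1 : ℝ)).indicator (hle _ (hX e he))
        have lim := ((hI2 e he).integrable (by norm_num)).tendsto_ae_condExp hsm
        rw [measure_eq_zero_iff_ae_notMem]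
        filter_upwards [lim] with ω hω hωN
        have h1 : I e ω = 1 := Set.indicator_of_mem hωN.1 _
        rw [h1] at hω
        obtain ⟨m₀, hm₀⟩ := eventually_atTop.1 (hω.eventually (lt_mem_nhds ht1))
        have := hωN.2
        simp only [Set.mem_iInter, Set.mem_iUnion] at this
        obtain ⟨m, hm, hmC⟩ := this m₀
        exact hmC (hm₀ m hm)
    obtain ⟨m, hm⟩ : ∃ m, ν (⋂ e ∈ F, C e m) ≠ 0 := by
      by_contra! hcon
      apply hνX
      have h1 : ν ((⋃ e ∈ F, N e) ∪ ⋃ m, ⋂ e ∈ F, C e m) = 0 :=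
        measure_union_null ((measure_biUnion_null_iff F.countable_toSet).2 hN0)
          (measure_iUnion_null hcon)
      refine measure_mono_null (fun ω hω => ?_) h1
      by_contra hno
      simp only [Set.mem_union, Set.mem_iUnion, Set.mem_iInter, not_or, not_exists, not_forall]
        at hno hω
      have hev : ∀ e ∈ F, ∀ᶠ m in atTop, ω ∈ C e m := by
        intro e he
        have h2 := hno.1 e he
        by_contra hne
        refine h2 ⟨hω e he, ?_⟩
        simp only [Set.mem_iInter, Set.mem_iUnion]
        intro m₀
        by_contra hne'
        refine hne (eventually_atTop.2 ⟨m₀, fun m hm => ?_⟩)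
        by_contra hmC
        exact hne' ⟨m, hm, hmC⟩
      obtain ⟨m, hm⟩ := ((Filter.eventually_all_finset F).2 hev).exists
      obtain ⟨e, he, hne⟩ := hno.2 m
      exact hne (hm e he)
    -- reduction to the behaviour of `C`
    suffices hCμ : μ (⋂ e ∈ F, C e m) ≠ 0 by
      intro hX0
      set Z := ⋂ e ∈ F, C e m with hZ
      have hZm : MeasurableSet[bitSigma (P univ m)] Z :=
        @Finset.measurableSet_biInter _ _ (bitSigma _) _ F
          fun e _ => bitSigma_mono (hPuniv e m) _ (hCm e m)
      have hZ' : MeasurableSet Z := bitSigma_le _ _ hZm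
      have hone : ∀ e ∈ F, μ.real (Z \ X e) ≤ 1 / (2 * F.card) * μ.real Z := by
        intro e he
        have h1 := setIntegral_condExp_indicator (μ := μ) (bitSigma_le _) hZm (hXm e he)
        have h2 : μ[I e | bitSigma (P univ m)] =ᵐ[μ] φ e m := by
          refine condExp_bitSigma_ae_eq hμ e (hPuniv e m) m ?_ (hI2 e he)
            ((@stronglyMeasurable_const _ _ (bitSigma _) _ (1 : ℝ)).indicator (hXe e he))
          rintro M hM k ⟨hk, -⟩
          refine ⟨?_, by rw [zeroSet_shiftOff]; exact Finset.inter_subset_right⟩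
          rw [zeroSet_shiftOff]
          rcases hk with hk | ⟨hk, hkm⟩
          · exact Or.inl (hlow' hk Finset.inter_subset_left)
          · by_cases hge : g ⊆ e
            · right
              have : shiftOff e M k.2 = k.2 :=
                shiftOff_eq_self (hk ▸ hge) fun j => (hkm j).trans hM
              simp only [this]
              exact ⟨by rw [hk]; exact Finset.inter_eq_left.2 hge, hkm⟩
            · left
              rw [hk]
              refine Finset.mem_erase.2 ⟨fun h => hge (Finset.inter_eq_left.1 h),
                hlow hgW Finset.inter_subset_left⟩
        have h3 : ∫ x in Z, (μ[I e | bitSigma (P univ m)]) x ∂μ = ∫ x in Z, φ e m x ∂μ :=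
          integral_congr_ae (ae_restrict_of_ae h2)
        have h4 : t * μ.real Z ≤ ∫ x in Z, φ e m x ∂μ := by
          have : ∫ _ in Z, t ∂μ ≤ ∫ x in Z, φ e m x ∂μ := by
            refine setIntegral_mono_on (integrable_const _) integrable_condExp.integrableOn hZ' ?_
            intro ω hω
            simp only [hZ, Set.mem_iInter] at hω
            exact (hω e he).le
          simpa [mul_comm] using this
        have h5 := measureReal_inter_add_sdiff (μ := μ) (s := Z) (hXm e he)
        have h6 : (1 - 1 / (2 * (F.card : ℝ))) * μ.real Z ≤ μ.real (Z ∩ X e) := by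
          rw [← h1, h3]; exact h4
        linarith
      have hsub : Z ⊆ (⋂ e ∈ F, X e) ∪ ⋃ e ∈ F, Z \ X e := by
        intro ω hω
        by_cases h : ω ∈ ⋂ e ∈ F, X e
        · exact Or.inl h
        · right
          simp only [Set.mem_iInter, not_forall] at h
          obtain ⟨e, he, hne⟩ := h
          exact Set.mem_iUnion₂.2 ⟨e, he, hω, hne⟩
      have h7 : μ.real Z ≤ ∑ e ∈ F, 1 / (2 * F.card) * μ.real Z :=
        calc μ.real Z ≤ μ.real ((⋂ e ∈ F, X e) ∪ ⋃ e ∈ F, Z \ X e) := measureReal_mono hsub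
          _ ≤ μ.real (⋂ e ∈ F, X e) + μ.real (⋃ e ∈ F, Z \ X e) := measureReal_union_le _ _
          _ = μ.real (⋃ e ∈ F, Z \ X e) := by simp [measureReal_def, hX0]
          _ ≤ ∑ e ∈ F, μ.real (Z \ X e) := measureReal_biUnion_finset_le _ _
          _ ≤ _ := Finset.sum_le_sum hone
      rw [Finset.sum_const, nsmul_eq_mul] at h7
      have h8 : (F.card : ℝ) * (1 / (2 * F.card) * μ.real Z) = μ.real Z / 2 := by
        field_simp
      have h9 : 0 < μ.real Z :=
        ENNReal.toReal_pos hCμ (measure_ne_top _ _)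
      linarith
    -- fix the finitely many coordinates of type `g`
    set L : Set (A × (J → ℕ)) := {k | zeroSet k.2 = g ∧ ∀ j, k.2 j ≤ m} with hL
    have hLfin : L.Finite := by
      refine (Set.finite_univ.prod (Set.finite_Iic fun _ : J => m)).subset fun k hk => ?_
      exact ⟨Set.mem_univ _, hk.2⟩
    have : Finite L := hLfin
    set R : (L → Bool) → Set (A × (J → ℕ) → Bool) := fun b => {ω | ∀ k : L, ω k = b k} with hR
    obtain ⟨b, hb⟩ : ∃ b, ν ((⋂ e ∈ F, C e m) ∩ R b) ≠ 0 := by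
      by_contra! hcon
      refine hm (measure_mono_null (fun ω hω => ?_) (measure_iUnion_null hcon))
      exact Set.mem_iUnion.2 ⟨fun k => ω k, hω, fun k => rfl⟩
    have hRg : MeasurableSet[bitSigma {k : A × (J → ℕ) | zeroSet k.2 ⊆ g}] (R b) := by
      have : R b = ⋂ k : L, (fun ω : A × (J → ℕ) → Bool => ω k) ⁻¹' {b k} := by
        ext ω; simp [hR]
      rw [this]
      refine @MeasurableSet.iInter _ _ (bitSigma _) _ _ fun k => ?_
      have hk : (k : A × (J → ℕ)) ∈ {k : A × (J → ℕ) | zeroSet k.2 ⊆ g} := k.2.1.subset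
      exact measurable_bitSigma_eval hk (measurableSet_singleton _)
    have hRm : MeasurableSet (R b) := bitSigma_le _ _ hRg
    classical
    set s : (A × (J → ℕ) → Bool) → (A × (J → ℕ) → Bool) := fun ω k =>
      if h : k ∈ L then b ⟨k, h⟩ else ω k with hs
    have hsR : ∀ ω ∈ R b, s ω = ω := by
      intro ω hω
      ext k
      simp only [hs]
      split_ifs with h
      · exact (hω ⟨k, h⟩).symm
      · rfl
    set Y : Finset J → Set (A × (J → ℕ) → Bool) := fun e => s ⁻¹' (C e m) with hY
    have hYm : ∀ e, MeasurableSet[bitSigma {k | zeroSet k.2 ∈ W.erase g ∧ zeroSet k.2 ⊆ e}]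
        (Y e) := by
      intro e
      suffices hsm : Measurable[bitSigma {k | zeroSet k.2 ∈ W.erase g ∧ zeroSet k.2 ⊆ e},
          bitSigma (P e m)] s from hsm (hCm e m)
      refine measurable_bitSigma_iff.2 fun k hk => ?_
      by_cases h : k ∈ L
      · simp only [hs, h, dite_true]
        exact measurable_const
      · simp only [hs, h, dite_false]
        exact measurable_bitSigma_eval ⟨hk.1.resolve_right h, hk.2⟩
    set K : Set (A × (J → ℕ)) := {k | zeroSet k.2 ∈ W.erase g ∧ zeroSet k.2 ⊆ g} with hK
    set h := μ[(R b).indicator (fun _ => (1 : ℝ)) | bitSigma K] with hh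
    set H := {ω | 0 < h ω} with hH
    have hHm : MeasurableSet[bitSigma K] H :=
      (stronglyMeasurable_condExp (m := bitSigma K)).measurable measurableSet_Ioi
    have hKW : K ⊆ {k | zeroSet k.2 ∈ W.erase g} := fun k hk => hk.1
    have hRI : MemLp ((R b).indicator fun _ => (1 : ℝ)) 2 μ :=
      memLp_indicator_const 2 hRm 1 (Or.inr (measure_ne_top _ _))
    have hRH : μ (R b \ H) = 0 := by
      have h1 := setIntegral_condExp_indicator (μ := μ) (bitSigma_le K)
        (@MeasurableSet.compl _ _ (bitSigma K) hHm) hRm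
      have h2 : ∫ x in Hᶜ, h x ∂μ ≤ 0 := by
        refine setIntegral_nonpos (bitSigma_le _ _ hHm).compl fun ω hω => ?_
        exact not_lt.1 hω
      rw [h1] at h2
      have h3 : μ.real (Hᶜ ∩ R b) = 0 := le_antisymm h2 measureReal_nonneg
      rw [measureReal_eq_zero_iff] at h3
      rwa [Set.sdiff_eq, Set.inter_comm]
    have hνRH : ν (R b \ H) = 0 := by
      refine hν e₀ he₀ _ ?_ hRH
      refine @MeasurableSet.diff _ (bitSigma _) _ _ (bitSigma_mono ?_ _ hRg)
        (bitSigma_mono ?_ _ hHm)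
      · exact fun k hk => Finset.Subset.trans hk hge₀
      · exact fun k hk => Finset.Subset.trans hk.2 hge₀
    set Y' : Finset J → Set (A × (J → ℕ) → Bool) := fun e =>
      Y e ∩ if g ⊆ e then H else Set.univ with hY'
    have hY'm : ∀ e ∈ F, MeasurableSet[bitSigma {k | zeroSet k.2 ∈ W.erase g ∧ zeroSet k.2 ⊆ e}]
        (Y' e) := by
      intro e _
      refine @MeasurableSet.inter _ (bitSigma _) _ _ (hYm e) ?_
      split_ifs with hge
      · have hsub : {k : A × (J → ℕ) | zeroSet k.2 ∈ W.erase g ∧ zeroSet k.2 ⊆ g} ⊆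
            {k | zeroSet k.2 ∈ W.erase g ∧ zeroSet k.2 ⊆ e} :=
          fun k hk => ⟨hk.1, Finset.Subset.trans hk.2 hge⟩
        exact bitSigma_mono hsub _ hHm
      · exact @MeasurableSet.univ _ (bitSigma _)
    have hY'H : (⋂ e ∈ F, Y' e) ⊆ H := by
      intro ω hω
      simp only [Set.mem_iInter] at hω
      have := (hω e₀ he₀).2
      rwa [if_pos hge₀] at this
    have hνY : ν (⋂ e ∈ F, Y' e) ≠ 0 := by
      intro h0
      have h1 := measure_union_null h0 hνRH
      refine hb (measure_mono_null (fun ω hω => ?_) h1)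
      by_cases hωH : ω ∈ H
      · left
        have h1 := hω.1
        simp only [Set.mem_iInter] at h1 ⊢
        refine fun e he => Set.mem_inter ?_ ?_
        · change s ω ∈ C e m
          rw [hsR ω hω.2]
          exact h1 e he
        · split_ifs
          · exact hωH
          · trivial
      · exact Or.inr ⟨hω.2, hωH⟩
    have hμY := IH Y' hY'm hνY
    set V := ⋂ e ∈ F, Y' e with hV
    have hVm : MeasurableSet[bitSigma {k : A × (J → ℕ) | zeroSet k.2 ∈ W.erase g}] V :=
      @Finset.measurableSet_biInter _ _ (bitSigma _) _ F
        fun e he => bitSigma_mono (fun k hk => hk.1) _ (hY'm e he)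
    have hae : μ[(R b).indicator (fun _ => (1 : ℝ)) |
        bitSigma {k : A × (J → ℕ) | zeroSet k.2 ∈ W.erase g}] =ᵐ[μ] h := by
      refine condExp_bitSigma_ae_eq hμ g hKW 0 ?_ hRI
        ((@stronglyMeasurable_const _ _ (bitSigma _) _ (1 : ℝ)).indicator hRg)
      intro M _ k hk
      simp only [hK, Set.mem_ofPred_eq, zeroSet_shiftOff]
      exact ⟨hlow' hk Finset.inter_subset_left, Finset.inter_subset_right⟩
    have hVR : μ.real (V ∩ R b) = ∫ x in V, h x ∂μ := by
      rw [← setIntegral_condExp_indicator (μ := μ) (bitSigma_le _) hVm hRm]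
      exact integral_congr_ae (ae_restrict_of_ae hae)
    have hpos : 0 < ∫ x in V, h x ∂μ := by
      rw [setIntegral_pos_iff_support_of_nonneg_ae]
      · refine lt_of_lt_of_le (pos_iff_ne_zero.2 hμY) (measure_mono fun ω hω => ⟨?_, hω⟩)
        exact ne_of_gt (hY'H hω)
      · refine (ae_restrict_iff' (bitSigma_le _ _ hVm)).2 (Eventually.of_forall fun ω hω => ?_)
        exact le_of_lt (hY'H hω)
      · exact integrable_condExp.integrableOn
    intro h0
    rw [← hVR] at hpos
    have : μ (V ∩ R b) = 0 := by
      refine measure_mono_null (fun ω hω => ?_) h0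
      have h1 := hω.1
      simp only [hV, Set.mem_iInter] at h1 ⊢
      intro e he
      have h2 : s ω ∈ C e m := (h1 e he).1
      rwa [hsR ω hω.2] at h2
    rw [measureReal_def, this] at hpos
    simp at hpos

/-- Domination of measures passes to weak limits, as far as null sets are concerned. -/
theorem measure_eq_zero_of_tendsto {E τ : Type*} [TopologicalSpace E]
    [TopologicalSpace.PseudoMetrizableSpace E] [MeasurableSpace E] [BorelSpace E] {l : Filter τ}
    [l.NeBot] {μ ν : τ → ProbabilityMeasure E} {μ' ν' : ProbabilityMeasure E}
    (hμ : Tendsto μ l (𝓝 μ')) (hν : Tendsto ν l (𝓝 ν')) {C : ENNReal} (hC : C ≠ ⊤)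
    (h : ∀ t, ∀ D, MeasurableSet D → (ν t : Measure E) D ≤ C * (μ t : Measure E) D)
    {D : Set E} (hD : MeasurableSet D) (h0 : (μ' : Measure E) D = 0) :
    (ν' : Measure E) D = 0 := by
  rw [hD.measure_eq_iSup_isClosed_of_ne_top (measure_ne_top _ _)]
  simp only [ENNReal.iSup_eq_zero]
  intro K hKD hK
  have hK0 : (μ' : Measure E) K = 0 := measure_mono_null hKD h0
  refine le_antisymm (ENNReal.le_of_forall_pos_le_add fun ε hε _ => ?_) bot_le
  have hpos : 0 < (ε : ENNReal) / C :=
    ENNReal.div_pos (ENNReal.coe_pos.2 hε).ne' hC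
  obtain ⟨U, hKU, hU, hUε⟩ := K.exists_isOpen_lt_of_lt _ (hK0.trans_lt hpos)
  let := TopologicalSpace.pseudoMetrizableSpacePseudoMetric E
  obtain ⟨G, hG, hKG, hGU⟩ := normal_exists_closure_subset hK hU hKU
  calc (ν' : Measure E) K ≤ (ν' : Measure E) G := measure_mono hKG
    _ ≤ liminf (fun t => (ν t : Measure E) G) l :=
        ProbabilityMeasure.le_liminf_measure_open_of_tendsto hν hG
    _ ≤ liminf (fun t => C * (μ t : Measure E) (closure G)) l :=
        liminf_le_liminf (Eventually.of_forall fun t => (h t _ hG.measurableSet).trans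
          (by gcongr; exact subset_closure))
    _ ≤ limsup (fun t => C * (μ t : Measure E) (closure G)) l := liminf_le_limsup
    _ = C * limsup (fun t => (μ t : Measure E) (closure G)) l :=
        ENNReal.limsup_const_mul_of_ne_top hC
    _ ≤ C * (μ' : Measure E) (closure G) := by
        gcongr
        exact ProbabilityMeasure.limsup_measure_closed_le_of_tendsto hμ isClosed_closure
    _ ≤ C * ((ε : ENNReal) / C) := by gcongr; exact (measure_mono hGU).trans hUε.le
    _ ≤ 0 + ε := by rw [zero_add]; exact ENNReal.mul_div_le

/-- A version of `measure_eq_zero_of_tendsto` for sets depending on the coordinates in `K`. -/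
theorem measure_eq_zero_of_tendsto_bitSigma {ι τ : Type*} [Countable ι] {l : Filter τ} [l.NeBot]
    {μ ν : τ → ProbabilityMeasure (ι → Bool)} {μ' ν' : ProbabilityMeasure (ι → Bool)}
    (hμ : Tendsto μ l (𝓝 μ')) (hν : Tendsto ν l (𝓝 ν')) {C : ENNReal} (hC : C ≠ ⊤) (K : Set ι)
    (h : ∀ t, ∀ D, MeasurableSet[bitSigma K] D →
      (ν t : Measure (ι → Bool)) D ≤ C * (μ t : Measure (ι → Bool)) D)
    {D : Set (ι → Bool)} (hD : MeasurableSet[bitSigma K] D)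
    (h0 : (μ' : Measure (ι → Bool)) D = 0) : (ν' : Measure (ι → Bool)) D = 0 := by
  obtain ⟨B, hB, rfl⟩ := hD
  have hc : Continuous (K.domRestrict : (ι → Bool) → (K → Bool)) :=
    continuous_pi fun k => continuous_apply k.1
  have key : ∀ (ρ : ProbabilityMeasure (ι → Bool)) (B : Set (K → Bool)), MeasurableSet B →
      ((ρ.map hc.measurable.aemeasurable : ProbabilityMeasure (K → Bool)) : Measure _) B =
        (ρ : Measure (ι → Bool)) (K.domRestrict ⁻¹' B) := fun ρ B hB => by
    rw [ProbabilityMeasure.toMeasure_map, Measure.map_apply hc.measurable hB]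
  rw [← key _ _ hB] at h0 ⊢
  refine measure_eq_zero_of_tendsto
    (ProbabilityMeasure.tendsto_map_of_tendsto_of_continuous _ _ hμ hc)
    (ProbabilityMeasure.tendsto_map_of_tendsto_of_continuous _ _ hν hc) hC (fun t B hB => ?_) hB h0
  rw [key _ _ hB, key _ _ hB]
  exact h t _ ⟨B, hB, rfl⟩

/-- Invariance under a continuous map passes to weak limits. -/
theorem measurePreserving_of_tendsto {E τ : Type*} [TopologicalSpace E]
    [TopologicalSpace.PseudoMetrizableSpace E] [MeasurableSpace E] [BorelSpace E] {l : Filter τ}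
    [l.NeBot] {μ : τ → ProbabilityMeasure E} {μ' : ProbabilityMeasure E}
    (hμ : Tendsto μ l (𝓝 μ')) {T : E → E} (hT : Continuous T)
    (h : ∀ t, MeasurePreserving T (μ t) (μ t)) : MeasurePreserving T (μ' : Measure E) μ' := by
  refine ⟨hT.measurable, ?_⟩
  have h1 := ProbabilityMeasure.tendsto_map_of_tendsto_of_continuous _ _ hμ hT
  have h2 : (fun t => (μ t).map hT.measurable.aemeasurable) = μ := by
    funext t
    exact Subtype.ext (h t).map_eq
  rw [h2] at h1
  have h3 : μ'.map hT.measurable.aemeasurable = μ' := tendsto_nhds_unique h1 hμ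
  rw [← ProbabilityMeasure.toMeasure_map _ hT.measurable.aemeasurable, h3]

/-- The pattern of which restrictions of an infinite family of points lie in projections of `S`. -/
def encode {J β : Type*} [DecidableEq β] (S : Finset (J → β)) (x : J × ℕ → β) :
    Finset J × (J → ℕ) → Bool :=
  fun k => decide (∃ φ ∈ S, ∀ j ∈ k.1, φ j = x (j, k.2 j))

theorem measurable_encode {J β : Type*} [Finite J] [Fintype β] [DecidableEq β] [MeasurableSpace β]
    [MeasurableSingletonClass β] (S : Finset (J → β)) (k : Finset J × (J → ℕ)) (K : Set (J × ℕ))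
    (hK : ∀ j ∈ k.1, (j, k.2 j) ∈ K) :
    Measurable[⨆ a ∈ K, MeasurableSpace.comap (fun x : J × ℕ → β => x a) inferInstance]
      fun x => encode S x k := by
  classical
  cases nonempty_fintype J
  have h1 : Measurable[⨆ a ∈ K, MeasurableSpace.comap (fun x : J × ℕ → β => x a) inferInstance]
      fun (x : J × ℕ → β) (j : k.1) => x (j, k.2 j) := by
    refine @measurable_pi_lambda _ _ _ (_) _ _ fun j => ?_
    exact (comap_measurable _).mono (le_iSup₂_of_le _ (hK j j.2) le_rfl) le_rfl
  have h2 : Measurable fun (y : k.1 → β) => decide (∃ φ ∈ S, ∀ j : k.1, φ j = y j) :=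
    Measurable.of_discrete
  convert! h2.comp h1 using 1
  funext x
  simp [encode]

theorem measurePreserving_shiftMap_map_encode {J β : Type*} [Fintype J] [DecidableEq J] [Fintype β]
    [DecidableEq β] [MeasurableSpace β] [MeasurableSingletonClass β] (S : Finset (J → β))
    (Q : Measure β) [IsProbabilityMeasure Q] (e : Finset J) (M : ℕ) :
    MeasurePreserving (shiftMap e M) ((Measure.infinitePi fun _ : J × ℕ => Q).map (encode S))
      ((Measure.infinitePi fun _ : J × ℕ => Q).map (encode S)) := by
  have hmeas : Measurable (encode S) := measurable_pi_lambda _ fun k =>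
    (measurable_encode S k Set.univ fun _ _ => trivial).mono
      (iSup₂_le fun a _ => (measurable_pi_apply a).comap_le) le_rfl
  have hshift : Measurable (shiftMap (A := Finset J) e M) :=
    measurable_pi_lambda _ fun k => measurable_pi_apply _
  let σ : J × ℕ → J × ℕ := fun k => (k.1, shiftOff e M (fun _ => k.2) k.1)
  have hσ : Function.Injective σ := by
    rintro ⟨j, a⟩ ⟨j', a'⟩ h
    simp only [σ, Prod.mk.injEq, shiftOff] at h
    obtain ⟨rfl, h⟩ := h
    refine Prod.ext rfl ?_
    simp only
    split_ifs at h <;> omega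
  have hσm : Measurable fun (x : J × ℕ → β) k => x (σ k) :=
    measurable_pi_lambda _ fun k => measurable_pi_apply _
  refine ⟨hshift, ?_⟩
  have hcomm : shiftMap e M ∘ encode S = encode S ∘ fun (x : J × ℕ → β) k => x (σ k) := by
    funext x k
    rfl
  rw [Measure.map_map hshift hmeas, hcomm, ← Measure.map_map hmeas hσm,
    Measure.map_infinitePi_infinitePi_of_inj (P := fun _ => Q) hσ]

theorem measure_inter_le {J β : Type*} [Fintype J] [DecidableEq J] [Fintype β]
    [DecidableEq β] [MeasurableSpace β] [MeasurableSingletonClass β] (S : Finset (J → β))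
    (Q : Measure β) [IsProbabilityMeasure Q] {q : ENNReal} (hQ : ∀ b, Q {b} = q) (e : Finset J)
    {m : ℕ} (hm : ∀ s : J → β, #{φ ∈ S | ∀ j ∈ e, φ j = s j} ≤ m) {A : Set (J × ℕ → β)}
    (hA : MeasurableSet[⨆ a ∈ {a : J × ℕ | a.2 = 0 → a.1 ∈ e},
      MeasurableSpace.comap (fun x : J × ℕ → β => x a) inferInstance] A) :
    Measure.infinitePi (fun _ : J × ℕ => Q) (A ∩ {x | (fun j => x (j, 0)) ∈ S}) ≤
      m * q ^ (#eᶜ) * Measure.infinitePi (fun _ : J × ℕ => Q) A := by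
  set P := Measure.infinitePi fun _ : J × ℕ => Q with hP
  let m' : J × ℕ → MeasurableSpace (J × ℕ → β) :=
    fun a => MeasurableSpace.comap (fun x : J × ℕ → β => x a) inferInstance
  have hle : ∀ a, m' a ≤ MeasurableSpace.pi := fun a => (measurable_pi_apply a).comap_le
  have hind : ProbabilityTheory.iIndep m' P :=
    (ProbabilityTheory.iIndepFun_infinitePi (P := fun _ : J × ℕ => Q) (X := fun _ ω => ω)
      (fun _ => measurable_id)).iIndep
  let K : Set (J × ℕ) := {a | a.2 = 0 → a.1 ∈ e}
  let L : Set (J × ℕ) := {a | a.2 = 0 ∧ a.1 ∉ e}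
  have hKL : Disjoint K L := Set.disjoint_left.2 fun a ha hb => hb.2 (ha hb.1)
  have hindep := ProbabilityTheory.indep_iSup_of_disjoint hle hind hKL
  have hA' : MeasurableSet A := (iSup₂_le fun a _ => hle a : ⨆ a ∈ K, m' a ≤ _) _ hA
  let E : (J → β) → Set (J × ℕ → β) := fun φ => ⋂ j ∈ e, {x | x (j, 0) = φ j}
  let G : (J → β) → Set (J × ℕ → β) := fun φ => ⋂ j ∈ eᶜ, {x | x (j, 0) = φ j}
  have hbase : ∀ (a : J × ℕ) (T : Set (J × ℕ)), a ∈ T → ∀ b,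
      MeasurableSet[⨆ a ∈ T, m' a] {x : J × ℕ → β | x a = b} := fun a T ha b =>
    (le_iSup₂_of_le a ha le_rfl : m' a ≤ ⨆ a ∈ T, m' a) _ ⟨{b}, measurableSet_singleton b, rfl⟩
  have hE : ∀ φ, MeasurableSet[⨆ a ∈ K, m' a] (E φ) := fun φ =>
    Finset.measurableSet_biInter (m := ⨆ a ∈ K, m' a) e fun j hj => hbase (j, 0) K (fun _ => hj) _
  have hG : ∀ φ, MeasurableSet[⨆ a ∈ L, m' a] (G φ) := fun φ =>
    Finset.measurableSet_biInter (m := ⨆ a ∈ L, m' a) eᶜ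
      fun j hj => hbase (j, 0) L ⟨rfl, Finset.mem_compl.1 hj⟩ _
  have hE' : ∀ φ, MeasurableSet (E φ) := fun φ =>
    (iSup₂_le fun a _ => hle a : ⨆ a ∈ K, m' a ≤ _) _ (hE φ)
  have hGP : ∀ φ, P (G φ) = q ^ (#eᶜ) := by
    intro φ
    have h1 : G φ = ((eᶜ.image fun j => (j, 0) : Finset (J × ℕ)) : Set (J × ℕ)).pi
        fun a => {φ a.1} := by
      ext x
      simp [G, Set.mem_pi]
    rw [h1, hP, Measure.infinitePi_pi _ (fun _ _ => measurableSet_singleton _),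
      Finset.prod_image (fun a _ b _ h => congrArg Prod.fst h)]
    simp [hQ]
  have hcover : A ∩ {x | (fun j => x (j, 0)) ∈ S} ⊆ ⋃ φ ∈ S, (A ∩ E φ) ∩ G φ := by
    rintro x ⟨hxA, hxS⟩
    refine Set.mem_iUnion₂.2 ⟨_, hxS, ⟨hxA, ?_⟩, ?_⟩ <;> simp [E, G]
  calc P (A ∩ {x | (fun j => x (j, 0)) ∈ S})
      ≤ ∑ φ ∈ S, P ((A ∩ E φ) ∩ G φ) :=
        (measure_mono hcover).trans (measure_biUnion_finset_le _ _)
    _ = ∑ φ ∈ S, P (A ∩ E φ) * q ^ (#eᶜ) := by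
        refine Finset.sum_congr rfl fun φ _ => ?_
        rw [← hGP φ]
        exact (ProbabilityTheory.Indep_iff _ _ _).1 hindep _ _
          (@MeasurableSet.inter _ (⨆ a ∈ K, m' a) _ _ hA (hE φ)) (hG φ)
    _ = (∑ φ ∈ S, (P.restrict A) (E φ)) * q ^ (#eᶜ) := by
        rw [Finset.sum_mul]
        refine Finset.sum_congr rfl fun φ _ => ?_
        rw [Measure.restrict_apply (hE' φ), Set.inter_comm]
    _ ≤ (m * P A) * q ^ (#eᶜ) := by
        gcongr
        calc ∑ φ ∈ S, (P.restrict A) (E φ)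
            = ∫⁻ x, ∑ φ ∈ S, (E φ).indicator 1 x ∂(P.restrict A) := by
              rw [lintegral_finsetSum _ fun φ _ => measurable_one.indicator (hE' φ)]
              exact Finset.sum_congr rfl fun φ _ => (lintegral_indicator_one (hE' φ)).symm
          _ ≤ ∫⁻ _, (m : ENNReal) ∂(P.restrict A) := by
              refine lintegral_mono fun x => ?_
              have : ∑ φ ∈ S, (E φ).indicator (1 : (J × ℕ → β) → ENNReal) x =
                  (#{φ ∈ S | ∀ j ∈ e, φ j = x (j, 0)} : ENNReal) := by
                rw [Finset.card_filter, Nat.cast_sum]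
                refine Finset.sum_congr rfl fun φ _ => ?_
                simp only [Set.indicator, E, Set.mem_iInter, Set.mem_ofPred_eq, Pi.one_apply]
                simp only [eq_comm, Nat.cast_ite, Nat.cast_one, Nat.cast_zero]
              rw [this]
              exact Nat.cast_le.2 <| hm fun j => x (j, 0)
          _ = m * P A := by simp
    _ = m * q ^ (#eᶜ) * P A := by ring

theorem infinitePi_apply_mem {J β : Type*} [Fintype J] [DecidableEq J] [Fintype β]
    [DecidableEq β] [MeasurableSpace β] [MeasurableSingletonClass β] (S : Finset (J → β))
    (Q : Measure β) [IsProbabilityMeasure Q] {q : ENNReal} (hQ : ∀ b, Q {b} = q) :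
    Measure.infinitePi (fun _ : J × ℕ => Q) {x | (fun j => x (j, 0)) ∈ S} =
      #S * q ^ Fintype.card J := by
  have hm : Measurable fun (x : J × ℕ → β) j => x (j, 0) :=
    measurable_pi_lambda _ fun j => measurable_pi_apply _
  have h1 := Measure.map_infinitePi_infinitePi_of_inj (P := fun _ : J × ℕ => Q)
    (f := fun j : J => (j, 0)) (fun a b h => congrArg Prod.fst h)
  have h2 : {x : J × ℕ → β | (fun j => x (j, 0)) ∈ S} =
    (fun (x : J × ℕ → β) j => x (j, 0)) ⁻¹' (S : Set (J → β)) := rfl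
  rw [h2, ← Measure.map_apply hm S.measurableSet, h1, ← sum_measure_singleton]
  have h3 : ∀ φ : J → β, Measure.infinitePi (fun _ : J => Q) {φ} = q ^ Fintype.card J := by
    intro φ
    rw [Measure.infinitePi_singleton_of_fintype]
    simp [hQ]
  simp [h3]

/-- The index of the bit recording whether the `e`-part of the base point lies in a projection. -/
def rootIndex {J : Type*} [DecidableEq J] (e : Finset J) : Finset J × (J → ℕ) :=
  (e, fun j => if j ∈ e then 0 else 1)

theorem zeroSet_rootIndex {J : Type*} [Fintype J] [DecidableEq J] (e : Finset J) :
    zeroSet (rootIndex e).2 = e := by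
  ext j
  simp [mem_zeroSet, rootIndex]

/-- The set of configurations whose bits at all `rootIndex e` with `e ∈ F` are set. -/
def rootSet {J : Type*} [DecidableEq J] (F : Finset (Finset J)) :
    Set (Finset J × (J → ℕ) → Bool) :=
  ⋂ e ∈ F, {ω | ω (rootIndex e) = true}

theorem isClopen_rootSet {J : Type*} [DecidableEq J] (F : Finset (Finset J)) :
    IsClopen (rootSet F) :=
  F.finite_toSet.isClopen_biInter fun e _ =>
    (isClopen_discrete {true}).preimage (continuous_apply (rootIndex e))

theorem exists_shiftMap_invariant_measures {J : Type*} [Fintype J] [DecidableEq J]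
    (F : Finset (Finset J)) {r : ℕ} (hF : ∀ e ∈ F, #e = r) {δ : ℝ} (hδ : 0 < δ) (m : ℕ) {n : ℕ}
    (hn : 0 < n) (S : Finset (J → Fin n)) (hS : δ * n ^ r ≤ #S)
    (hm : ∀ e ∈ F, ∀ s : J → Fin n, #{φ ∈ S | ∀ j ∈ e, φ j = s j} ≤ m) :
    ∃ μ ν : ProbabilityMeasure (Finset J × (J → ℕ) → Bool),
      (∀ e M, MeasurePreserving (shiftMap e M) (μ : Measure (Finset J × (J → ℕ) → Bool)) μ) ∧
      (∀ e ∈ F, ∀ D, MeasurableSet[bitSigma {k | zeroSet k.2 ⊆ e}] D →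
        (ν : Measure (Finset J × (J → ℕ) → Bool)) D ≤
          m * (ENNReal.ofReal δ)⁻¹ * (μ : Measure (Finset J × (J → ℕ) → Bool)) D) ∧
      (ν : Measure (Finset J × (J → ℕ) → Bool)) (rootSet F) = 1 ∧
      (μ : Measure (Finset J × (J → ℕ) → Bool)) (rootSet F) =
        #{x : J → Fin n | ∀ e ∈ F, ∃ φ ∈ S, ∀ j ∈ e, φ j = x j} *
          (n : ENNReal)⁻¹ ^ Fintype.card J := by
  have hne : Nonempty (Fin n) := ⟨⟨0, hn⟩⟩
  set Q : Measure (Fin n) := (PMF.uniformOfFintype (Fin n)).toMeasure with hQdef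
  have hQ : ∀ b, Q {b} = (n : ENNReal)⁻¹ := by
    intro b
    rw [hQdef, PMF.toMeasure_apply_singleton _ _ (measurableSet_singleton _)]
    simp
  set P := Measure.infinitePi fun _ : J × ℕ => Q with hP
  set q := (n : ENNReal)⁻¹ with hq
  have hq0 : q ≠ 0 := ENNReal.inv_ne_zero.2 (ENNReal.natCast_ne_top n)
  have hqt : q ≠ ⊤ := ENNReal.inv_ne_top.2 (by exact_mod_cast hn.ne')
  set X₀ : Set (J × ℕ → Fin n) := {x | (fun j => x (j, 0)) ∈ S} with hX₀
  have hbase : Measurable fun (x : J × ℕ → Fin n) j => x (j, 0) :=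
    measurable_pi_lambda _ fun j => measurable_pi_apply _
  have hX₀m : MeasurableSet X₀ := hbase S.measurableSet
  have hPX₀ : P X₀ = #S * q ^ Fintype.card J := infinitePi_apply_mem S Q hQ
  have hScard : 0 < #S := by
    have : (0 : ℝ) < δ * n ^ r := by positivity
    exact_mod_cast this.trans_le hS
  have hPX₀0 : P X₀ ≠ 0 := by
    rw [hPX₀]
    exact mul_ne_zero (by exact_mod_cast hScard.ne') (pow_ne_zero _ hq0)
  have henc : Measurable (encode S) := measurable_pi_lambda _ fun k =>
    (measurable_encode S k Set.univ fun _ _ => trivial).mono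
      (iSup₂_le fun a _ => (measurable_pi_apply a).comap_le) le_rfl
  have hcond : IsProbabilityMeasure (ProbabilityTheory.cond P X₀) :=
    ProbabilityTheory.cond_isProbabilityMeasure hPX₀0
  have hpre : encode S ⁻¹' rootSet F = {x | (fun j => x (j, 0)) ∈
      ({x : J → Fin n | ∀ e ∈ F, ∃ φ ∈ S, ∀ j ∈ e, φ j = x j} : Finset (J → Fin n))} := by
    ext x
    simp only [rootSet, Set.mem_preimage, Set.mem_iInter, Set.mem_ofPred_eq, encode, rootIndex,
      decide_eq_true_eq, Finset.mem_filter, Finset.mem_univ, true_and]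
    refine forall₂_congr fun e _ => exists_congr fun φ => and_congr_right fun _ =>
      forall₂_congr fun j hj => ?_
    rw [if_pos hj]
  have hRm := (isClopen_rootSet F).isOpen.measurableSet
  refine ⟨⟨P.map (encode S), Measure.isProbabilityMeasure_map henc.aemeasurable⟩,
    ⟨(ProbabilityTheory.cond P X₀).map (encode S),
      Measure.isProbabilityMeasure_map henc.aemeasurable⟩, fun e M => ?_, fun e he D hD => ?_,
    ?_, ?_⟩
  · exact measurePreserving_shiftMap_map_encode S Q e M
  · have hDm : MeasurableSet D := bitSigma_le _ _ hD
    have hA : MeasurableSet[⨆ a ∈ {a : J × ℕ | a.2 = 0 → a.1 ∈ e},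
        MeasurableSpace.comap (fun x : J × ℕ → Fin n => x a) inferInstance] (encode S ⁻¹' D) :=
      (measurable_bitSigma_iff (K := {k : Finset J × (J → ℕ) | zeroSet k.2 ⊆ e})).2
        (fun k hk => measurable_encode S k {a : J × ℕ | a.2 = 0 → a.1 ∈ e} fun j _ hj =>
          hk (mem_zeroSet.2 hj)) hD
    have hle := measure_inter_le S Q hQ e (hm e he) hA
    have hδ' : ENNReal.ofReal δ * q ^ (#eᶜ) ≤ P X₀ := by
      have hv : Fintype.card J = r + #eᶜ := by rw [← hF e he, Finset.card_add_card_compl]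
      rw [hPX₀, hv, pow_add, ← mul_assoc]
      gcongr
      rw [hq, ← ENNReal.inv_pow, ← div_eq_mul_inv]
      rw [ENNReal.le_div_iff_mul_le (Or.inl (pow_ne_zero _ (by exact_mod_cast hn.ne')))
        (Or.inl (ENNReal.pow_ne_top (ENNReal.natCast_ne_top n)))]
      have h1 := ENNReal.ofReal_le_ofReal hS
      rw [ENNReal.ofReal_mul hδ.le, ENNReal.ofReal_natCast,
        ENNReal.ofReal_pow (Nat.cast_nonneg n), ENNReal.ofReal_natCast] at h1
      exact h1
    have hδ0 : ENNReal.ofReal δ ≠ 0 := (ENNReal.ofReal_pos.2 hδ).ne'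
    have hδ'' : q ^ (#eᶜ) ≤ (ENNReal.ofReal δ)⁻¹ * P X₀ := by
      rw [← one_mul (q ^ _), ← ENNReal.inv_mul_cancel hδ0 ENNReal.ofReal_ne_top, mul_assoc]
      gcongr
    change ((ProbabilityTheory.cond P X₀).map (encode S)) D ≤ _ * (P.map (encode S)) D
    rw [Measure.map_apply henc hDm, Measure.map_apply henc hDm,
      ProbabilityTheory.cond_apply hX₀m, Set.inter_comm]
    calc (P X₀)⁻¹ * P (encode S ⁻¹' D ∩ X₀)
        ≤ (P X₀)⁻¹ * (m * q ^ (#eᶜ) * P (encode S ⁻¹' D)) := by gcongr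
      _ ≤ (P X₀)⁻¹ * (m * ((ENNReal.ofReal δ)⁻¹ * P X₀) * P (encode S ⁻¹' D)) := by gcongr
      _ = ((P X₀)⁻¹ * P X₀) * (m * (ENNReal.ofReal δ)⁻¹ * P (encode S ⁻¹' D)) := by ring
      _ = m * (ENNReal.ofReal δ)⁻¹ * P (encode S ⁻¹' D) := by
        rw [ENNReal.inv_mul_cancel hPX₀0 (measure_ne_top _ _), one_mul]
  · change ((ProbabilityTheory.cond P X₀).map (encode S)) (rootSet F) = 1
    rw [Measure.map_apply henc hRm, ProbabilityTheory.cond_apply hX₀m, Set.inter_eq_left.2,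
      ENNReal.inv_mul_cancel hPX₀0 (measure_ne_top _ _)]
    rw [hpre]
    intro x hx
    simp only [Set.mem_ofPred_eq, Finset.mem_filter, Finset.mem_univ, true_and]
    exact fun e _ => ⟨_, hx, fun j _ => rfl⟩
  · change (P.map (encode S)) (rootSet F) = _
    rw [Measure.map_apply henc hRm, hpre, infinitePi_apply_mem _ Q hQ]

/-- A weak form of the hypergraph removal lemma: if `S` contains at least `δ n ^ r` maps, at most
`m` of which agree on any given member of `F`, then a positive proportion of all maps agree on each
member of `F` with some element of `S`. -/
theorem exists_pos_mul_pow_le_card {J : Type*} [Fintype J] [DecidableEq J]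
    (F : Finset (Finset J)) {r : ℕ} (hF : ∀ e ∈ F, #e = r) {δ : ℝ} (hδ : 0 < δ) (m : ℕ) :
    ∃ c : ℝ, 0 < c ∧ ∀ n : ℕ, 0 < n → ∀ S : Finset (J → Fin n), δ * n ^ r ≤ #S →
      (∀ e ∈ F, ∀ s : J → Fin n, #{φ ∈ S | ∀ j ∈ e, φ j = s j} ≤ m) →
      c * n ^ Fintype.card J ≤
        #{x : J → Fin n | ∀ e ∈ F, ∃ φ ∈ S, ∀ j ∈ e, φ j = x j} := by
  by_contra! h
  have h1 : ∀ t : ℕ, ∃ μ ν : ProbabilityMeasure (Finset J × (J → ℕ) → Bool),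
      (∀ e M, MeasurePreserving (shiftMap e M) (μ : Measure (Finset J × (J → ℕ) → Bool)) μ) ∧
      (∀ e ∈ F, ∀ D, MeasurableSet[bitSigma {k | zeroSet k.2 ⊆ e}] D →
        (ν : Measure (Finset J × (J → ℕ) → Bool)) D ≤
          m * (ENNReal.ofReal δ)⁻¹ * (μ : Measure (Finset J × (J → ℕ) → Bool)) D) ∧
      (ν : Measure (Finset J × (J → ℕ) → Bool)) (rootSet F) = 1 ∧
      (μ : Measure (Finset J × (J → ℕ) → Bool)) (rootSet F) ≤
        ENNReal.ofReal (1 / ((t : ℝ) + 1)) := by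
    intro t
    obtain ⟨n, hn, S, hS, hm, hlt⟩ := h (1 / ((t : ℝ) + 1)) (by positivity)
    obtain ⟨μ, ν, h1, h2, h3, h4⟩ := exists_shiftMap_invariant_measures F hF hδ m hn S hS hm
    refine ⟨μ, ν, h1, h2, h3, ?_⟩
    rw [h4, ← ENNReal.inv_pow, ← div_eq_mul_inv]
    refine ENNReal.div_le_of_le_mul ?_
    have h5 := ENNReal.ofReal_le_ofReal hlt.le
    rwa [ENNReal.ofReal_mul (by positivity), ENNReal.ofReal_natCast,
      ENNReal.ofReal_pow (Nat.cast_nonneg n), ENNReal.ofReal_natCast] at h5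
  choose μ ν hμ hν hν1 hμ0 using h1
  let U : Ultrafilter ℕ := hyperfilter ℕ
  have hUtop : (U : Filter ℕ) ≤ atTop := Nat.hyperfilter_le_atTop
  have hμl : Tendsto μ U (𝓝 (U.map μ).lim) := (U.map μ).le_nhds_lim
  have hνl : Tendsto ν U (𝓝 (U.map ν).lim) := (U.map ν).le_nhds_lim
  set μ' := (U.map μ).lim
  set ν' := (U.map ν).lim
  have hC : (m : ENNReal) * (ENNReal.ofReal δ)⁻¹ ≠ ⊤ :=
    ENNReal.mul_ne_top (ENNReal.natCast_ne_top m)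
      (ENNReal.inv_ne_top.2 (ENNReal.ofReal_pos.2 hδ).ne')
  have hinv : ∀ e M, MeasurePreserving (shiftMap (A := Finset J) (J := J) e M)
      (μ' : Measure (Finset J × (J → ℕ) → Bool)) μ' := fun e M =>
    measurePreserving_of_tendsto hμl (continuous_pi fun k => continuous_apply _) fun t => hμ t e M
  have hac : ∀ e ∈ F, ∀ D, MeasurableSet[bitSigma {k | zeroSet k.2 ⊆ e}] D →
      (μ' : Measure (Finset J × (J → ℕ) → Bool)) D = 0 →
      (ν' : Measure (Finset J × (J → ℕ) → Bool)) D = 0 := fun e he D hD h0 =>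
    measure_eq_zero_of_tendsto_bitSigma hμl hνl hC _ (fun t D hD => hν t e he D hD) hD h0
  refine measure_iInter_ne_zero_of_forall_absolutelyContinuous hinv F hac _ Finset.univ rfl
    (fun _ _ _ _ => Finset.mem_coe.2 (Finset.mem_univ _)) (fun e => {ω | ω (rootIndex e) = true})
    (fun e _ => ?_) ?_ ?_
  · exact measurable_bitSigma_eval (K := {k : Finset J × (J → ℕ) |
        zeroSet k.2 ∈ Finset.univ ∧ zeroSet k.2 ⊆ e})
      ⟨Finset.mem_univ _, (zeroSet_rootIndex e).subset⟩ (measurableSet_singleton true)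
  · have h2 := ProbabilityMeasure.limsup_measure_closed_le_of_tendsto hνl
      (isClopen_rootSet F).isClosed
    simp only [hν1, limsup_const] at h2
    exact (zero_lt_one.trans_le h2).ne'
  · have h2 := ProbabilityMeasure.le_liminf_measure_open_of_tendsto hμl
      (isClopen_rootSet F).isOpen
    refine le_antisymm (h2.trans ?_) bot_le
    have h3 : Tendsto (fun t : ℕ => ENNReal.ofReal (1 / ((t : ℝ) + 1))) U (𝓝 0) := by
      have := (ENNReal.tendsto_ofReal
        (tendsto_one_div_add_atTop_nhds_zero_nat (𝕜 := ℝ))).mono_left hUtop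
      simpa using this
    exact (liminf_le_liminf (Eventually.of_forall fun t => hμ0 t)).trans h3.liminf_eq.le

theorem card_mul_le_of_forall_exists_finset {J : Type*} [Fintype J] [DecidableEq J] {n : ℕ}
    (B : Finset (J → Fin n)) (j : J) (c : ℕ)
    (h : ∀ y ∈ B, ∃ T : Finset (Fin n), #T ≤ c ∧ ∀ x ∈ B, (∀ i, i ≠ j → x i = y i) → x j ∈ T) :
    #B * n ≤ c * n ^ Fintype.card J := by
  let f : (J → Fin n) → ({i // i ≠ j} → Fin n) := fun x i => x i
  have h1 : #B ≤ c * #(B.image f) := by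
    refine Finset.card_le_mul_card_image B c fun a ha => ?_
    obtain ⟨y, hy, rfl⟩ := Finset.mem_image.1 ha
    obtain ⟨T, hTc, hT⟩ := h y hy
    refine le_trans (Finset.card_le_card_of_injOn (fun x => x j) ?_ ?_) hTc
    · intro x hx
      obtain ⟨hx, hxy⟩ := Finset.mem_filter.1 hx
      exact hT x hx fun i hi => congrFun hxy ⟨i, hi⟩
    · intro x hx x' hx' hxx
      have hx2 := (Finset.mem_filter.1 hx).2
      have hx2' := (Finset.mem_filter.1 hx').2
      funext i
      by_cases hi : i = j
      · rw [hi]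
        exact hxx
      · exact congrFun (hx2.trans hx2'.symm) ⟨i, hi⟩
  have h2 : #(B.image f) ≤ n ^ (Fintype.card J - 1) := by
    refine (Finset.card_le_univ _).trans ?_
    simp
  have h3 : Fintype.card J - 1 + 1 = Fintype.card J :=
    Nat.succ_pred_eq_of_pos (Fintype.card_pos_iff.2 ⟨j⟩)
  calc #B * n ≤ c * n ^ (Fintype.card J - 1) * n := by gcongr; exact h1.trans (by gcongr)
    _ = c * n ^ Fintype.card J := by rw [mul_assoc, ← pow_succ, h3]

theorem containsBerge_of_forall_card_le {α β : Type*} [DecidableEq α] [DecidableEq β]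
    {F : Finset (Finset α)} {H : Finset (Finset β)} {φ : α → β} (hφ : Function.Injective φ)
    (h : ∀ e ∈ F, #F ≤ #{h ∈ H | e.image φ ⊆ h}) : ContainsBerge F H := by
  have hall : ∀ s : Finset F, #s ≤ #(s.biUnion fun e => {h ∈ H | e.1.image φ ⊆ h}) := by
    intro s
    obtain rfl | ⟨e, he⟩ := s.eq_empty_or_nonempty
    · simp
    · calc #s ≤ #F := by simpa using Finset.card_le_univ s
        _ ≤ #{h ∈ H | e.1.image φ ⊆ h} := h e e.2
        _ ≤ _ := Finset.card_le_card
          (Finset.subset_biUnion_of_mem (fun e : F => {h ∈ H | e.1.image φ ⊆ h}) he)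
  obtain ⟨f, hf, hfm⟩ := (Finset.all_card_le_biUnion_card_iff_exists_injective _).1 hall
  refine ⟨φ, fun e => if he : e ∈ F then f ⟨e, he⟩ else ∅, hφ, ?_, ?_, ?_⟩
  · intro e he e' he' hee
    simp only [Finset.mem_coe] at he he'
    simp only [dif_pos he, dif_pos he'] at hee
    exact congrArg Subtype.val (hf hee)
  · intro e he
    simp only [dif_pos he]
    exact (Finset.mem_filter.1 (hfm ⟨e, he⟩)).1
  · intro e he
    simp only [dif_pos he]
    exact (Finset.mem_filter.1 (hfm ⟨e, he⟩)).2

/-- In a Berge-`F`-free hypergraph every hyperedge contains a copy of `F` all of whose hyperedges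
have small codegree. -/
theorem exists_copy_codegree_lt {α β : Type*} [DecidableEq α] [DecidableEq β] {r k : ℕ}
    {F : Finset (Finset α)} (hk : RamseyProp k r F) {H : Finset (Finset β)}
    (hF : ¬ ContainsBerge F H) {h : Finset β} (hh : #h = k) :
    ∃ φ : α → β, Function.Injective φ ∧
      ∀ e ∈ F, e.image φ ⊆ h ∧ #{h' ∈ H | e.image φ ⊆ h'} < #F := by
  let ι : Fin k → β := fun i => (h.equivFinOfCardEq hh).symm i
  have hι : Function.Injective ι := fun a b hab =>
    (h.equivFinOfCardEq hh).symm.injective (Subtype.ext hab)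
  have hιh : ∀ i, ι i ∈ h := fun i => ((h.equivFinOfCardEq hh).symm i).2
  obtain ⟨c, φ, hφ, hc⟩ := hk fun s => decide (#F ≤ #{h' ∈ H | s.image ι ⊆ h'})
  have hcol : ∀ e ∈ F, decide (#F ≤ #{h' ∈ H | e.image (ι ∘ φ) ⊆ h'}) = c := by
    intro e he
    have := (Finset.mem_filter.1 (hc e he)).2
    rwa [Finset.image_image] at this
  refine ⟨ι ∘ φ, hι.comp hφ, fun e he => ⟨Finset.image_subset_iff.2 fun a _ => hιh _, ?_⟩⟩
  cases c with
  | true =>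
    exact absurd (containsBerge_of_forall_card_le (hι.comp hφ) fun e he =>
      of_decide_eq_true (hcol e he)) hF
  | false => exact not_le.1 (of_decide_eq_false (hcol e he))

/-- There are few maps into a Berge-`F`-free hypergraph that send every hyperedge of `F` to a set
of positive but small codegree. -/
theorem card_mul_le_of_not_containsBerge {α : Type*} [Fintype α] [DecidableEq α] {r k n : ℕ}
    {F : Finset (Finset α)} (hF : ∀ e ∈ F, #e = r) {H : Finset (Finset (Fin n))}
    (hH : ∀ h ∈ H, #h = k) (hFH : ¬ ContainsBerge F H) (m : ℕ) (B : Finset (α → Fin n))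
    (hB : ∀ x ∈ B, ∀ e ∈ F, (∃ h ∈ H, e.image x ⊆ h) ∧ #{h ∈ H | e.image x ⊆ h} ≤ m) :
    #B * n ≤ (Fintype.card α * Fintype.card α + #F * Fintype.card α * (m * k)) *
      n ^ Fintype.card α := by
  let B₁ : α × α → Finset (α → Fin n) := fun p => {x | p.1 ≠ p.2 ∧ x p.1 = x p.2}
  let B₂ : Finset α × α → Finset (α → Fin n) := fun p =>
    {x | p.2 ∉ p.1 ∧ #{h ∈ H | p.1.image x ⊆ h} ≤ m ∧ ∃ h ∈ H, p.1.image x ⊆ h ∧ x p.2 ∈ h}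
  have hcover : B ⊆ (univ.biUnion B₁) ∪ (F ×ˢ univ).biUnion B₂ := by
    intro x hx
    rw [Finset.mem_union]
    by_cases hinj : Function.Injective x
    · right
      choose! f hfH hf using fun e he => (hB x hx e he).1
      have hnot : ¬ Set.InjOn f (F : Set (Finset α)) := fun h => hFH ⟨x, f, hinj, h, hfH, hf⟩
      simp only [Set.InjOn, not_forall] at hnot
      obtain ⟨e, he, e', he', hee, hne⟩ := hnot
      have hns : ¬ e' ⊆ e := fun hs => hne
        (Finset.eq_of_subset_of_card_le hs (by rw [hF e he, hF e' he'])).symm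
      obtain ⟨j, hj, hje⟩ := Finset.not_subset.1 hns
      refine Finset.mem_biUnion.2 ⟨(e, j), Finset.mem_product.2 ⟨he, Finset.mem_univ _⟩, ?_⟩
      refine Finset.mem_filter.2 ⟨Finset.mem_univ _, hje, (hB x hx e he).2, f e, hfH e he,
        hf e he, ?_⟩
      rw [hee]
      exact hf e' he' (Finset.mem_image_of_mem x hj)
    · left
      simp only [Function.Injective, not_forall] at hinj
      obtain ⟨a, b, hab, hne⟩ := hinj
      exact Finset.mem_biUnion.2 ⟨(a, b), Finset.mem_univ _,
        Finset.mem_filter.2 ⟨Finset.mem_univ _, hne, hab⟩⟩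
  have h₁ : ∀ p, #(B₁ p) * n ≤ n ^ Fintype.card α := by
    intro p
    rw [← one_mul (n ^ _)]
    refine card_mul_le_of_forall_exists_finset _ p.1 1 fun y _ =>
      ⟨{y p.2}, (Finset.card_singleton _).le, fun x hx hxy => ?_⟩
    obtain ⟨-, hne, hxe⟩ := Finset.mem_filter.1 hx
    rw [Finset.mem_singleton, hxe, hxy _ hne.symm]
  have h₂ : ∀ p, #(B₂ p) * n ≤ m * k * n ^ Fintype.card α := by
    intro p
    refine card_mul_le_of_forall_exists_finset _ p.2 (m * k) fun y hy =>
      ⟨({h ∈ H | p.1.image y ⊆ h} : Finset (Finset (Fin n))).biUnion id, ?_, fun x hx hxy => ?_⟩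
    · obtain ⟨-, -, hm, -⟩ := Finset.mem_filter.1 hy
      refine (Finset.card_biUnion_le_card_mul _ _ k fun h hh =>
        (hH h (Finset.mem_filter.1 hh).1).le).trans ?_
      gcongr
    · obtain ⟨-, hp, -, h, hh, hs, hxh⟩ := Finset.mem_filter.1 hx
      have him : p.1.image y = p.1.image x := Finset.image_congr fun i hi =>
        (hxy i fun hip => hp (hip ▸ hi)).symm
      exact Finset.mem_biUnion.2 ⟨h, Finset.mem_filter.2 ⟨hh, him ▸ hs⟩, hxh⟩
  calc #B * n ≤ (∑ p, #(B₁ p) + ∑ p ∈ F ×ˢ univ, #(B₂ p)) * n := by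
        gcongr
        refine (Finset.card_le_card hcover).trans ((Finset.card_union_le _ _).trans ?_)
        exact add_le_add Finset.card_biUnion_le Finset.card_biUnion_le
    _ = ∑ p, #(B₁ p) * n + ∑ p ∈ F ×ˢ univ, #(B₂ p) * n := by
        rw [add_mul, Finset.sum_mul, Finset.sum_mul]
    _ ≤ ∑ _p : α × α, n ^ Fintype.card α +
          ∑ _p ∈ F ×ˢ (univ : Finset α), m * k * n ^ Fintype.card α :=
        add_le_add (Finset.sum_le_sum fun p _ => h₁ p) (Finset.sum_le_sum fun p _ => h₂ p)
    _ = _ := by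
        simp only [Finset.sum_const, Finset.card_product, Finset.card_univ, Fintype.card_prod,
          smul_eq_mul]
        ring

theorem statement3 {α : Type*} [DecidableEq α] (r k : ℕ) (hr : 2 ≤ r)
    (F : Finset (Finset α)) (hF : ∀ e ∈ F, e.card = r)
    (hk : RamseyProp k r F) :
    ∀ ε : ℝ, 0 < ε → ∃ N : ℕ, ∀ n ≥ N, ∀ H : Finset (Finset (Fin n)),
      (∀ h ∈ H, h.card = k) →
      ¬ ContainsBerge F H →
      (H.card : ℝ) ≤ ε * (n : ℝ) ^ r := by
  intro ε hε
  obtain ⟨-, φ₀, hφ₀, -⟩ := hk fun _ => true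
  have := Fintype.ofInjective φ₀ hφ₀
  obtain rfl | ⟨e₀, he₀⟩ := F.eq_empty_or_nonempty
  · refine ⟨Fintype.card α, fun n hn H _ hH => (hH ?_).elim⟩
    exact ⟨fun a => Fin.castLE hn (Fintype.equivFin α a), fun _ => ∅,
      (Fin.castLE_injective hn).comp (Fintype.equivFin α).injective, by simp, by simp, by simp⟩
  have hm0 : 0 < #F := Finset.card_pos.2 ⟨e₀, he₀⟩
  have hmR : (0 : ℝ) < #F := by exact_mod_cast hm0
  obtain ⟨c, hc, hrem⟩ := exists_pos_mul_pow_le_card F hF (div_pos hε hmR) #F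
  set C := Fintype.card α * Fintype.card α + #F * Fintype.card α * (#F * k) with hC
  refine ⟨⌈(C : ℝ) / c⌉₊ + 1, fun n hn H hH hFH => ?_⟩
  by_contra! hlt
  have hn0 : 0 < n := by omega
  have hne : Nonempty (Fin n) := ⟨⟨0, hn0⟩⟩
  choose! Φ hΦi hΦ using fun h (hh : h ∈ H) => exists_copy_codegree_lt hk hFH (hH h hh)
  have hHS : #H ≤ #F * #(H.image Φ) := by
    refine Finset.card_le_mul_card_image H _ fun φ hφ => ?_
    obtain ⟨h, hh, rfl⟩ := Finset.mem_image.1 hφ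
    refine le_trans (Finset.card_le_card fun h' hh' => ?_) (hΦ h hh e₀ he₀).2.le
    obtain ⟨hh', heq⟩ := Finset.mem_filter.1 hh'
    exact Finset.mem_filter.2 ⟨hh', heq ▸ (hΦ h' hh' e₀ he₀).1⟩
  have hS : ε / #F * (n : ℝ) ^ r ≤ #(H.image Φ) := by
    rw [div_mul_eq_mul_div, div_le_iff₀ hmR, mul_comm (#(H.image Φ) : ℝ)]
    exact hlt.le.trans (by exact_mod_cast hHS)
  have hfib : ∀ e ∈ F, ∀ s : α → Fin n, #{φ ∈ H.image Φ | ∀ j ∈ e, φ j = s j} ≤ #F := by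
    intro e he s
    obtain h0 | ⟨φ, hφ⟩ := ({φ ∈ H.image Φ | ∀ j ∈ e, φ j = s j} :
      Finset (α → Fin n)).eq_empty_or_nonempty
    · simp [h0]
    · obtain ⟨hφ, hφs⟩ := Finset.mem_filter.1 hφ
      obtain ⟨h, hh, rfl⟩ := Finset.mem_image.1 hφ
      refine le_trans ?_ (hΦ h hh e he).2.le
      refine le_trans (Finset.card_le_card ?_) (Finset.card_image_le (f := Φ))
      intro ψ hψ
      obtain ⟨hψ, hψs⟩ := Finset.mem_filter.1 hψ
      obtain ⟨h', hh', rfl⟩ := Finset.mem_image.1 hψ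
      refine Finset.mem_image_of_mem Φ (Finset.mem_filter.2 ⟨hh', ?_⟩)
      rw [Finset.image_congr fun j hj => (hφs j hj).trans (hψs j hj).symm]
      exact (hΦ h' hh' e he).1
  have hlow := hrem n hn0 _ hS hfib
  have hupp := card_mul_le_of_not_containsBerge hF hH hFH #F
    ({x | ∀ e ∈ F, ∃ φ ∈ H.image Φ, ∀ j ∈ e, φ j = x j} : Finset (α → Fin n)) fun x hx e he => by
      obtain ⟨φ, hφ, hφx⟩ := (Finset.mem_filter.1 hx).2 e he
      obtain ⟨h, hh, rfl⟩ := Finset.mem_image.1 hφ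
      have him : e.image x = e.image (Φ h) := Finset.image_congr fun j hj => (hφx j hj).symm
      rw [him]
      exact ⟨⟨h, hh, (hΦ h hh e he).1⟩, (hΦ h hh e he).2.le⟩
  rw [← hC] at hupp
  have hnR : (0 : ℝ) < n := by exact_mod_cast hn0
  have hCn : (C : ℝ) < c * n := by
    rw [← div_lt_iff₀' hc]
    exact (Nat.le_ceil _).trans_lt (by exact_mod_cast hn)
  have hpow : (0 : ℝ) < (n : ℝ) ^ Fintype.card α := by positivity
  have h1 : c * n ^ Fintype.card α * n ≤ C * (n : ℝ) ^ Fintype.card α :=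
    (mul_le_mul_of_nonneg_right hlow hnR.le).trans (by exact_mod_cast hupp)
  nlinarith [mul_lt_mul_of_pos_right hCn hpow]
end

section
/- Let F be an r-graph and let r ≤ l ≤ k. A k-graph H is a Berge copy of F if and only if there exists an l-graph G such that G is a Berge copy of F and H is a Berge copy of G. -/
open Finset

/-- `H` is (isomorphic to) a Berge copy of `F`: there is an injection of the vertices of
`F` and a bijection `f` from the edges of `F` onto the edges of `H` with `e ⊆ f e`. -/
def IsBergeOf {α β : Type*} [DecidableEq α] [DecidableEq β]
    (F : Finset (Finset α)) (H : Finset (Finset β)) : Prop :=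
  ∃ (φ : α → β) (f : Finset α → Finset β),
    Function.Injective φ ∧ Set.InjOn f (F : Set (Finset α)) ∧
    F.image f = H ∧ ∀ e ∈ F, e.image φ ⊆ f e

/-- Two families of sets are linked if there is a bijection between them sending each set to
a superset of it. -/
def Linked {β : Type*} [DecidableEq β] (S R : Finset (Finset β)) : Prop :=
  ∃ f : Finset β → Finset β, Set.InjOn f (S : Set (Finset β)) ∧ S.image f = R ∧
    ∀ s ∈ S, s ⊆ f s

/-- The `l`-sets lying between a member of `S` and a member of `R`. -/
def between {β : Type*} [DecidableEq β] (l : ℕ) (S R : Finset (Finset β)) :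
    Finset (Finset β) :=
  (R.biUnion fun t => t.powersetCard l).filter fun g => ∃ s ∈ S, s ⊆ g

section Linked

variable {β : Type*} [DecidableEq β]

theorem mem_between {l : ℕ} {S R : Finset (Finset β)} {g : Finset β} :
    g ∈ between l S R ↔ g.card = l ∧ (∃ s ∈ S, s ⊆ g) ∧ ∃ t ∈ R, g ⊆ t := by
  simp only [between, mem_filter, mem_biUnion, mem_powersetCard]
  grind

theorem between_mono {l : ℕ} {S S' R R' : Finset (Finset β)} (hS : S ⊆ S') (hR : R ⊆ R') :
    between l S R ⊆ between l S' R' := by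
  intro g
  simp only [mem_between]
  grind

theorem Linked.refl (S : Finset (Finset β)) : Linked S S :=
  ⟨id, Set.injOn_id _, image_id, fun _ _ => Subset.rfl⟩

theorem Linked.card_eq {S R : Finset (Finset β)} (h : Linked S R) : S.card = R.card := by
  obtain ⟨f, hf, rfl, -⟩ := h
  exact (card_image_of_injOn hf).symm

theorem Linked.trans {S T R : Finset (Finset β)} (h₁ : Linked S T) (h₂ : Linked T R) :
    Linked S R := by
  obtain ⟨f, hf, rfl, hfs⟩ := h₁
  obtain ⟨g, hg, rfl, hgs⟩ := h₂
  refine ⟨g ∘ f, hg.comp hf fun s hs => mem_coe.2 (mem_image_of_mem f hs), ?_, fun s hs => ?_⟩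
  · rw [image_image]
  · exact (hfs s hs).trans (hgs _ (mem_image_of_mem f hs))

/-- If `g ⊆ z` covers the members of `S` below it and all sets between `S` and `z` lie in `Q`,
then `z` lies above more members of `Q` than `g` lies above members of `S`. -/
theorem card_below_lt {r : ℕ} {S Q : Finset (Finset β)} {g z : Finset β}
    (hS : ∀ s ∈ S, s.card = r) (hg : g.card = r + 1) (hz : z.card = r + 2) (hgz : g ⊆ z)
    (hgQ : g ∈ Q) (hQ : ∀ s ∈ S, ∀ g', g'.card = r + 1 → s ⊆ g' → g' ⊆ z → g' ∈ Q) :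
    (S.filter (· ⊆ g)).card + 1 ≤ (Q.filter (· ⊆ z)).card := by
  have hd : (z \ g).card = 1 := by rw [card_sdiff_of_subset hgz]; omega
  obtain ⟨y, hy⟩ := card_eq_one.1 hd
  have hyz : y ∈ z \ g := by rw [hy]; exact mem_singleton_self y
  rw [mem_sdiff] at hyz
  have hinj : Set.InjOn (insert y) (S.filter (· ⊆ g) : Set (Finset β)) := by
    intro a ha b hb hab
    simp only [coe_filter, Set.mem_ofPred_eq] at ha hb
    have hya : y ∉ a := fun h => hyz.2 (ha.2 h)
    have hyb : y ∉ b := fun h => hyz.2 (hb.2 h)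
    rw [← erase_insert hya, ← erase_insert hyb, hab]
  have hnot : g ∉ (S.filter (· ⊆ g)).image (insert y) := by
    intro h
    obtain ⟨a, -, rfl⟩ := mem_image.1 h
    exact hyz.2 (mem_insert_self y a)
  rw [← card_image_of_injOn hinj, ← card_insert_of_notMem hnot]
  refine card_le_card (insert_subset (mem_filter.2 ⟨hgQ, hgz⟩) ?_)
  intro x hx
  obtain ⟨a, ha, rfl⟩ := mem_image.1 hx
  rw [mem_filter] at ha
  have hya : y ∉ a := fun h => hyz.2 (ha.2 h)
  have hsub : insert y a ⊆ z := insert_subset hyz.1 (ha.2.trans hgz)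
  exact mem_filter.2 ⟨hQ a ha.1 _ (by rw [card_insert_of_notMem hya, hS a ha.1])
    (subset_insert _ _) hsub, hsub⟩

/-- Dual of `card_below_lt`. -/
theorem card_above_lt {r : ℕ} {Q Z : Finset (Finset β)} {s g : Finset β}
    (hs : s.card = r) (hg : g.card = r + 1) (hZ : ∀ z ∈ Z, z.card = r + 2) (hsg : s ⊆ g)
    (hgQ : g ∈ Q) (hQ : ∀ z ∈ Z, ∀ g', g'.card = r + 1 → s ⊆ g' → g' ⊆ z → g' ∈ Q) :
    (Z.filter (g ⊆ ·)).card + 1 ≤ (Q.filter (s ⊆ ·)).card := by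
  have hinj : Set.InjOn (fun z => s ∪ z \ g) (Z.filter (g ⊆ ·) : Set (Finset β)) := by
    intro a ha b hb hab
    simp only [coe_filter, Set.mem_ofPred_eq] at ha hb
    have key : ∀ z : Finset β, g ⊆ z → g ∪ (s ∪ z \ g) = z := by
      intro z hz
      rw [← union_assoc, union_eq_left.2 hsg, union_sdiff_of_subset hz]
    have hab' : s ∪ a \ g = s ∪ b \ g := hab
    rw [← key a ha.2, ← key b hb.2, hab']
  have hdisj : ∀ z : Finset β, Disjoint s (z \ g) := fun z =>
    disjoint_sdiff.mono_left hsg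
  have hcard : ∀ z ∈ Z, g ⊆ z → (z \ g).card = 1 := by
    intro z hz hgz
    rw [card_sdiff_of_subset hgz, hZ z hz]
    omega
  have hnot : g ∉ (Z.filter (g ⊆ ·)).image fun z => s ∪ z \ g := by
    intro h
    obtain ⟨z, hz, hzg⟩ := mem_image.1 h
    rw [mem_filter] at hz
    have h1 := hcard z hz.1 hz.2
    obtain ⟨y, hy⟩ := card_pos.1 (by omega : 0 < (z \ g).card)
    have : y ∈ g := by rw [← hzg]; exact mem_union_right _ hy
    exact (mem_sdiff.1 hy).2 this
  rw [← card_image_of_injOn hinj, ← card_insert_of_notMem hnot]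
  refine card_le_card (insert_subset (mem_filter.2 ⟨hgQ, hsg⟩) ?_)
  intro x hx
  obtain ⟨z, hz, rfl⟩ := mem_image.1 hx
  rw [mem_filter] at hz
  refine mem_filter.2 ⟨hQ z hz.1 _ ?_ subset_union_left ?_, subset_union_left⟩
  · rw [card_union_of_disjoint (hdisj z), hs, hcard z hz.1 hz.2]
  · exact union_subset (hsg.trans hz.2) sdiff_subset

/-- A family containing every set between two adjacent levels cannot be linked to both. -/
theorem eq_empty_of_linked {r : ℕ} {S Q Z : Finset (Finset β)}
    (hS : ∀ s ∈ S, s.card = r) (hQ : ∀ g ∈ Q, g.card = r + 1) (hZ : ∀ z ∈ Z, z.card = r + 2)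
    (hSQ : Linked S Q) (hQZ : Linked Q Z)
    (hmid : ∀ s ∈ S, ∀ z ∈ Z, ∀ g, g.card = r + 1 → s ⊆ g → g ⊆ z → g ∈ Q) :
    Q = ∅ := by
  obtain ⟨p, hp, hpQ, hps⟩ := hSQ
  obtain ⟨q, hq, hqZ, hqs⟩ := hQZ
  have hp_mem : ∀ s ∈ S, p s ∈ Q := fun s hs => hpQ ▸ mem_image_of_mem p hs
  have hq_mem : ∀ g ∈ Q, q g ∈ Z := fun g hg => hqZ ▸ mem_image_of_mem q hg
  have hcard : S.card = Q.card := by rw [← hpQ, card_image_of_injOn hp]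
  have e₁ : ∑ s ∈ S, (Q.filter (s ⊆ ·)).card = ∑ g ∈ Q, (S.filter (· ⊆ g)).card := by
    simp only [card_filter]
    exact sum_comm
  have e₂ : ∑ g ∈ Q, (Z.filter (g ⊆ ·)).card = ∑ z ∈ Z, (Q.filter (· ⊆ z)).card := by
    simp only [card_filter]
    exact sum_comm
  have i₁ : ∑ g ∈ Q, ((S.filter (· ⊆ g)).card + 1) ≤ ∑ z ∈ Z, (Q.filter (· ⊆ z)).card := by
    rw [← hqZ, sum_image hq]
    refine sum_le_sum fun g hg => ?_
    exact card_below_lt hS (hQ g hg) (hZ _ (hq_mem g hg)) (hqs g hg) hg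
      fun s hs => hmid s hs _ (hq_mem g hg)
  have i₂ : ∑ g ∈ Q, (Z.filter (g ⊆ ·)).card + S.card ≤ ∑ s ∈ S, (Q.filter (s ⊆ ·)).card := by
    have : ∑ g ∈ Q, (Z.filter (g ⊆ ·)).card = ∑ s ∈ S, (Z.filter (p s ⊆ ·)).card := by
      conv_lhs => rw [← hpQ, sum_image hp]
    rw [this, card_eq_sum_ones, ← sum_add_distrib]
    refine sum_le_sum fun s hs => ?_
    exact card_above_lt (hS s hs) (hQ _ (hp_mem s hs)) hZ (hps s hs) (hp_mem s hs)
      fun z hz => hmid s hs z hz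
  rw [sum_add_distrib, ← card_eq_sum_ones] at i₁
  exact card_eq_zero.1 (by omega)

/-- A Hall-type criterion for a linking through the `l`-sets. -/
theorem exists_linked_of_card_le {l : ℕ} {S : Finset (Finset β)} {f : Finset β → Finset β}
    (hf : Set.InjOn f (S : Set (Finset β)))
    (hall : ∀ S' ⊆ S, S'.card ≤ (between l S' (S'.image f)).card) :
    ∃ T ⊆ between l S (S.image f), Linked S T ∧ Linked T (S.image f) := by
  set R := S.image f with hR
  set Q := between l S R with hQ
  let N : S ⊕ Q → Finset (Finset β ⊕ Finset β) := Sum.elim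
    (fun s => (Q.filter (s.1 ⊆ ·)).map .inl)
    (fun g => insert (Sum.inl g.1) ((R.filter (g.1 ⊆ ·)).map .inr))
  have hN : ∀ A : Finset (S ⊕ Q), A.card ≤ (A.biUnion N).card := by
    intro A
    set I : Finset (Finset β) := A.toLeft.map (Function.Embedding.subtype _) with hI
    set B : Finset (Finset β) := A.toRight.map (Function.Embedding.subtype _) with hB
    have hIS : I ⊆ S := by
      intro s hs
      obtain ⟨x, -, rfl⟩ := mem_map.1 hs
      exact x.2
    have hAc : A.card = I.card + B.card := by
      rw [hI, hB, card_map, card_map, card_toLeft_add_card_toRight]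
    set M := R.filter fun t => ∃ g ∈ B, g ⊆ t with hM
    set J := I.filter fun s => f s ∉ M with hJ
    have hJS : J ⊆ S := (filter_subset _ _).trans hIS
    have hIJ : I.card ≤ J.card + M.card := by
      have h1 : (I.filter fun s => f s ∈ M).card + J.card = I.card :=
        card_filter_add_card_filter_not _
      have h2 : (I.filter fun s => f s ∈ M).card ≤ M.card := by
        refine card_le_card_of_injOn f (fun s hs => ?_) (hf.mono fun s hs => ?_)
        · exact (mem_filter.1 hs).2
        · exact hIS (mem_filter.1 hs).1
      omega
    set P := between l J (J.image f) with hP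
    have hPB : Disjoint P B := by
      rw [disjoint_left]
      intro g hg hgB
      obtain ⟨-, -, t, ht, hgt⟩ := mem_between.1 hg
      obtain ⟨s, hs, rfl⟩ := mem_image.1 ht
      exact (mem_filter.1 hs).2 (mem_filter.2 ⟨mem_image_of_mem f (hJS hs), g, hgB, hgt⟩)
    have hsub : (P ∪ B).disjSum M ⊆ A.biUnion N := by
      intro x hx
      rw [mem_biUnion]
      rcases mem_disjSum.1 hx with ⟨g, hg, rfl⟩ | ⟨t, ht, rfl⟩
      · rcases mem_union.1 hg with hg | hg
        · have hgQ : g ∈ Q := between_mono hJS (image_subset_image hJS) hg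
          obtain ⟨-, ⟨s, hs, hsg⟩, -⟩ := mem_between.1 hg
          obtain ⟨y, hy, rfl⟩ := mem_map.1 (mem_filter.1 hs).1
          refine ⟨Sum.inl y, mem_toLeft.1 hy, ?_⟩
          exact mem_map_of_mem _ (mem_filter.2 ⟨hgQ, hsg⟩)
        · obtain ⟨y, hy, rfl⟩ := mem_map.1 hg
          exact ⟨Sum.inr y, mem_toRight.1 hy, mem_insert_self _ _⟩
      · obtain ⟨htR, g, hg, hgt⟩ := mem_filter.1 ht
        obtain ⟨y, hy, rfl⟩ := mem_map.1 hg
        refine ⟨Sum.inr y, mem_toRight.1 hy, mem_insert_of_mem ?_⟩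
        exact mem_map_of_mem _ (mem_filter.2 ⟨htR, hgt⟩)
    have h3 := card_le_card hsub
    rw [card_disjSum, card_union_of_disjoint hPB] at h3
    have h4 : J.card ≤ P.card := hall J hJS
    omega
  obtain ⟨m, hm, hmN⟩ := (all_card_le_biUnion_card_iff_exists_injective N).1 hN
  have hleft : ∀ s : S, ∃ g ∈ Q, s.1 ⊆ g ∧ m (.inl s) = .inl g := by
    intro s
    obtain ⟨g, hg, hgm⟩ := mem_map.1 (hmN (.inl s))
    exact ⟨g, (mem_filter.1 hg).1, (mem_filter.1 hg).2, hgm.symm⟩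
  have hright : ∀ g : Q, m (.inr g) = .inl g.1 ∨ ∃ t ∈ R, g.1 ⊆ t ∧ m (.inr g) = .inr t := by
    intro g
    rcases mem_insert.1 (hmN (.inr g)) with h | h
    · exact Or.inl h
    · obtain ⟨t, ht, htm⟩ := mem_map.1 h
      exact Or.inr ⟨t, (mem_filter.1 ht).1, (mem_filter.1 ht).2, htm.symm⟩
  choose u huQ hsu hum using hleft
  have huinj : Function.Injective u := by
    intro a b hab
    exact Sum.inl_injective (hm (by rw [hum, hum, hab]))
  have hu' : ∀ s : S, ∃ t ∈ R, u s ⊆ t ∧ m (.inr ⟨u s, huQ s⟩) = .inr t := by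
    intro s
    refine (hright ⟨u s, huQ s⟩).resolve_left fun h => ?_
    exact Sum.inl_ne_inr (hm ((hum s).trans h.symm))
  choose v hvR huv hvm using hu'
  have hvinj : Function.Injective v := by
    intro a b hab
    have h1 := Sum.inr_injective (hm (by rw [hvm, hvm, hab] :
      m (.inr ⟨u a, huQ a⟩) = m (.inr ⟨u b, huQ b⟩)))
    exact huinj (congrArg Subtype.val h1)
  let u' : Finset β → Finset β := fun s => if h : s ∈ S then u ⟨s, h⟩ else s
  have hu'_eq : ∀ s (h : s ∈ S), u' s = u ⟨s, h⟩ := fun s h => dif_pos h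
  have hu'inj : Set.InjOn u' (S : Set (Finset β)) := by
    intro a ha b hb hab
    rw [hu'_eq a ha, hu'_eq b hb] at hab
    exact congrArg Subtype.val (huinj hab)
  refine ⟨S.image u', ?_, ⟨u', hu'inj, rfl, ?_⟩, ?_⟩
  · intro g hg
    obtain ⟨s, hs, rfl⟩ := mem_image.1 hg
    rw [hu'_eq s hs]
    exact huQ _
  · intro s hs
    rw [hu'_eq s hs]
    exact hsu ⟨s, hs⟩
  · let w : Finset β → Finset β := Function.extend u v id
    have hw : ∀ s (h : s ∈ S), w (u' s) = v ⟨s, h⟩ := by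
      intro s h
      rw [hu'_eq s h]
      exact huinj.extend_apply v id _
    have hwinj : Set.InjOn w (S.image u' : Finset (Finset β)) := by
      intro a ha b hb hab
      obtain ⟨s, hs, rfl⟩ := mem_image.1 (mem_coe.1 ha)
      obtain ⟨s', hs', rfl⟩ := mem_image.1 (mem_coe.1 hb)
      rw [hw s hs, hw s' hs'] at hab
      exact congrArg u' (congrArg Subtype.val (hvinj hab))
    refine ⟨w, hwinj, ?_, ?_⟩
    · refine eq_of_subset_of_card_le ?_ ?_
      · intro t ht
        obtain ⟨g, hg, rfl⟩ := mem_image.1 ht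
        obtain ⟨s, hs, rfl⟩ := mem_image.1 hg
        rw [hw s hs]
        exact hvR _
      · rw [card_image_of_injOn hwinj, card_image_of_injOn hu'inj]
        exact card_image_le
    · intro g hg
      obtain ⟨s, hs, rfl⟩ := mem_image.1 hg
      rw [hw s hs, hu'_eq s hs]
      exact huv _

/-- Linked uniform families can be linked through any intermediate level
(a theorem of Lehman and Ron). -/
theorem Linked.exists_intermediate {r d l : ℕ} (hrl : r ≤ l) (hld : l ≤ r + d)
    {S R : Finset (Finset β)} (hS : ∀ s ∈ S, s.card = r) (hR : ∀ t ∈ R, t.card = r + d)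
    (h : Linked S R) :
    ∃ T : Finset (Finset β), (∀ g ∈ T, g.card = l) ∧ Linked S T ∧ Linked T R := by
  induction d generalizing r l S R with
  | zero =>
    obtain rfl : l = r := by omega
    exact ⟨S, hS, Linked.refl S, h⟩
  | succ d ih =>
    rcases hrl.eq_or_lt with rfl | hlt
    · exact ⟨S, hS, Linked.refl S, h⟩
    obtain ⟨f, hf, rfl, hfs⟩ := h
    have hall : ∀ S' ⊆ S, S'.card ≤ (between (r + 1) S' (S'.image f)).card := by
      intro S'
      induction S' using Finset.strongInduction with
      | H A ihA =>
      intro hAS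
      by_contra! hlt'
      obtain ⟨s₀, hs₀⟩ := card_pos.1 (by omega : 0 < A.card)
      have hsub : A.erase s₀ ⊆ A := erase_subset _ _
      obtain ⟨T, hTsub, hT₁, hT₂⟩ := exists_linked_of_card_le (l := r + 1)
        (hf.mono (coe_subset.2 (hsub.trans hAS)))
        (fun A' hA' => ihA A' (hA'.trans_ssubset (erase_ssubset hs₀))
          ((hA'.trans hsub).trans hAS))
      have hTQ : T = between (r + 1) A (A.image f) := by
        refine eq_of_subset_of_card_le
          (hTsub.trans (between_mono hsub (image_subset_image hsub))) ?_
        rw [← hT₁.card_eq, card_erase_of_mem hs₀]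
        omega
      have hTc : ∀ g ∈ T, g.card = r + 1 := fun g hg => (mem_between.1 (hTsub hg)).1
      obtain ⟨g, hg₁, hg₂, hg₃⟩ := exists_subsuperset_card_eq (n := r + 1) (hfs s₀ (hAS hs₀))
        (by rw [hS s₀ (hAS hs₀)]; omega)
        (by rw [hR _ (mem_image_of_mem f (hAS hs₀))]; omega)
      have hgT : g ∈ T := by
        rw [hTQ, mem_between]
        exact ⟨hg₃, ⟨s₀, hs₀, hg₁⟩, f s₀, mem_image_of_mem f hs₀, hg₂⟩
      have hAR : (A.erase s₀).image f ⊆ A.image f := image_subset_image hsub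
      rcases Nat.eq_zero_or_pos d with rfl | hd
      · have : A.image f ⊆ between (r + 1) A (A.image f) := by
          intro t ht
          obtain ⟨s, hs, rfl⟩ := mem_image.1 ht
          exact mem_between.2 ⟨hR _ (mem_image_of_mem f (hAS hs)), ⟨s, hs, hfs s (hAS hs)⟩,
            f s, ht, Subset.rfl⟩
        have h1 := card_le_card this
        rw [card_image_of_injOn (hf.mono (coe_subset.2 hAS))] at h1
        omega
      · obtain ⟨Z, hZ, hTZ, hZR⟩ := ih (r := r + 1) (l := r + 2) (by omega) (by omega) hTc
          (fun t ht => by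
            rw [hR t (image_subset_image (hsub.trans hAS) ht)]; omega) hT₂
        have hTe : T = ∅ := by
          refine eq_empty_of_linked (fun s hs => hS s (hAS (hsub hs))) hTc hZ hT₁ hTZ ?_
          intro s hs z hz g hg hsg hgz
          obtain ⟨p, -, hpR, hps⟩ := hZR
          rw [hTQ, mem_between]
          exact ⟨hg, ⟨s, hsub hs, hsg⟩, p z, hAR (hpR ▸ mem_image_of_mem p hz),
            hgz.trans (hps z hz)⟩
        rw [hTe] at hgT
        exact notMem_empty _ hgT
    obtain ⟨T, hTsub, hT₁, hT₂⟩ := exists_linked_of_card_le hf hall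
    have hTc : ∀ g ∈ T, g.card = r + 1 := fun g hg => (mem_between.1 (hTsub hg)).1
    obtain ⟨W, hW, hTW, hWR⟩ := ih (r := r + 1) (l := l) hlt (by omega) hTc
      (fun t ht => by rw [hR t ht]; omega) hT₂
    exact ⟨W, hW, hT₁.trans hTW, hWR⟩

end Linked

theorem isBergeOf_iff_exists_linked {α β : Type*} [DecidableEq α] [DecidableEq β]
    {F : Finset (Finset α)} {H : Finset (Finset β)} :
    IsBergeOf F H ↔
      ∃ φ : α → β, Function.Injective φ ∧ Linked (F.image fun e => e.image φ) H := by
  constructor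
  · rintro ⟨φ, f, hφ, hf, rfl, hsub⟩
    have hinj : Function.Injective fun e : Finset α => e.image φ := image_injective hφ
    have hg : ∀ e, Function.extend (fun e : Finset α => e.image φ) f id (e.image φ) = f e :=
      fun e => hinj.extend_apply f id e
    refine ⟨φ, hφ, Function.extend (fun e : Finset α => e.image φ) f id, ?_, ?_, ?_⟩
    · intro a ha b hb hab
      obtain ⟨e, he, rfl⟩ := mem_image.1 (mem_coe.1 ha)
      obtain ⟨e', he', rfl⟩ := mem_image.1 (mem_coe.1 hb)
      simp only [hg] at hab
      rw [hf he he' hab]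
    · rw [image_image]
      exact image_congr fun e _ => hg e
    · intro a ha
      obtain ⟨e, he, rfl⟩ := mem_image.1 ha
      simp only [hg]
      exact hsub e he
  · rintro ⟨φ, hφ, g, hg, rfl, hsub⟩
    refine ⟨φ, fun e => g (e.image φ), hφ, ?_, ?_, ?_⟩
    · intro a ha b hb hab
      exact image_injective hφ (hg (mem_coe.2 (mem_image_of_mem _ ha))
        (mem_coe.2 (mem_image_of_mem _ hb)) hab)
    · rw [image_image]
      rfl
    · intro e he
      exact hsub _ (mem_image_of_mem _ he)

theorem IsBergeOf.trans {α β γ : Type*} [DecidableEq α] [DecidableEq β] [DecidableEq γ]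
    {F : Finset (Finset α)} {G : Finset (Finset β)} {H : Finset (Finset γ)}
    (h₁ : IsBergeOf F G) (h₂ : IsBergeOf G H) : IsBergeOf F H := by
  obtain ⟨φ, f, hφ, hf, rfl, hfs⟩ := h₁
  obtain ⟨ψ, g, hψ, hg, rfl, hgs⟩ := h₂
  refine ⟨ψ ∘ φ, g ∘ f, hψ.comp hφ,
    hg.comp hf fun e he => mem_coe.2 (mem_image_of_mem f he), ?_, fun e he => ?_⟩
  · rw [image_image]
  · rw [← image_image]
    exact (image_subset_image (hfs e he)).trans (hgs _ (mem_image_of_mem f he))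

theorem Linked.isBergeOf {β : Type*} [DecidableEq β] {G H : Finset (Finset β)}
    (h : Linked G H) : IsBergeOf G H :=
  isBergeOf_iff_exists_linked.2 ⟨id, Function.injective_id, by simpa using h⟩

theorem statement11 {α β : Type*} [DecidableEq α] [DecidableEq β] (r l k : ℕ)
    (hrl : r ≤ l) (hlk : l ≤ k)
    (F : Finset (Finset α)) (hF : ∀ e ∈ F, e.card = r)
    (H : Finset (Finset β)) (hH : ∀ e ∈ H, e.card = k) :
    IsBergeOf F H ↔
      ∃ G : Finset (Finset β), (∀ e ∈ G, e.card = l) ∧ IsBergeOf F G ∧ IsBergeOf G H := by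
  constructor
  · intro h
    obtain ⟨φ, hφ, hlink⟩ := isBergeOf_iff_exists_linked.1 h
    obtain ⟨d, rfl⟩ := Nat.exists_eq_add_of_le (hrl.trans hlk)
    obtain ⟨G, hG, hFG, hGH⟩ := hlink.exists_intermediate hrl hlk (fun s hs => by
      obtain ⟨e, he, rfl⟩ := mem_image.1 hs
      rw [card_image_of_injective _ hφ, hF e he]) hH
    exact ⟨G, hG, isBergeOf_iff_exists_linked.2 ⟨φ, hφ, hFG⟩, hGH.isBergeOf⟩
  · rintro ⟨G, -, hFG, hGH⟩
    exact hFG.trans hGH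
end
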